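/- arXiv:2401.08800 — 4 statements merged into one kernel-verified Lean document; each statement's English description precedes it below -/
import Mathlib

section
/- For every exceptional class e in C, there is exactly one exceptional class f with B(e,f) = 3, exactly 56 exceptional classes f with B(e,f) = 0, exactly 126 exceptional classes f with B(e,f) = 1, and exactly 56 exceptional classes f with B(e,f) = 2. -/
/-- The intersection pairing on `ℤ⁹`, the Picard lattice of a del Pezzo surface of degree 1:
`B(v, v') = a·a' - Σᵢ bᵢ·bᵢ'` for `v = (a, b₁, …, b₈)`. -/
def B (v w : Fin 9 → ℤ) : ℤ := v 0 * w 0 - ∑ i : Fin 8, v i.succ * w i.succ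

/-- The canonical class `K = (-3, -1, …, -1)`. -/
def Kcl : Fin 9 → ℤ := fun i => if i = 0 then -3 else -1

/-- A vector is an exceptional class if `B(v,v) = -1` and `B(v,K) = -1`. -/
def IsExc (v : Fin 9 → ℤ) : Prop := B v v = -1 ∧ B v Kcl = -1

def enumE : ℕ → ℤ → ℤ → List (List ℤ)
  | 0, s, q => if s = 0 ∧ q = 0 then [[]] else []
  | n+1, s, q => [Int.negSucc 1, Int.negSucc 0, Int.ofNat 0, Int.ofNat 1, Int.ofNat 2].flatMap fun x =>
      if (s-x)*(s-x) ≤ n * (q-x*x) then (enumE n (s-x) (q-x*x)).map (x :: ·) else []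

def LL : List (List ℤ) :=
  [Int.negSucc 3, Int.negSucc 2, Int.negSucc 1, Int.negSucc 0, Int.ofNat 0, Int.ofNat 1,
    Int.ofNat 2, Int.ofNat 3, Int.ofNat 4].flatMap
    fun d => (enumE 8 (3*d) (d*d+2)).map (d :: ·)

def momE (i j : ℕ) : List (List ℤ) → ℤ
  | [] => Int.ofNat 0
  | l :: m => Int.add (Int.mul (l.getD i 0) (l.getD j 0)) (momE i j m)

theorem momE_eq (i j : ℕ) (L : List (List ℤ)) :
    momE i j L = (L.map fun l => l.getD i 0 * l.getD j 0).sum := by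
  induction L with
  | nil => rfl
  | cons l m ih =>
    rw [List.map_cons, List.sum_cons, ← ih]; rfl

def JJ (i j : Fin 9) : ℤ := if i = j then (if i = 0 then 1 else -1) else 0

theorem LL_len : LL.length = 240 := by decide +kernel
theorem LL_mom : ∀ i : Fin 9, ∀ j : Fin 9, momE i j LL = 60 * (Kcl i * Kcl j - JJ i j) := by
  decide +kernel

theorem list_cs1 (t : ℤ) (l : List ℤ) :
    2 * t * l.sum ≤ l.length * (t * t) + (l.map fun x => x * x).sum := by
  induction l with
  | nil => simp
  | cons x l ih =>
    simp only [List.sum_cons, List.length_cons, List.map_cons]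
    push_cast
    nlinarith [sq_nonneg (t - x)]

theorem list_cs (l : List ℤ) :
    l.sum * l.sum ≤ l.length * (l.map fun x => x * x).sum := by
  induction l with
  | nil => simp
  | cons x l ih =>
    have := list_cs1 x l
    simp only [List.sum_cons, List.length_cons, List.map_cons]
    push_cast
    nlinarith

theorem small_mem (x : ℤ) (h : -2 ≤ x ∧ x ≤ 2) :
    x ∈ [Int.negSucc 1, Int.negSucc 0, Int.ofNat 0, Int.ofNat 1, Int.ofNat 2] := by
  obtain ⟨h1, h2⟩ := h
  interval_cases x <;> decide

theorem small_mem' (x : ℤ) (h : -4 ≤ x ∧ x ≤ 4) :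
    x ∈ [Int.negSucc 3, Int.negSucc 2, Int.negSucc 1, Int.negSucc 0, Int.ofNat 0, Int.ofNat 1,
    Int.ofNat 2, Int.ofNat 3, Int.ofNat 4] := by
  obtain ⟨h1, h2⟩ := h
  interval_cases x <;> decide

theorem enum_complete (l : List ℤ) (hl : ∀ x ∈ l, -2 ≤ x ∧ x ≤ 2) :
    l ∈ enumE l.length l.sum (l.map fun x => x * x).sum := by
  induction l with
  | nil => simp [enumE]
  | cons x l ih =>
    have h1 := ih (fun y hy => hl y (List.mem_cons_of_mem _ hy))
    have h2 := small_mem x (hl x List.mem_cons_self)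
    simp only [List.length_cons, enumE]
    rw [List.mem_flatMap]
    refine ⟨x, h2, ?_⟩
    simp only [List.sum_cons, List.map_cons, add_sub_cancel_left]
    rw [if_pos (list_cs l)]
    exact List.mem_map_of_mem h1

theorem enum_sound (n : ℕ) : ∀ (s q : ℤ) (l : List ℤ), l ∈ enumE n s q →
    l.length = n ∧ l.sum = s ∧ (l.map fun x => x * x).sum = q := by
  induction n with
  | zero =>
    intro s q l h
    simp only [enumE] at h
    split_ifs at h with h0
    · simp at h
      subst h
      simp [h0.1, h0.2]
    · simp at h
  | succ n ih =>
    intro s q l h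
    simp only [enumE] at h
    rw [List.mem_flatMap] at h
    obtain ⟨x, -, h⟩ := h
    split_ifs at h with h0
    · rw [List.mem_map] at h
      obtain ⟨m, hm, rfl⟩ := h
      obtain ⟨a, b, c⟩ := ih _ _ _ hm
      simp only [List.length_cons, List.sum_cons, List.map_cons, a, b, c]
      refine ⟨trivial, by ring, by ring⟩
    · simp at h

theorem flat_nodup (D : List ℤ) (hD : D.Nodup) (g : ℤ → List (List ℤ)) (hg : ∀ x, (g x).Nodup)
    (h : ∀ x, ∀ l ∈ g x, l.head? = some x) : (D.flatMap g).Nodup := by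
  rw [List.nodup_flatMap]
  refine ⟨fun x _ => hg x, ?_⟩
  refine List.Pairwise.imp ?_ hD
  intro a b hab l ha hb
  have h1 := h a l ha
  have h2 := h b l hb
  rw [h1] at h2
  exact hab (Option.some.inj h2)

theorem enum_nodup (n : ℕ) : ∀ (s q : ℤ), (enumE n s q).Nodup := by
  induction n with
  | zero =>
    intro s q
    simp only [enumE]
    split_ifs <;> simp
  | succ n ih =>
    intro s q
    simp only [enumE]
    apply flat_nodup _ (by decide)
    · intro x
      split_ifs
      · exact (ih _ _).map (List.cons_injective)
      · simp
    · intro x l hl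
      split_ifs at hl
      · rw [List.mem_map] at hl
        obtain ⟨m, _, rfl⟩ := hl
        rfl
      · simp at hl

theorem LL_nodup : LL.Nodup := by
  apply flat_nodup _ (by decide)
  · intro x
    exact (enum_nodup _ _ _).map (List.cons_injective)
  · intro x l hl
    rw [List.mem_map] at hl
    obtain ⟨m, _, rfl⟩ := hl
    rfl

def IsRt (r : Fin 9 → ℤ) : Prop :=
  ∑ i : Fin 8, r i.succ = 3 * r 0 ∧ ∑ i : Fin 8, r i.succ * r i.succ = r 0 * r 0 + 2

theorem rt_bound0 {r : Fin 9 → ℤ} (h : IsRt r) : -4 ≤ r 0 ∧ r 0 ≤ 4 := by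
  obtain ⟨h1, h2⟩ := h
  have := sq_sum_le_card_mul_sum_sq (s := Finset.univ) (f := fun i : Fin 8 => r i.succ)
  simp only [pow_two, h1, h2, Finset.card_univ, Fintype.card_fin] at this
  push_cast at this
  constructor <;> nlinarith

theorem rt_bound {r : Fin 9 → ℤ} (h : IsRt r) (i : Fin 8) : -2 ≤ r i.succ ∧ r i.succ ≤ 2 := by
  obtain ⟨h1, h2⟩ := h
  have := sq_sum_le_card_mul_sum_sq (s := Finset.univ.erase i) (f := fun i : Fin 8 => r i.succ)
  rw [← Finset.add_sum_erase _ _ (Finset.mem_univ i)] at h1 h2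
  rw [Finset.card_erase_of_mem (Finset.mem_univ i), Finset.card_univ, Fintype.card_fin] at this
  simp only [pow_two] at this
  rw [← eq_sub_iff_add_eq'] at h1 h2
  rw [h1, h2] at this
  norm_num at this
  have h3 : r i.succ * r i.succ ≤ 4 := by
    nlinarith [sq_nonneg (2 * r 0 - 3 * r i.succ)]
  constructor <;> nlinarith

theorem mem_LL (r : Fin 9 → ℤ) : List.ofFn r ∈ LL ↔ IsRt r := by
  rw [LL, List.mem_flatMap, List.ofFn_succ]
  constructor
  · rintro ⟨d, -, h⟩
    rw [List.mem_map] at h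
    obtain ⟨m, hm, h⟩ := h
    obtain ⟨a, b, c⟩ := enum_sound _ _ _ _ hm
    obtain ⟨rfl, rfl⟩ := List.cons.inj h
    rw [List.sum_ofFn] at b
    rw [List.map_ofFn, List.sum_ofFn] at c
    exact ⟨b, c⟩
  · intro h
    refine ⟨r 0, small_mem' _ (rt_bound0 h), ?_⟩
    apply List.mem_map_of_mem
    have := enum_complete (List.ofFn fun i : Fin 8 => r i.succ) (by
      intro x hx
      rw [List.mem_ofFn] at hx
      obtain ⟨i, rfl⟩ := hx
      exact rt_bound h i)
    rw [List.map_ofFn, List.sum_ofFn, List.sum_ofFn, List.length_ofFn, h.1] at this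
    have h2 := h.2
    simp only [Function.comp_def] at this
    rw [h2] at this
    exact this

def gE (l : List ℤ) : Fin 9 → ℤ := fun i => l.getD i 0

theorem gE_ofFn (r : Fin 9 → ℤ) : gE (List.ofFn r) = r := by
  funext i
  rw [gE, List.getD_eq_getElem _ _ (by rw [List.length_ofFn]; exact i.2), List.getElem_ofFn]

theorem ofFn_gE {l : List ℤ} (h : l.length = 9) : List.ofFn (gE l) = l := by
  apply List.ext_getElem
  · simp [h]
  · intro i h1 h2
    rw [List.getElem_ofFn]
    simp only [gE]
    exact List.getD_eq_getElem _ _ h2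

theorem LL_length {l : List ℤ} (h : l ∈ LL) : l.length = 9 := by
  rw [LL, List.mem_flatMap] at h
  obtain ⟨d, -, h⟩ := h
  rw [List.mem_map] at h
  obtain ⟨m, hm, rfl⟩ := h
  simp [(enum_sound _ _ _ _ hm).1]

theorem LF_nodup : (LL.map gE).Nodup := by
  apply LL_nodup.map_on
  intro x hx y hy h
  rw [← ofFn_gE (LL_length hx), h, ofFn_gE (LL_length hy)]

def FF : Finset (Fin 9 → ℤ) := (LL.map gE).toFinset

theorem mem_FF (r : Fin 9 → ℤ) : r ∈ FF ↔ IsRt r := by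
  rw [FF, List.mem_toFinset, List.mem_map, ← mem_LL]
  constructor
  · rintro ⟨l, hl, rfl⟩
    rwa [ofFn_gE (LL_length hl)]
  · intro h
    exact ⟨_, h, gE_ofFn r⟩

theorem FF_card : FF.card = 240 := by
  rw [FF, List.toFinset_card_of_nodup LF_nodup, List.length_map, LL_len]

theorem FF_mom (i j : Fin 9) : ∑ s ∈ FF, s i * s j = 60 * (Kcl i * Kcl j - JJ i j) := by
  rw [← LL_mom, momE_eq, FF, List.sum_toFinset _ LF_nodup, List.map_map]
  rfl

theorem FF_mom2 (w : Fin 9 → ℤ) : ∑ s ∈ FF, (∑ i, w i * s i) * (∑ j, w j * s j) =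
    ∑ i, ∑ j, w i * w j * (60 * (Kcl i * Kcl j - JJ i j)) := by
  simp only [← FF_mom, Finset.mul_sum, Finset.sum_mul]
  rw [Finset.sum_comm]
  rw [Finset.sum_congr rfl fun i _ => Finset.sum_comm]
  rw [Finset.sum_comm]
  refine Finset.sum_congr rfl fun i _ => Finset.sum_congr rfl fun j _ =>
    Finset.sum_congr rfl fun s _ => by ring

theorem FF_sq {r : Fin 9 → ℤ} (h : IsRt r) : ∑ s ∈ FF, B r s * B r s = 120 := by
  have h0 := FF_mom2 (fun i => if i = 0 then r 0 else - r i)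
  have h1 : ∀ s, ∑ i, (if i = 0 then r 0 else - r i) * s i = B r s := by
    intro s
    rw [Fin.sum_univ_succ, B]
    simp [Fin.succ_ne_zero, sub_eq_add_neg]
  simp only [h1] at h0
  rw [h0]
  have h2 : ∀ i j : Fin 9, ∀ x y : ℤ, x * y * (60 * (Kcl i * Kcl j - JJ i j)) =
      60 * ((x * Kcl i) * (y * Kcl j)) - 60 * (x * y * JJ i j) := by intros; ring
  simp only [h2, Finset.sum_sub_distrib, ← Finset.mul_sum, ← Finset.sum_mul]
  have h3 : ∑ i, (if i = 0 then r 0 else - r i) * Kcl i = 0 := by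
    rw [Fin.sum_univ_succ]
    simp [Fin.succ_ne_zero, Kcl, h.1]
    ring
  rw [h3]
  have h4 : ∀ x : Fin 9 → ℤ, ∑ i, ∑ j, x i * x j * JJ i j = B x x := by
    intro x
    simp [JJ, Fin.sum_univ_succ (n := 8), B, Fin.succ_ne_zero, (Fin.succ_ne_zero _).symm]
    ring
  rw [h4 (fun i => if i = 0 then r 0 else - r i), B]
  simp [Fin.succ_ne_zero, h.2]

theorem B_add (x y z : Fin 9 → ℤ) : B x (y + z) = B x y + B x z := by
  simp only [B, Pi.add_apply, mul_add, Finset.sum_add_distrib]; ring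

theorem B_neg (x y : Fin 9 → ℤ) : B x (-y) = - B x y := by
  simp only [B, Pi.neg_apply, mul_neg, Finset.sum_neg_distrib]; ring

theorem B_comm (x y : Fin 9 → ℤ) : B x y = B y x := by
  simp only [B, mul_comm]

theorem rt_iff (r : Fin 9 → ℤ) : IsRt r ↔ B r r = -2 ∧ B r Kcl = 0 := by
  have : B r Kcl = -3 * r 0 + ∑ i : Fin 8, r i.succ := by
    simp [B, Kcl, Fin.succ_ne_zero]; ring
  rw [this, B, IsRt]
  constructor <;> rintro ⟨h1, h2⟩ <;> constructor <;> linarith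

theorem BKK : B Kcl Kcl = 1 := by decide

theorem B_negdef (t : Fin 9 → ℤ) (h : B t Kcl = 0) : B t t ≤ 0 ∧ (B t t = 0 → t = 0) := by
  have h0 : B t Kcl = -3 * t 0 + ∑ i : Fin 8, t i.succ := by
    simp [B, Kcl, Fin.succ_ne_zero]; ring
  have := sq_sum_le_card_mul_sum_sq (s := Finset.univ) (f := fun i : Fin 8 => t i.succ)
  have h1 : ∑ i : Fin 8, t i.succ = 3 * t 0 := by linarith
  simp only [pow_two, h1, Finset.card_univ, Fintype.card_fin] at this
  push_cast at this
  rw [B]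
  refine ⟨by nlinarith, fun h2 => ?_⟩
  have h3 : t 0 * t 0 = 0 := by nlinarith
  have h4 : ∑ i : Fin 8, t i.succ * t i.succ = 0 := by linarith
  rw [Finset.sum_eq_zero_iff_of_nonneg (fun i _ => mul_self_nonneg _)] at h4
  funext i
  refine Fin.cases (by simpa using h3) (fun j => by simpa using h4 j) i

theorem rt_add {r s : Fin 9 → ℤ} (hr : IsRt r) (hs : IsRt s) :
    B r s ≤ 2 ∧ (B r s = 2 → s = -r) := by
  rw [rt_iff] at hr hs
  have h1 : B (r + s) Kcl = 0 := by
    rw [B_comm, B_add, B_comm _ r, B_comm _ s, hr.2, hs.2]; rfl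
  have h2 : B (r + s) (r + s) = -4 + 2 * B r s := by
    rw [B_add, B_comm _ r, B_comm _ s, B_add, B_add, hr.1, hs.1, B_comm s r]; ring
  obtain ⟨h3, h4⟩ := B_negdef _ h1
  refine ⟨by linarith, fun h => ?_⟩
  have := h4 (by linarith)
  exact (neg_eq_of_add_eq_zero_right this).symm

theorem rt_neg {r : Fin 9 → ℤ} (hr : IsRt r) : IsRt (-r) := by
  rw [rt_iff] at *
  rw [B_neg, B_comm, B_neg, B_comm _ Kcl, B_neg, B_comm Kcl, hr.2, hr.1]
  simp

theorem cnt_neg (r : Fin 9 → ℤ) (k : ℤ) :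
    (FF.filter fun s => B r s = -k).card = (FF.filter fun s => B r s = k).card := by
  apply Finset.card_bij (fun s _ => -s)
  · intro s hs
    rw [Finset.mem_filter, mem_FF] at *
    exact ⟨rt_neg hs.1, by rw [B_neg, hs.2, neg_neg]⟩
  · intro a _ b _ h
    exact neg_injective h
  · intro s hs
    rw [Finset.mem_filter, mem_FF] at hs
    refine ⟨-s, ?_, neg_neg s⟩
    rw [Finset.mem_filter, mem_FF]
    exact ⟨rt_neg hs.1, by rw [B_neg, hs.2]⟩

theorem cnt2 {r : Fin 9 → ℤ} (hr : IsRt r) : (FF.filter fun s => B r s = 2).card = 1 := by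
  rw [Finset.card_eq_one]
  refine ⟨-r, ?_⟩
  ext s
  rw [Finset.mem_filter, mem_FF, Finset.mem_singleton]
  constructor
  · rintro ⟨h1, h2⟩
    exact (rt_add hr h1).2 h2
  · rintro rfl
    refine ⟨rt_neg hr, ?_⟩
    rw [B_neg, ((rt_iff r).1 hr).1]; rfl

theorem cnts {r : Fin 9 → ℤ} (hr : IsRt r) :
    (FF.filter fun s => B r s = 2).card = 1 ∧ (FF.filter fun s => B r s = -1).card = 56 ∧
    (FF.filter fun s => B r s = 0).card = 126 ∧ (FF.filter fun s => B r s = 1).card = 56 := by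
  have a2 := cnt2 hr
  have am2 := cnt_neg r 2
  have am1 := cnt_neg r 1
  have hv : ∀ s ∈ FF, B r s = 2 ∨ B r s = 1 ∨ B r s = 0 ∨ B r s = -1 ∨ B r s = -2 := by
    intro s hs
    rw [mem_FF] at hs
    have h1 := (rt_add hr hs).1
    have h2 := (rt_add hr (rt_neg hs)).1
    rw [B_neg] at h2
    omega
  have hsq := FF_sq hr
  have e1 : ∑ s ∈ FF, B r s * B r s = ∑ s ∈ FF, (4 * (if B r s = 2 then 1 else 0) +
      (if B r s = 1 then 1 else 0) + (if B r s = -1 then 1 else 0)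
      + 4 * (if B r s = -2 then (1:ℤ) else 0)) := by
    refine Finset.sum_congr rfl fun s hs => ?_
    rcases hv s hs with h | h | h | h | h <;> rw [h] <;> norm_num
  have e2 : ∑ s ∈ FF, (1 : ℤ) = ∑ s ∈ FF, ((if B r s = 2 then 1 else 0) +
      (if B r s = 1 then 1 else 0) + (if B r s = 0 then 1 else 0) + (if B r s = -1 then 1 else 0)
      + (if B r s = -2 then (1:ℤ) else 0)) := by
    refine Finset.sum_congr rfl fun s hs => ?_
    rcases hv s hs with h | h | h | h | h <;> rw [h] <;> norm_num
  rw [hsq] at e1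
  simp only [Finset.sum_add_distrib, ← Finset.mul_sum, Finset.sum_boole] at e1 e2
  simp only [Finset.sum_const, FF_card, nsmul_eq_mul, mul_one, Nat.cast_ofNat] at e2
  rw [am2, am1, a2] at e1 e2
  rw [am1]
  refine ⟨a2, ?_⟩
  generalize (FF.filter fun s => B r s = 1).card = x at *
  generalize (FF.filter fun s => B r s = 0).card = y at *
  clear hsq am2 am1 a2 hv
  omega

theorem ncard_eq (e : Fin 9 → ℤ) (he : IsExc e) (k : ℤ) :
    {f : Fin 9 → ℤ | IsExc f ∧ B e f = k + 1}.ncard =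
      (FF.filter fun s => B (e + Kcl) s = k).card := by
  have key : {f : Fin 9 → ℤ | IsExc f ∧ B e f = k + 1} =
      (fun s => s + -Kcl) '' ↑(FF.filter fun s => B (e + Kcl) s = k) := by
    ext f
    simp only [Set.mem_ofPred_eq, Set.mem_image, Finset.mem_coe, Finset.mem_filter, mem_FF, rt_iff]
    obtain ⟨h1, h2⟩ := he
    have hadd : ∀ x y z : Fin 9 → ℤ, B (x + y) z = B x z + B y z := fun x y z => by
      rw [B_comm, B_add, B_comm z x, B_comm z y]
    have hneg : ∀ x y : Fin 9 → ℤ, B (-x) y = - B x y := fun x y => by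
      rw [B_comm, B_neg, B_comm]
    constructor
    · rintro ⟨⟨h3, h4⟩, h5⟩
      refine ⟨f + Kcl, ?_, by simp⟩
      have h6 := B_comm Kcl f
      simp only [hadd, B_add, BKK]
      refine ⟨⟨?_, ?_⟩, ?_⟩ <;> linarith
    · rintro ⟨s, ⟨⟨h3, h4⟩, h5⟩, rfl⟩
      have h6 := B_comm Kcl s
      simp only [hadd] at h5
      simp only [IsExc, hadd, hneg, B_add, B_neg, BKK]
      refine ⟨⟨?_, ?_⟩, ?_⟩ <;> linarith
  rw [key, Set.ncard_image_of_injective _ (add_left_injective _), Set.ncard_coe_finset]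

theorem stmt0 (e : Fin 9 → ℤ) (he : IsExc e) :
    {f : Fin 9 → ℤ | IsExc f ∧ B e f = 3}.ncard = 1 ∧
    {f : Fin 9 → ℤ | IsExc f ∧ B e f = 0}.ncard = 56 ∧
    {f : Fin 9 → ℤ | IsExc f ∧ B e f = 1}.ncard = 126 ∧
    {f : Fin 9 → ℤ | IsExc f ∧ B e f = 2}.ncard = 56 := by
  have hr : IsRt (e + Kcl) := by
    rw [rt_iff]
    obtain ⟨h1, h2⟩ := he
    have h3 := B_comm Kcl e
    rw [B_comm _ Kcl, B_add, B_add, BKK, B_comm _ e, B_add, B_comm (e + Kcl) Kcl, B_add, BKK]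
    constructor <;> linarith
  obtain ⟨a, b, c, d⟩ := cnts hr
  exact ⟨(ncard_eq e he 2).trans a, (ncard_eq e he (-1)).trans b, (ncard_eq e he 0).trans c,
    (ncard_eq e he 1).trans d⟩
end

section
/- Let e_1, e_2 be exceptional classes with B(e_1, e_2) = 3, and let f be any exceptional class. Then B(e_1, f) = 1 if and only if B(e_2, f) = 1, and B(e_1, f) = 0 if and only if B(e_2, f) = 2. -/
theorem sq_aux (w : Fin 9 → ℤ) (h0 : B w w = 0) (hK : B w Kcl = 0) : ∀ i, w i = 0 := by
  have hk : (3 : ℤ) * w 0 = ∑ i : Fin 8, w i.succ := by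
    simp [B, Kcl, Fin.succ_ne_zero] at hK
    linarith
  have hs : w 0 * w 0 = ∑ i : Fin 8, w i.succ * w i.succ := by
    unfold B at h0
    linarith
  have key : ∑ i : Fin 8, (3 * w i.succ - w 0) ^ 2 = - (w 0) ^ 2 := by
    have : ∑ i : Fin 8, (3 * w i.succ - w 0) ^ 2
        = 9 * ∑ i : Fin 8, w i.succ * w i.succ - 6 * w 0 * ∑ i : Fin 8, w i.succ
          + 8 * (w 0) ^ 2 := by
      simp only [Fin.sum_univ_eight]
      ring
    rw [this, ← hs, ← hk]
    ring
  have hnn : 0 ≤ ∑ i : Fin 8, (3 * w i.succ - w 0) ^ 2 :=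
    Finset.sum_nonneg fun i _ => sq_nonneg _
  have ha : w 0 = 0 := by
    have : (w 0) ^ 2 = 0 := le_antisymm (by linarith) (sq_nonneg _)
    exact pow_eq_zero_iff (two_ne_zero) |>.1 this
  have hz : ∑ i : Fin 8, (3 * w i.succ - w 0) ^ 2 = 0 := by rw [key, ha]; norm_num
  rw [Finset.sum_eq_zero_iff_of_nonneg fun i _ => sq_nonneg _] at hz
  intro i
  refine Fin.cases ha (fun j => ?_) i
  have := pow_eq_zero_iff (two_ne_zero) |>.1 (hz j (Finset.mem_univ j))
  linarith

theorem B_add_s1 (u v w : Fin 9 → ℤ) : B (u + v) w = B u w + B v w := by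
  simp only [B, Fin.sum_univ_eight, Pi.add_apply]
  ring

theorem B_comm' (u v : Fin 9 → ℤ) : B u v = B v u := by
  simp only [B, Fin.sum_univ_eight]
  ring

theorem stmt1 (e₁ e₂ f : Fin 9 → ℤ) (h₁ : IsExc e₁) (h₂ : IsExc e₂) (hf : IsExc f)
    (h : B e₁ e₂ = 3) :
    (B e₁ f = 1 ↔ B e₂ f = 1) ∧ (B e₁ f = 0 ↔ B e₂ f = 2) := by
  have hKK : B Kcl Kcl = 1 := by decide
  obtain ⟨a1, a2⟩ := h₁
  obtain ⟨b1, b2⟩ := h₂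
  obtain ⟨c1, c2⟩ := hf
  have hK : B (e₁ + e₂ + (Kcl + Kcl)) Kcl = 0 := by
    simp only [B_add_s1]
    linarith
  have h0 : B (e₁ + e₂ + (Kcl + Kcl)) (e₁ + e₂ + (Kcl + Kcl)) = 0 := by
    rw [B_add_s1, B_add_s1 e₁, B_add_s1 Kcl, B_comm' e₁, B_comm' e₂, B_comm' Kcl, hK]
    simp only [B_add_s1]
    linarith [B_comm' e₁ e₂, B_comm' e₁ Kcl, B_comm' e₂ Kcl]
  have hw : e₁ + e₂ + (Kcl + Kcl) = 0 := funext (sq_aux _ h0 hK)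
  have hs : B (e₁ + e₂ + (Kcl + Kcl)) f = 0 := by
    rw [hw]
    simp [B]
  simp only [B_add_s1] at hs
  rw [B_comm' Kcl f] at hs
  omega
end

section
/- The natural action of W on the set of 10-element cliques in C with weights in {1,2} has exactly 8 orbits. -/
/-- The type of exceptional classes (the set `C`). -/
abbrev Exc : Type := {v : Fin 9 → ℤ // IsExc v}

/-- The pairing on exceptional classes. -/
def Bx (x y : Exc) : ℤ := B x.1 y.1

/-- `S` is a clique with weights in `M` if `B(x,y) ∈ M` for all distinct `x, y ∈ S`. -/
def IsClique (M : Set ℤ) (S : Finset Exc) : Prop :=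
  ∀ x ∈ S, ∀ y ∈ S, x ≠ y → Bx x y ∈ M

/-- A bijection of `C` preserving the pairing `B`: an element of the Weyl group `W`. -/
def PreservesB (g : Exc ≃ Exc) : Prop := ∀ x y : Exc, Bx (g x) (g y) = Bx x y

/-- Two finite subsets of `C` lie in the same orbit of `W`. -/
def SameOrbit (S T : Finset Exc) : Prop :=
  ∃ g : Exc ≃ Exc, PreservesB g ∧ S.image g = T

/-- An exceptional class `(a, b_i)` coded by the naturals `a` and `c_i = b_i + 1`. -/
structure V where
  a : Nat
  c1 : Nat
  c2 : Nat
  c3 : Nat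
  c4 : Nat
  c5 : Nat
  c6 : Nat
  c7 : Nat
  c8 : Nat

namespace V
def lhs (u v : V) : Nat := u.a * v.a + 3 * u.a + 3 * v.a + 6
def rhs (u v : V) : Nat := u.c1 * v.c1 + u.c2 * v.c2 + u.c3 * v.c3 + u.c4 * v.c4 +
  u.c5 * v.c5 + u.c6 * v.c6 + u.c7 * v.c7 + u.c8 * v.c8
def orth (u v : V) : Bool := Nat.beq (lhs u v) (rhs u v + 1)
def adj (u v : V) : Bool := Nat.beq (lhs u v) (rhs u v + 2)
def clq (u v : V) : Bool := orth u v || adj u v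
def le1 (u v : V) : Bool := Nat.ble (lhs u v) (rhs u v + 1)
def same (u v : V) : Bool := Nat.beq u.a v.a && (Nat.beq u.c1 v.c1 && (Nat.beq u.c2 v.c2 &&
  (Nat.beq u.c3 v.c3 && (Nat.beq u.c4 v.c4 && (Nat.beq u.c5 v.c5 && (Nat.beq u.c6 v.c6 &&
  (Nat.beq u.c7 v.c7 && Nat.beq u.c8 v.c8)))))))
def mem (u : V) (l : List V) : Bool := l.any (same u)
def pack (u : V) : Nat := ((((((((u.a * 8 + u.c1) * 8 + u.c2) * 8 + u.c3) * 8 + u.c4) * 8 +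
  u.c5) * 8 + u.c6) * 8 + u.c7) * 8 + u.c8)
def isPos (u : V) : Bool := Nat.blt 3448 (1000 * u.a + 4 * u.c2 + 10 * u.c3 + 18 * u.c4 +
  28 * u.c5 + 40 * u.c6 + 54 * u.c7 + 70 * u.c8)
def valid (u : V) : Bool :=
  Nat.beq (u.c1 + u.c2 + u.c3 + u.c4 + u.c5 + u.c6 + u.c7 + u.c8) (3 * u.a + 7) &&
  Nat.beq (rhs u u) (u.a * u.a + 6 * u.a + 7)
/-- the reflection in the root `y + K` -/
def refl (y u : V) : V :=
  let t : Int := (lhs u y : Int) - (rhs u y : Int) - 1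
  ⟨((u.a : Int) + t * ((y.a : Int) - 3)).toNat, ((u.c1 : Int) + t * ((y.c1 : Int) - 2)).toNat,
   ((u.c2 : Int) + t * ((y.c2 : Int) - 2)).toNat, ((u.c3 : Int) + t * ((y.c3 : Int) - 2)).toNat,
   ((u.c4 : Int) + t * ((y.c4 : Int) - 2)).toNat, ((u.c5 : Int) + t * ((y.c5 : Int) - 2)).toNat,
   ((u.c6 : Int) + t * ((y.c6 : Int) - 2)).toNat, ((u.c7 : Int) + t * ((y.c7 : Int) - 2)).toNat,
   ((u.c8 : Int) + t * ((y.c8 : Int) - 2)).toNat⟩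
end V

def allV : List V := [
  ⟨0,1,1,1,1,1,1,1,0⟩, ⟨0,1,1,1,1,1,1,0,1⟩, ⟨0,1,1,1,1,1,0,1,1⟩, ⟨0,1,1,1,1,0,1,1,1⟩, ⟨0,1,1,1,0,1,1,1,1⟩,
  ⟨0,1,1,0,1,1,1,1,1⟩, ⟨0,1,0,1,1,1,1,1,1⟩, ⟨0,0,1,1,1,1,1,1,1⟩, ⟨1,2,2,1,1,1,1,1,1⟩, ⟨1,2,1,2,1,1,1,1,1⟩,
  ⟨1,1,2,2,1,1,1,1,1⟩, ⟨1,2,1,1,2,1,1,1,1⟩, ⟨1,1,2,1,2,1,1,1,1⟩, ⟨1,1,1,2,2,1,1,1,1⟩, ⟨1,2,1,1,1,2,1,1,1⟩,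
  ⟨1,1,2,1,1,2,1,1,1⟩, ⟨1,1,1,2,1,2,1,1,1⟩, ⟨1,2,1,1,1,1,2,1,1⟩, ⟨1,1,2,1,1,1,2,1,1⟩, ⟨1,1,1,1,2,2,1,1,1⟩,
  ⟨1,1,1,2,1,1,2,1,1⟩, ⟨1,2,1,1,1,1,1,2,1⟩, ⟨1,1,1,1,2,1,2,1,1⟩, ⟨1,1,2,1,1,1,1,2,1⟩, ⟨1,1,1,2,1,1,1,2,1⟩,
  ⟨1,1,1,1,1,2,2,1,1⟩, ⟨1,2,1,1,1,1,1,1,2⟩, ⟨1,1,1,1,2,1,1,2,1⟩, ⟨1,1,2,1,1,1,1,1,2⟩, ⟨1,1,1,2,1,1,1,1,2⟩,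
  ⟨1,1,1,1,1,2,1,2,1⟩, ⟨1,1,1,1,2,1,1,1,2⟩, ⟨1,1,1,1,1,1,2,2,1⟩, ⟨1,1,1,1,1,2,1,1,2⟩, ⟨1,1,1,1,1,1,2,1,2⟩,
  ⟨1,1,1,1,1,1,1,2,2⟩, ⟨2,2,2,2,2,2,1,1,1⟩, ⟨2,2,2,2,2,1,2,1,1⟩, ⟨2,2,2,2,1,2,2,1,1⟩, ⟨2,2,2,2,2,1,1,2,1⟩,
  ⟨2,2,2,1,2,2,2,1,1⟩, ⟨2,2,1,2,2,2,2,1,1⟩, ⟨2,2,2,2,1,2,1,2,1⟩, ⟨2,1,2,2,2,2,2,1,1⟩, ⟨2,2,2,2,2,1,1,1,2⟩,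
  ⟨2,2,2,1,2,2,1,2,1⟩, ⟨2,2,2,2,1,1,2,2,1⟩, ⟨2,2,1,2,2,2,1,2,1⟩, ⟨2,2,2,2,1,2,1,1,2⟩, ⟨2,1,2,2,2,2,1,2,1⟩,
  ⟨2,2,2,1,2,1,2,2,1⟩, ⟨2,2,2,1,2,2,1,1,2⟩, ⟨2,2,1,2,2,1,2,2,1⟩, ⟨2,2,2,2,1,1,2,1,2⟩, ⟨2,1,2,2,2,1,2,2,1⟩,
  ⟨2,2,1,2,2,2,1,1,2⟩, ⟨2,2,2,1,1,2,2,2,1⟩, ⟨2,1,2,2,2,2,1,1,2⟩, ⟨2,2,1,2,1,2,2,2,1⟩, ⟨2,2,2,1,2,1,2,1,2⟩,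
  ⟨2,1,2,2,1,2,2,2,1⟩, ⟨2,2,1,2,2,1,2,1,2⟩, ⟨2,2,2,2,1,1,1,2,2⟩, ⟨2,2,1,1,2,2,2,2,1⟩, ⟨2,1,2,2,2,1,2,1,2⟩,
  ⟨2,2,2,1,1,2,2,1,2⟩, ⟨2,1,2,1,2,2,2,2,1⟩, ⟨2,2,2,1,2,1,1,2,2⟩, ⟨2,2,1,2,1,2,2,1,2⟩, ⟨2,1,1,2,2,2,2,2,1⟩,
  ⟨2,1,2,2,1,2,2,1,2⟩, ⟨2,2,1,2,2,1,1,2,2⟩, ⟨2,1,2,2,2,1,1,2,2⟩, ⟨2,2,1,1,2,2,2,1,2⟩, ⟨2,2,2,1,1,2,1,2,2⟩,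
  ⟨2,1,2,1,2,2,2,1,2⟩, ⟨2,2,1,2,1,2,1,2,2⟩, ⟨2,1,1,2,2,2,2,1,2⟩, ⟨2,1,2,2,1,2,1,2,2⟩, ⟨2,2,2,1,1,1,2,2,2⟩,
  ⟨2,2,1,1,2,2,1,2,2⟩, ⟨2,1,2,1,2,2,1,2,2⟩, ⟨2,2,1,2,1,1,2,2,2⟩, ⟨2,1,2,2,1,1,2,2,2⟩, ⟨2,1,1,2,2,2,1,2,2⟩,
  ⟨2,2,1,1,2,1,2,2,2⟩, ⟨2,1,2,1,2,1,2,2,2⟩, ⟨2,1,1,2,2,1,2,2,2⟩, ⟨2,2,1,1,1,2,2,2,2⟩, ⟨2,1,2,1,1,2,2,2,2⟩,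
  ⟨2,1,1,2,1,2,2,2,2⟩, ⟨2,1,1,1,2,2,2,2,2⟩, ⟨3,3,2,2,2,2,2,2,1⟩, ⟨3,2,3,2,2,2,2,2,1⟩, ⟨3,2,2,3,2,2,2,2,1⟩,
  ⟨3,3,2,2,2,2,2,1,2⟩, ⟨3,2,2,2,3,2,2,2,1⟩, ⟨3,2,3,2,2,2,2,1,2⟩, ⟨3,2,2,3,2,2,2,1,2⟩, ⟨3,2,2,2,2,3,2,2,1⟩,
  ⟨3,3,2,2,2,2,1,2,2⟩, ⟨3,2,2,2,3,2,2,1,2⟩, ⟨3,2,3,2,2,2,1,2,2⟩, ⟨3,2,2,2,2,2,3,2,1⟩, ⟨3,2,2,3,2,2,1,2,2⟩,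
  ⟨3,3,2,2,2,1,2,2,2⟩, ⟨3,2,2,2,2,3,2,1,2⟩, ⟨3,2,3,2,2,1,2,2,2⟩, ⟨3,2,2,2,3,2,1,2,2⟩, ⟨3,2,2,3,2,1,2,2,2⟩,
  ⟨3,3,2,2,1,2,2,2,2⟩, ⟨3,2,2,2,2,2,2,3,1⟩, ⟨3,2,2,2,2,2,3,1,2⟩, ⟨3,2,3,2,1,2,2,2,2⟩, ⟨3,2,2,2,2,3,1,2,2⟩,
  ⟨3,2,2,2,3,1,2,2,2⟩, ⟨3,3,2,1,2,2,2,2,2⟩, ⟨3,2,2,3,1,2,2,2,2⟩, ⟨3,2,3,1,2,2,2,2,2⟩, ⟨3,3,1,2,2,2,2,2,2⟩,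
  ⟨3,1,3,2,2,2,2,2,2⟩, ⟨3,2,1,3,2,2,2,2,2⟩, ⟨3,2,2,1,3,2,2,2,2⟩, ⟨3,1,2,3,2,2,2,2,2⟩, ⟨3,2,2,2,1,3,2,2,2⟩,
  ⟨3,2,2,2,2,1,3,2,2⟩, ⟨3,2,1,2,3,2,2,2,2⟩, ⟨3,2,2,2,2,2,1,3,2⟩, ⟨3,2,2,2,2,2,2,1,3⟩, ⟨3,1,2,2,3,2,2,2,2⟩,
  ⟨3,2,2,1,2,3,2,2,2⟩, ⟨3,2,2,2,1,2,3,2,2⟩, ⟨3,2,1,2,2,3,2,2,2⟩, ⟨3,2,2,2,2,1,2,3,2⟩, ⟨3,1,2,2,2,3,2,2,2⟩,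
  ⟨3,2,2,1,2,2,3,2,2⟩, ⟨3,2,2,2,2,2,1,2,3⟩, ⟨3,2,1,2,2,2,3,2,2⟩, ⟨3,2,2,2,1,2,2,3,2⟩, ⟨3,1,2,2,2,2,3,2,2⟩,
  ⟨3,2,2,2,2,1,2,2,3⟩, ⟨3,2,2,1,2,2,2,3,2⟩, ⟨3,2,1,2,2,2,2,3,2⟩, ⟨3,2,2,2,1,2,2,2,3⟩, ⟨3,1,2,2,2,2,2,3,2⟩,
  ⟨3,2,2,1,2,2,2,2,3⟩, ⟨3,2,1,2,2,2,2,2,3⟩, ⟨3,1,2,2,2,2,2,2,3⟩, ⟨4,3,3,3,2,2,2,2,2⟩, ⟨4,3,3,2,3,2,2,2,2⟩,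
  ⟨4,3,2,3,3,2,2,2,2⟩, ⟨4,2,3,3,3,2,2,2,2⟩, ⟨4,3,3,2,2,3,2,2,2⟩, ⟨4,3,2,3,2,3,2,2,2⟩, ⟨4,2,3,3,2,3,2,2,2⟩,
  ⟨4,3,3,2,2,2,3,2,2⟩, ⟨4,3,2,2,3,3,2,2,2⟩, ⟨4,2,3,2,3,3,2,2,2⟩, ⟨4,3,2,3,2,2,3,2,2⟩, ⟨4,2,3,3,2,2,3,2,2⟩,
  ⟨4,2,2,3,3,3,2,2,2⟩, ⟨4,3,2,2,3,2,3,2,2⟩, ⟨4,3,3,2,2,2,2,3,2⟩, ⟨4,2,3,2,3,2,3,2,2⟩, ⟨4,3,2,3,2,2,2,3,2⟩,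
  ⟨4,2,2,3,3,2,3,2,2⟩, ⟨4,2,3,3,2,2,2,3,2⟩, ⟨4,3,2,2,2,3,3,2,2⟩, ⟨4,2,3,2,2,3,3,2,2⟩, ⟨4,3,2,2,3,2,2,3,2⟩,
  ⟨4,3,3,2,2,2,2,2,3⟩, ⟨4,2,3,2,3,2,2,3,2⟩, ⟨4,2,2,3,2,3,3,2,2⟩, ⟨4,3,2,3,2,2,2,2,3⟩, ⟨4,2,2,3,3,2,2,3,2⟩,
  ⟨4,3,2,2,2,3,2,3,2⟩, ⟨4,2,3,3,2,2,2,2,3⟩, ⟨4,2,2,2,3,3,3,2,2⟩, ⟨4,2,3,2,2,3,2,3,2⟩, ⟨4,3,2,2,3,2,2,2,3⟩,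
  ⟨4,2,2,3,2,3,2,3,2⟩, ⟨4,2,3,2,3,2,2,2,3⟩, ⟨4,3,2,2,2,2,3,3,2⟩, ⟨4,2,2,3,3,2,2,2,3⟩, ⟨4,2,3,2,2,2,3,3,2⟩,
  ⟨4,3,2,2,2,3,2,2,3⟩, ⟨4,2,2,2,3,3,2,3,2⟩, ⟨4,2,3,2,2,3,2,2,3⟩, ⟨4,2,2,3,2,2,3,3,2⟩, ⟨4,2,2,3,2,3,2,2,3⟩,
  ⟨4,3,2,2,2,2,3,2,3⟩, ⟨4,2,2,2,3,2,3,3,2⟩, ⟨4,2,3,2,2,2,3,2,3⟩, ⟨4,2,2,2,3,3,2,2,3⟩, ⟨4,2,2,3,2,2,3,2,3⟩,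
  ⟨4,2,2,2,2,3,3,3,2⟩, ⟨4,3,2,2,2,2,2,3,3⟩, ⟨4,2,2,2,3,2,3,2,3⟩, ⟨4,2,3,2,2,2,2,3,3⟩, ⟨4,2,2,3,2,2,2,3,3⟩,
  ⟨4,2,2,2,2,3,3,2,3⟩, ⟨4,2,2,2,3,2,2,3,3⟩, ⟨4,2,2,2,2,3,2,3,3⟩, ⟨4,2,2,2,2,2,3,3,3⟩, ⟨5,3,3,3,3,3,3,2,2⟩,
  ⟨5,3,3,3,3,3,2,3,2⟩, ⟨5,3,3,3,3,2,3,3,2⟩, ⟨5,3,3,3,3,3,2,2,3⟩, ⟨5,3,3,3,2,3,3,3,2⟩, ⟨5,3,3,3,3,2,3,2,3⟩,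
  ⟨5,3,3,2,3,3,3,3,2⟩, ⟨5,3,2,3,3,3,3,3,2⟩, ⟨5,3,3,3,2,3,3,2,3⟩, ⟨5,2,3,3,3,3,3,3,2⟩, ⟨5,3,3,3,3,2,2,3,3⟩,
  ⟨5,3,3,2,3,3,3,2,3⟩, ⟨5,3,2,3,3,3,3,2,3⟩, ⟨5,3,3,3,2,3,2,3,3⟩, ⟨5,2,3,3,3,3,3,2,3⟩, ⟨5,3,3,2,3,3,2,3,3⟩,
  ⟨5,3,3,3,2,2,3,3,3⟩, ⟨5,3,2,3,3,3,2,3,3⟩, ⟨5,2,3,3,3,3,2,3,3⟩, ⟨5,3,3,2,3,2,3,3,3⟩, ⟨5,3,2,3,3,2,3,3,3⟩,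
  ⟨5,2,3,3,3,2,3,3,3⟩, ⟨5,3,3,2,2,3,3,3,3⟩, ⟨5,3,2,3,2,3,3,3,3⟩, ⟨5,2,3,3,2,3,3,3,3⟩, ⟨5,3,2,2,3,3,3,3,3⟩,
  ⟨5,2,3,2,3,3,3,3,3⟩, ⟨5,2,2,3,3,3,3,3,3⟩, ⟨6,4,3,3,3,3,3,3,3⟩, ⟨6,3,4,3,3,3,3,3,3⟩, ⟨6,3,3,4,3,3,3,3,3⟩,
  ⟨6,3,3,3,4,3,3,3,3⟩, ⟨6,3,3,3,3,4,3,3,3⟩, ⟨6,3,3,3,3,3,4,3,3⟩, ⟨6,3,3,3,3,3,3,4,3⟩, ⟨6,3,3,3,3,3,3,3,4⟩]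

def certs : List (List Nat × List (Nat × List Nat)) := [
  ([1, 102, 111, 115, 117, 119, 130, 139, 204, 239],
   [(49, [157, 159, 155, 160]), (184, [157, 129, 150]), (137, []), (254, [132]), (73, [127, 231, 136, 160]), (20, [198, 194, 218, 159])]),
  ([1, 62, 91, 111, 115, 118, 123, 131, 204, 239],
   [(283, [124, 131]), (259, [124, 131, 120, 121]), (271, []), (247, [120, 121]), (217, [130, 160, 149]), (193, [130, 160, 149, 120, 123]), (130, [126, 167, 149, 124, 125]), (118, [126, 167, 149]), (235, [127, 236, 143]), (211, [127, 236, 143, 120, 121]), (148, [142, 232, 145, 124, 131]), (136, [142, 232, 145]), (82, [127, 236, 122, 168, 151, 181])]),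
  ([1, 83, 91, 111, 114, 115, 118, 119, 204, 239],
   [(273, [156, 204, 137, 158]), (237, [156, 204, 134, 154]), (290, [122, 132, 124, 121]), (74, []), (210, [153, 137, 168]), (70, [138, 234, 122, 185, 135, 170, 168]), (95, [133, 235, 140, 179, 135, 190, 218]), (6, [138, 234, 140, 135]), (94, [138, 234, 167, 135, 209, 187, 163])]),
  ([1, 83, 91, 110, 111, 114, 115, 121, 204, 239],
   [(131, [183, 190, 187]), (140, []), (55, [153, 134, 165, 121]), (28, [198, 215, 218]), (174, [138, 234, 140, 135, 146]), (154, [133, 235, 125, 126, 145])]),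
  ([2, 17, 43, 87, 89, 107, 111, 117, 156, 239],
   [(213, []), (4, [130, 150, 122]), (102, [190, 222, 128]), (190, [190, 147, 207, 126, 152, 122])]),
  ([17, 28, 43, 55, 91, 111, 115, 117, 152, 239],
   [(105, []), (87, [142, 162]), (132, [120, 160, 175, 133]), (249, [123, 202, 143, 162, 148, 200]), (201, [120, 199, 126, 195, 133, 226]), (274, [236, 210, 139, 141, 212]), (192, [190, 222, 142, 146, 162]), (147, [198, 237, 196])]),
  ([72, 91, 112, 114, 117, 118, 150, 182, 213, 239],
   [(24, [136, 175, 141, 146, 218]), (255, [127, 140, 125, 218]), (12, [133, 165, 184]), (27, [])]),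
  ([35, 43, 95, 111, 114, 115, 117, 118, 137, 239],
   [(58, [])])]


def getV (i : Nat) : V := allV.getD i ⟨0, 0, 1, 1, 1, 1, 1, 1, 1⟩

def key (L : List V) : Nat := (L.foldr (fun u n => u.pack * u.pack + n) 0) % 297

def wordV (w : List Nat) (L : List V) : List V := w.foldl (fun L i => L.map (V.refl (getV i))) L

def leaf (L : List V) : Bool :=
  certs.any fun p => p.2.any fun q => Nat.beq q.1 (key L) &&
    (wordV q.2 L).all (fun u => V.mem u (p.1.map getV))

def search : Nat → List V → List V → List V → List V → Bool
  | 0, _, _, _, _ => false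
  | n + 1, L, cand, perp, act =>
    bif Nat.beq L.length 10 then leaf L else
    bif Nat.blt (L.length + cand.length) 10 then true else
    match act with
    | [] => (cand.filter fun c => perp.all fun s => V.le1 c s).all fun c =>
        search n (c :: L) (cand.filter (V.clq c)) (perp.filter (V.orth c)) [c]
    | l :: act' => (((cand.filter (V.adj l)).filter fun c => perp.all fun s => V.le1 c s).all fun c =>
        search n (c :: L) (cand.filter (V.clq c)) (perp.filter (V.orth c)) (act ++ [c])) &&
        search n L (cand.filter (V.orth l)) perp act'

theorem search_true : search 30 [] allV (allV.filter V.isPos) [] = true := by decide +kernel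

theorem allV_valid : allV.all V.valid = true := by decide +kernel

/-! ### Enumeration of the exceptional classes -/

def ofRev (a : Nat) : List Nat → V
  | [c8, c7, c6, c5, c4, c3, c2, c1] => ⟨a, c1, c2, c3, c4, c5, c6, c7, c8⟩
  | _ => ⟨0, 0, 0, 0, 0, 0, 0, 0, 0⟩

def chk (a : Nat) : Nat → List Nat → Nat → Nat → Bool
  | 0, p, _, _ => V.mem (ofRev a p) allV
  | n + 1, p, s, q =>
    bif Nat.blt ((n + 1) * q) (s * s) then true else
    [0, 1, 2, 3, 4].all fun c =>
      bif Nat.ble c s && Nat.ble (c * c) q && (Nat.blt 0 n || (Nat.beq c s && Nat.beq (c * c) q))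
      then chk a n (c :: p) (s - c) (q - c * c) else true

theorem chk_true : ∀ a ∈ List.range 8, chk a 8 [] (3 * a + 7) (a * a + 6 * a + 7) = true := by
  decide +kernel

theorem list_cauchy (l : List Nat) :
    l.sum * l.sum ≤ l.length * (l.map fun c => c * c).sum := by
  induction l with
  | nil => simp
  | cons b l ih =>
    simp only [List.sum_cons, List.length_cons, List.map_cons]
    generalize l.sum = s at *
    generalize (l.map fun c => c * c).sum = q at *
    generalize l.length = n at *
    rcases Nat.eq_zero_or_pos n with h | h
    · subst h
      have : s = 0 := by nlinarith
      subst this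
      nlinarith
    · zify at *
      have h1 : (0 : ℤ) ≤ ((s : ℤ) - n * b) ^ 2 := sq_nonneg _
      have h2 : (n : ℤ) * (2 * b * s) ≤ n * (q + n * b * b) := by nlinarith
      have h3 := le_of_mul_le_mul_left h2 (by exact_mod_cast h)
      nlinarith

theorem chk_sound (a : Nat) : ∀ (n : Nat) (p : List Nat) (s q : Nat), chk a n p s q = true →
    ∀ l : List Nat, l.length = n → (∀ c ∈ l, c ≤ 4) → l.sum = s →
      (l.map fun c => c * c).sum = q → V.mem (ofRev a (l.reverse ++ p)) allV = true
  | 0, p, s, q, h, l, hl, _, _, _ => by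
    obtain rfl := List.length_eq_zero_iff.1 hl
    simpa [chk] using h
  | n + 1, p, s, q, h, l, hl, hc, hs, hq => by
    have hC := list_cauchy l
    rw [hl, hs, hq] at hC
    match l, hl with
    | c :: l, hl =>
      simp only [List.length_cons, Nat.add_right_cancel_iff] at hl
      simp only [List.sum_cons, List.map_cons] at hs hq
      rw [chk] at h
      have hb : Nat.blt ((n + 1) * q) (s * s) = false := by
        rw [Bool.eq_false_iff]; intro h'
        rw [Nat.blt_eq] at h'; omega
      rw [hb, cond_false, List.all_eq_true] at h
      have hc4 : c ≤ 4 := hc c (by simp)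
      have h' := h c (by interval_cases c <;> simp)
      have hcond : (Nat.ble c s && Nat.ble (c * c) q &&
          (Nat.blt 0 n || (Nat.beq c s && Nat.beq (c * c) q))) = true := by
        simp only [Bool.and_eq_true, Bool.or_eq_true, Nat.ble_eq, Nat.blt_eq, Nat.beq_eq]
        refine ⟨⟨by omega, by omega⟩, ?_⟩
        rcases Nat.eq_zero_or_pos n with h0 | h0
        · right
          subst h0
          obtain rfl := List.length_eq_zero_iff.1 hl
          simp at hs hq
          exact ⟨hs, hq⟩
        · exact Or.inl h0
      rw [hcond, cond_true] at h'
      have := chk_sound a n (c :: p) _ _ h' l hl (fun d hd => hc d (by simp [hd])) (by omega)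
        (by omega)
      simpa using this

theorem V.same_iff (u v : V) : V.same u v = true ↔ u = v := by
  cases u; cases v
  simp [V.same, V.mk.injEq]

theorem V.mem_iff (u : V) (l : List V) : V.mem u l = true ↔ u ∈ l := by
  simp [V.mem, List.any_eq_true, V.same_iff]

/-- the vector coded by `u` -/
def fV (u : V) : Fin 9 → ℤ :=
  ![u.a, u.c1 - 1, u.c2 - 1, u.c3 - 1, u.c4 - 1, u.c5 - 1, u.c6 - 1, u.c7 - 1, u.c8 - 1]

def cV (v : Fin 9 → ℤ) : V :=
  ⟨(v 0).toNat, (v 1 + 1).toNat, (v 2 + 1).toNat, (v 3 + 1).toNat, (v 4 + 1).toNat,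
    (v 5 + 1).toNat, (v 6 + 1).toNat, (v 7 + 1).toNat, (v 8 + 1).toNat⟩

theorem B_expand (v w : Fin 9 → ℤ) : B v w = v 0 * w 0 - (v 1 * w 1 + v 2 * w 2 + v 3 * w 3 +
    v 4 * w 4 + v 5 * w 5 + v 6 * w 6 + v 7 * w 7 + v 8 * w 8) := by
  simp only [B, Fin.sum_univ_eight]
  rfl

theorem BK_expand (v : Fin 9 → ℤ) : B v Kcl = -3 * v 0 + (v 1 + v 2 + v 3 +
    v 4 + v 5 + v 6 + v 7 + v 8) := by
  rw [B_expand]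
  simp [Kcl]
  ring

theorem cV_fV (u : V) : cV (fV u) = u := by
  cases u
  simp [cV, fV]

theorem sq18 {x : ℤ} (h : x ^ 2 ≤ 18) : -4 ≤ x ∧ x ≤ 4 := by
  constructor <;> nlinarith

theorem exc_bounds {v : Fin 9 → ℤ} (h : IsExc v) :
    0 ≤ v 0 ∧ v 0 < 8 ∧ ∀ i : Fin 9, i ≠ 0 → -1 ≤ v i ∧ v i ≤ 3 := by
  obtain ⟨h1, h2⟩ := h
  rw [B_expand] at h1
  rw [BK_expand] at h2
  have hk : (v 0 - 3) ^ 2 + ((3 * v 1 - v 0) ^ 2 + (3 * v 2 - v 0) ^ 2 + (3 * v 3 - v 0) ^ 2 +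
      (3 * v 4 - v 0) ^ 2 + (3 * v 5 - v 0) ^ 2 + (3 * v 6 - v 0) ^ 2 + (3 * v 7 - v 0) ^ 2 +
      (3 * v 8 - v 0) ^ 2) = 18 := by
    linear_combination (-9) * h1 - 6 * v 0 * h2
  have q := fun i => sq_nonneg (3 * v i - v 0)
  have q0 := sq_nonneg (v 0 - 3)
  have ha : -1 ≤ v 0 ∧ v 0 ≤ 7 := by
    have : (v 0 - 3) ^ 2 ≤ 18 := by
      linarith [q 1, q 2, q 3, q 4, q 5, q 6, q 7, q 8]
    have := sq18 this
    omega
  have hb : ∀ i : Fin 9, i ≠ 0 → (3 * v i - v 0) ^ 2 ≤ 18 := by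
    intro i hi
    have q1 := q 1
    have q2 := q 2
    have q3 := q 3
    have q4 := q 4
    have q5 := q 5
    have q6 := q 6
    have q7 := q 7
    have q8 := q 8
    fin_cases i
    · exact absurd rfl hi
    all_goals
      simp only [Fin.reduceFinMk]
      linarith
  have hb' : ∀ i : Fin 9, i ≠ 0 → -4 ≤ 3 * v i - v 0 ∧ 3 * v i - v 0 ≤ 4 := by
    intro i hi
    exact sq18 (hb i hi)
  refine ⟨?_, by omega, fun i hi => ?_⟩
  · by_contra hneg
    have h0 : v 0 = -1 := by omega
    rw [h0] at h1 h2
    have e : ∀ x : ℤ, 0 ≤ x * x + x := by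
      intro x
      rcases le_or_gt 0 x with hx | hx <;> nlinarith
    linarith [e (v 1), e (v 2), e (v 3), e (v 4), e (v 5), e (v 6), e (v 7), e (v 8)]
  · have := hb' i hi
    omega

theorem fV_cV {v : Fin 9 → ℤ} (h : IsExc v) : fV (cV v) = v := by
  obtain ⟨h0, -, hb⟩ := exc_bounds h
  have b1 := hb 1 (by decide)
  have b2 := hb 2 (by decide)
  have b3 := hb 3 (by decide)
  have b4 := hb 4 (by decide)
  have b5 := hb 5 (by decide)
  have b6 := hb 6 (by decide)
  have b7 := hb 7 (by decide)
  have b8 := hb 8 (by decide)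
  funext i
  fin_cases i <;> simp [fV, cV] <;> omega

theorem cV_mem {v : Fin 9 → ℤ} (h : IsExc v) : cV v ∈ allV := by
  have hf := fV_cV h
  obtain ⟨h0, h8, hb⟩ := exc_bounds h
  obtain ⟨h1, h2⟩ := h
  rw [← hf] at h1 h2 h8
  have b1 := hb 1 (by decide)
  have b2 := hb 2 (by decide)
  have b3 := hb 3 (by decide)
  have b4 := hb 4 (by decide)
  have b5 := hb 5 (by decide)
  have b6 := hb 6 (by decide)
  have b7 := hb 7 (by decide)
  have b8 := hb 8 (by decide)
  have hc : ∀ c ∈ [(cV v).c1, (cV v).c2, (cV v).c3, (cV v).c4, (cV v).c5, (cV v).c6, (cV v).c7,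
      (cV v).c8], c ≤ 4 := by
    simp [cV]
    omega
  generalize cV v = u at *
  rw [B_expand] at h1
  rw [BK_expand] at h2
  obtain ⟨a, c1, c2, c3, c4, c5, c6, c7, c8⟩ := u
  simp [fV] at h1 h2 h8
  have hs : [c1, c2, c3, c4, c5, c6, c7, c8].sum = 3 * a + 7 := by
    simp
    zify
    linarith
  have hq : ([c1, c2, c3, c4, c5, c6, c7, c8].map fun c => c * c).sum = a * a + 6 * a + 7 := by
    simp
    zify
    linarith
  have := chk_sound a 8 [] _ _ (chk_true a (by simp; omega)) _ rfl hc hs hq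
  rw [V.mem_iff] at this
  simpa [ofRev] using this

theorem ip_fV {u v : V} (hu : IsExc (fV u)) (hv : IsExc (fV v)) :
    B (fV u) (fV v) = (V.lhs u v : ℤ) - V.rhs u v := by
  have h1 := hu.2
  have h2 := hv.2
  rw [BK_expand] at h1 h2
  rw [B_expand]
  obtain ⟨a, c1, c2, c3, c4, c5, c6, c7, c8⟩ := u
  obtain ⟨a', d1, d2, d3, d4, d5, d6, d7, d8⟩ := v
  simp [fV, V.lhs, V.rhs] at *
  linarith

theorem exc_of_valid {u : V} (h : V.valid u = true) : IsExc (fV u) := by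
  obtain ⟨a, c1, c2, c3, c4, c5, c6, c7, c8⟩ := u
  simp only [V.valid, V.rhs, Bool.and_eq_true, Nat.beq_eq] at h
  obtain ⟨h1, h2⟩ := h
  zify at h1 h2
  constructor
  · rw [B_expand]
    simp [fV]
    linarith
  · rw [BK_expand]
    simp [fV]
    linarith

theorem exc_of_mem {u : V} (h : u ∈ allV) : IsExc (fV u) :=
  exc_of_valid (List.all_eq_true.1 allV_valid u h)

/-! ### The correspondence with `Exc` -/

def code (x : Exc) : V := cV x.1

theorem code_mem (x : Exc) : code x ∈ allV := cV_mem x.2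

theorem fV_code (x : Exc) : fV (code x) = x.1 := fV_cV x.2

theorem code_inj {x y : Exc} (h : code x = code y) : x = y := by
  apply Subtype.ext
  rw [← fV_code x, ← fV_code y, h]

theorem exists_code {u : V} (h : u ∈ allV) : ∃ x : Exc, code x = u :=
  ⟨⟨fV u, exc_of_mem h⟩, cV_fV u⟩

theorem Bx_code (x y : Exc) : Bx x y = (V.lhs (code x) (code y) : ℤ) - V.rhs (code x) (code y) := by
  have := ip_fV (u := code x) (v := code y) (by rw [fV_code]; exact x.2) (by rw [fV_code]; exact y.2)
  rw [fV_code, fV_code] at this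
  exact this

theorem orth_iff (x y : Exc) : V.orth (code x) (code y) = true ↔ Bx x y = 1 := by
  rw [Bx_code, V.orth, Nat.beq_eq]; omega

theorem adj_iff (x y : Exc) : V.adj (code x) (code y) = true ↔ Bx x y = 2 := by
  rw [Bx_code, V.adj, Nat.beq_eq]; omega

theorem le1_iff (x y : Exc) : V.le1 (code x) (code y) = true ↔ Bx x y ≤ 1 := by
  rw [Bx_code, V.le1, Nat.ble_eq]; omega

theorem clq_iff (x y : Exc) : V.clq (code x) (code y) = true ↔ Bx x y = 1 ∨ Bx x y = 2 := by
  rw [V.clq, Bool.or_eq_true, orth_iff, adj_iff]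

instance : Finite Exc := by
  have : Finite {u : V // u ∈ allV} := List.finite_toSet allV
  exact Finite.of_injective (fun x : Exc => (⟨code x, code_mem x⟩ : {u : V // u ∈ allV}))
    (fun x y h => code_inj (congrArg Subtype.val h))

theorem Bx_self (x : Exc) : Bx x x = -1 := x.2.1

theorem Bx_comm (x y : Exc) : Bx x y = Bx y x := by
  simp only [Bx, B_expand]; ring

/-! ### Reflections -/

def sv (y : Fin 9 → ℤ) : Fin 9 → ℤ := fun i => y i + Kcl i

def rv (s v : Fin 9 → ℤ) : Fin 9 → ℤ := fun i => v i + B v s * s i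

theorem rv_def (s v : Fin 9 → ℤ) : rv s v = fun i => v i + B v s * s i := rfl

theorem B_sv (v y : Fin 9 → ℤ) : B v (sv y) = B v y + B v Kcl := by
  simp only [B_expand, sv]; ring

theorem sv_self {y : Fin 9 → ℤ} (hy : IsExc y) : B (sv y) (sv y) = -2 := by
  obtain ⟨h1, h2⟩ := hy
  rw [B_expand] at h1 ⊢
  rw [BK_expand] at h2
  simp [sv, Kcl]
  linarith

theorem sv_K {y : Fin 9 → ℤ} (hy : IsExc y) : B (sv y) Kcl = 0 := by
  obtain ⟨h1, h2⟩ := hy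
  rw [BK_expand] at h2 ⊢
  simp [sv, Kcl]
  linarith

theorem B_lin (v w s : Fin 9 → ℤ) (a b : ℤ) :
    B (fun i => v i + a * s i) (fun i => w i + b * s i) =
      B v w + b * B v s + a * B w s + a * b * B s s := by
  simp only [B_expand]; ring

theorem B_lin1 (v w s : Fin 9 → ℤ) (a : ℤ) :
    B (fun i => v i + a * s i) w = B v w + a * B s w := by
  simp only [B_expand]; ring

theorem B_rv {s : Fin 9 → ℤ} (hs : B s s = -2) (v w : Fin 9 → ℤ) : B (rv s v) (rv s w) = B v w := by
  rw [rv_def, rv_def, B_lin, hs]; ring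

theorem rv_rv {s : Fin 9 → ℤ} (hs : B s s = -2) (v : Fin 9 → ℤ) : rv s (rv s v) = v := by
  have h : B (rv s v) s = - B v s := by
    rw [rv_def, B_lin1, hs]; ring
  funext i
  rw [rv, h]
  simp only [rv]; ring

theorem rv_exc {y v : Fin 9 → ℤ} (hy : IsExc y) (hv : IsExc v) : IsExc (rv (sv y) v) := by
  refine ⟨by rw [B_rv (sv_self hy)]; exact hv.1, ?_⟩
  rw [rv_def, B_lin1, sv_K hy, hv.2]; ring

/-- The reflection attached to an exceptional class. -/
def rfE (y : Exc) : Exc ≃ Exc where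
  toFun x := ⟨rv (sv y.1) x.1, rv_exc y.2 x.2⟩
  invFun x := ⟨rv (sv y.1) x.1, rv_exc y.2 x.2⟩
  left_inv x := Subtype.ext (rv_rv (sv_self y.2) x.1)
  right_inv x := Subtype.ext (rv_rv (sv_self y.2) x.1)

theorem rfE_pres (y : Exc) : PreservesB (rfE y) := fun a b => B_rv (sv_self y.2) a.1 b.1

theorem rfE_coe (y x : Exc) (i : Fin 9) :
    (rfE y x).1 i = x.1 i + (Bx x y - 1) * (y.1 i + Kcl i) := by
  change x.1 i + B x.1 (sv y.1) * _ = _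
  rw [B_sv, x.2.2]
  rfl

theorem rfE_fix {y x : Exc} (h : Bx x y = 1) : rfE y x = x := by
  apply Subtype.ext
  funext i
  rw [rfE_coe, h]; ring

theorem code_refl (y x : Exc) : code (rfE y x) = V.refl (code y) (code x) := by
  have hx := fV_code x
  have hy := fV_code y
  have hB := Bx_code x y
  rw [code, cV]
  simp only [rfE_coe, hB]
  rw [← hx, ← hy]
  generalize code x = u
  generalize code y = v
  simp only [V.refl]
  rw [V.mk.injEq]
  refine ⟨?_, ?_, ?_, ?_, ?_, ?_, ?_, ?_, ?_⟩ <;> congr 1 <;> simp [fV, Kcl] <;> ring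

def hf (v : Fin 9 → ℤ) : ℤ := 1000 * v 0 + 4 * v 2 + 10 * v 3 + 18 * v 4 +
  28 * v 5 + 40 * v 6 + 54 * v 7 + 70 * v 8

theorem isPos_sound {y : Exc} (h : V.isPos (code y) = true) : 0 < hf (sv y.1) := by
  rw [← fV_code y]
  generalize code y = u at *
  rw [V.isPos, Nat.blt_eq] at h
  simp [hf, sv, fV, Kcl]
  omega

/-- Every class can be moved by the pointwise stabilizer of `F` to a dominant one. -/
theorem exists_dominant (F : Set Exc) (x : Exc) :
    ∃ g : Exc ≃ Exc, PreservesB g ∧ (∀ y ∈ F, g y = y) ∧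
      ∀ s : Exc, (∀ y ∈ F, Bx y s = 1) → 0 < hf (sv s.1) → Bx (g x) s ≤ 1 := by
  let G := {g : Exc ≃ Exc // PreservesB g ∧ ∀ y ∈ F, g y = y}
  have : Nonempty G := ⟨⟨Equiv.refl _, fun _ _ => rfl, fun _ _ => rfl⟩⟩
  obtain ⟨⟨g, hg, hF⟩, hmax⟩ := Finite.exists_max (fun g : G => hf (g.1 x).1)
  refine ⟨g, hg, hF, fun s hs hp => ?_⟩
  have h := hmax ⟨g.trans (rfE s), fun a b => by
    rw [Equiv.trans_apply, Equiv.trans_apply, rfE_pres, hg], fun y hy => by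
    rw [Equiv.trans_apply, hF y hy, rfE_fix (hs y hy)]⟩
  simp only [Equiv.trans_apply] at h
  have e : hf (rfE s (g x)).1 = hf (g x).1 + (Bx (g x) s - 1) * hf (sv s.1) := by
    simp only [hf, rfE_coe, sv]; ring
  rw [e] at h
  by_contra hc
  have : 0 < (Bx (g x) s - 1) * hf (sv s.1) := mul_pos (by omega) hp
  omega

/-! ### The representatives -/

theorem getV_mem (i : Nat) : getV i ∈ allV := by
  rw [getV, List.getD_eq_getElem?_getD]
  rcases h : allV[i]? with _ | u
  · have : V.mem ⟨0, 0, 1, 1, 1, 1, 1, 1, 1⟩ allV = true := by decide +kernel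
    exact (V.mem_iff _ _).1 this
  · exact List.mem_of_getElem? h

def dec (i : Nat) : Exc := ⟨fV (getV i), exc_of_mem (getV_mem i)⟩

theorem code_dec (i : Nat) : code (dec i) = getV i := cV_fV _

open Classical in
noncomputable def Tset (l : List Nat) : Finset Exc := (l.map dec).toFinset

theorem mem_Tset {l : List Nat} {x : Exc} : x ∈ Tset l ↔ code x ∈ l.map getV := by
  simp only [Tset, List.mem_toFinset, List.mem_map]
  constructor
  · rintro ⟨i, hi, rfl⟩
    exact ⟨i, hi, (code_dec i).symm⟩
  · rintro ⟨i, hi, h⟩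
    exact ⟨i, hi, code_inj (by rw [code_dec, h])⟩

theorem certs_nodup : ∀ p ∈ certs, (p.1.map fun i => (getV i).pack).Nodup := by decide +kernel

theorem certs_len : ∀ p ∈ certs, p.1.length = 10 := by decide +kernel

theorem certs_clq : ∀ p ∈ certs, ∀ i ∈ p.1, ∀ j ∈ p.1, i = j ∨ V.clq (getV i) (getV j) = true := by
  decide +kernel

theorem dec_nodup {p} (hp : p ∈ certs) : (p.1.map dec).Nodup := by
  apply List.Nodup.of_map (fun x => (code x).pack)
  rw [List.map_map]
  have := certs_nodup p hp
  simpa [Function.comp_def, code_dec] using this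

theorem Tset_card {p} (hp : p ∈ certs) : (Tset p.1).card = 10 := by
  rw [Tset, List.toFinset_card_of_nodup (dec_nodup hp), List.length_map, certs_len p hp]

theorem Tset_clique {p} (hp : p ∈ certs) : IsClique {1, 2} (Tset p.1) := by
  intro x hx y hy hxy
  simp only [Tset, List.mem_toFinset, List.mem_map] at hx hy
  obtain ⟨i, hi, rfl⟩ := hx
  obtain ⟨j, hj, rfl⟩ := hy
  rcases certs_clq p hp i hi j hj with h | h
  · exact absurd (by rw [h]) hxy
  · rw [← code_dec i, ← code_dec j, clq_iff] at h
    simpa using h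

/-! ### The invariant -/

open Classical in
noncomputable def degE (S : Finset Exc) (x : Exc) : ℕ := ∑ y ∈ S, if Bx x y = 2 then 1 else 0

open Classical in
noncomputable def triE (S : Finset Exc) (x : Exc) : ℕ :=
  ∑ y ∈ S, ∑ z ∈ S, if Bx x y = 2 ∧ Bx y z = 2 ∧ Bx x z = 2 then 1 else 0

noncomputable def invE (S : Finset Exc) : ℕ := ∑ x ∈ S, (degE S x ^ 3 + 10 * triE S x)

theorem invE_eq {S T : Finset Exc} (h : SameOrbit S T) : invE S = invE T := by
  classical
  obtain ⟨g, hg, rfl⟩ := h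
  have hi : ∀ φ : Exc → ℕ, ∑ x ∈ S.image g, φ x = ∑ x ∈ S, φ (g x) := fun φ =>
    Finset.sum_image (fun a _ b _ h => g.injective h)
  have e : S.image g = Finset.image g S := by congr!
  simp only [invE, degE, triE, hi, hg _ _]

def invV (l : List V) : ℕ := (l.map fun x =>
  (l.map fun y => bif V.adj x y then 1 else 0).sum ^ 3 +
  10 * (l.map fun y => (l.map fun z =>
    bif V.adj x y && (V.adj y z && V.adj x z) then 1 else 0).sum).sum).sum

theorem invE_Tset {p} (hp : p ∈ certs) : invE (Tset p.1) = invV (p.1.map getV) := by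
  classical
  have hs : ∀ φ : Exc → ℕ, ∑ x ∈ Tset p.1, φ x = (p.1.map fun i => φ (dec i)).sum := by
    intro φ
    rw [Tset, List.sum_toFinset _ (dec_nodup hp), List.map_map]
    rfl
  simp only [invE, degE, triE, hs, invV, List.map_map, Function.comp_def, ← adj_iff, code_dec]
  simp only [Bool.cond_eq_ite, Bool.and_eq_true]

theorem inv_nodup : (certs.map fun p => invV (p.1.map getV)).Nodup := by decide +kernel

/-! ### Soundness of the search -/

theorem SameOrbit.of_image {S T : Finset Exc} {g : Exc ≃ Exc} (hg : PreservesB g)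
    (h : SameOrbit (S.image g) T) : SameOrbit S T := by
  obtain ⟨g', hg', rfl⟩ := h
  refine ⟨g.trans g', fun a b => ?_, ?_⟩
  · rw [Equiv.trans_apply, Equiv.trans_apply, hg', hg]
  · rw [Finset.image_image]
    rfl

theorem image_data {S : Finset Exc} {g : Exc ≃ Exc} (hg : PreservesB g) (hS : S.card = 10)
    (hc : IsClique {1, 2} S) : (S.image g).card = 10 ∧ IsClique {1, 2} (S.image g) := by
  refine ⟨by rw [Finset.card_image_of_injective _ g.injective, hS], ?_⟩
  intro x hx y hy hxy
  rw [Finset.mem_image] at hx hy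
  obtain ⟨x, hx, rfl⟩ := hx
  obtain ⟨y, hy, rfl⟩ := hy
  rw [hg]
  exact hc x hx y hy (fun h => hxy (by rw [h]))

theorem word_sound (w : List Nat) : ∀ (L : List V) (S : Finset Exc) , (∀ x ∈ S, code x ∈ L) →
    ∃ g : Exc ≃ Exc, PreservesB g ∧ ∀ x ∈ S.image g, code x ∈ wordV w L := by
  induction w with
  | nil =>
    intro L S h
    refine ⟨Equiv.refl _, fun _ _ => rfl, fun x hx => ?_⟩
    rw [Finset.mem_image] at hx
    obtain ⟨y, hy, rfl⟩ := hx
    exact h y hy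
  | cons i w ih =>
    intro L S h
    obtain ⟨g, hg, h'⟩ := ih (L.map (V.refl (getV i))) (S.image (rfE (dec i))) (by
      intro x hx
      rw [Finset.mem_image] at hx
      obtain ⟨y, hy, rfl⟩ := hx
      rw [code_refl, code_dec]
      exact List.mem_map_of_mem (h y hy))
    refine ⟨(rfE (dec i)).trans g, fun a b => ?_, fun x hx => ?_⟩
    · rw [Equiv.trans_apply, Equiv.trans_apply, hg, rfE_pres]
    · apply h'
      rw [Finset.image_image]
      exact hx

theorem leaf_sound {L : List V} (h : leaf L = true) {S : Finset Exc} (hS : S.card = 10)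
    (hL : ∀ x ∈ S, code x ∈ L) : ∃ p ∈ certs, SameOrbit S (Tset p.1) := by
  simp only [leaf, List.any_eq_true, Bool.and_eq_true, List.all_eq_true] at h
  obtain ⟨p, hp, q, hq, -, hall⟩ := h
  obtain ⟨g, hg, h'⟩ := word_sound q.2 L S hL
  refine ⟨p, hp, g, hg, Finset.eq_of_subset_of_card_le ?_ ?_⟩
  · intro x hx
    rw [mem_Tset]
    exact (V.mem_iff _ _).1 (hall _ (h' x hx))
  · rw [Tset_card hp, Finset.card_image_of_injective _ g.injective, hS]

/-- The invariants of a search state. -/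
structure State (S : Finset Exc) (L cand perp act : List V) : Prop where
  card : S.card = 10
  clique : IsClique {1, 2} S
  sub : ∀ u ∈ L, ∃ x ∈ S, code x = u
  nodup : L.Nodup
  cover : ∀ x ∈ S, code x ∈ L ∨ code x ∈ cand
  inv : ∀ g : Exc ≃ Exc, PreservesB g → (∀ x, code x ∈ L → g x = x) →
    ∀ x, code x ∈ cand → code (g x) ∈ cand
  perp : ∀ u ∈ perp, ∃ y : Exc, code y = u ∧ 0 < hf (sv y.1) ∧ ∀ x, code x ∈ L → Bx x y = 1
  act : ∀ u ∈ act, u ∈ L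

theorem length_le {S : Finset Exc} {L : List V} (h : ∀ x ∈ S, code x ∈ L) : S.card ≤ L.length := by
  classical
  have : S.card = (S.image code).card :=
    (Finset.card_image_of_injective _ (fun a b h => code_inj h)).symm
  rw [this]
  refine (Finset.card_le_card (t := L.toFinset) ?_).trans (List.toFinset_card_le _)
  intro u hu
  rw [Finset.mem_image] at hu
  obtain ⟨x, hx, rfl⟩ := hu
  exact List.mem_toFinset.2 (h x hx)

theorem le_length {S : Finset Exc} {L : List V} (h : ∀ u ∈ L, ∃ x ∈ S, code x = u)
    (hn : L.Nodup) : L.length ≤ S.card := by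
  classical
  have : S.card = (S.image code).card :=
    (Finset.card_image_of_injective _ (fun a b h => code_inj h)).symm
  rw [this, ← List.toFinset_card_of_nodup hn]
  apply Finset.card_le_card
  intro u hu
  obtain ⟨x, hx, rfl⟩ := h u (List.mem_toFinset.1 hu)
  exact Finset.mem_image_of_mem _ hx

/-- Adding a vertex, moved to a dominant position. -/
theorem State.add {S L cand perp act} (st : State S L cand perp act) {x : Exc} (hx : x ∈ S)
    (hxL : code x ∉ L) :
    ∃ g : Exc ≃ Exc, PreservesB g ∧ (∀ y, code y ∈ L → g y = y) ∧ code (g x) ∈ cand ∧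
      (perp.all fun s => V.le1 (code (g x)) s) = true ∧
      ∀ act', (∀ u ∈ act', u ∈ code (g x) :: L) →
        State (S.image g) (code (g x) :: L) (cand.filter (V.clq (code (g x))))
          (perp.filter (V.orth (code (g x)))) act' := by
  obtain ⟨g, hg, hfix, hdom⟩ := exists_dominant {y | code y ∈ L} x
  have hxc : code x ∈ cand := (st.cover x hx).resolve_left hxL
  refine ⟨g, hg, hfix, st.inv g hg hfix x hxc, ?_, fun act' hact => ?_⟩
  · rw [List.all_eq_true]
    intro s hs
    obtain ⟨y, rfl, hy, hyL⟩ := st.perp s hs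
    rw [le1_iff]
    exact hdom y hyL hy
  · obtain ⟨hc, hq⟩ := image_data hg st.card st.clique
    refine ⟨hc, hq, ?_, ?_, ?_, ?_, ?_, hact⟩
    · intro u hu
      rcases List.mem_cons.1 hu with rfl | hu
      · exact ⟨g x, Finset.mem_image_of_mem _ hx, rfl⟩
      · obtain ⟨y, hy, rfl⟩ := st.sub u hu
        refine ⟨y, ?_, rfl⟩
        rw [← hfix y hu]
        exact Finset.mem_image_of_mem _ hy
    · rw [List.nodup_cons]
      refine ⟨fun h => hxL ?_, st.nodup⟩
      have := g.injective (hfix _ h)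
      rwa [this] at h
    · intro z hz
      rw [Finset.mem_image] at hz
      obtain ⟨y, hy, rfl⟩ := hz
      by_cases hyL : code y ∈ L
      · left
        rw [hfix y hyL]
        exact List.mem_cons_of_mem _ hyL
      · by_cases hxy : x = y
        · left
          rw [hxy]
          exact List.mem_cons_self
        · right
          rw [List.mem_filter]
          refine ⟨st.inv g hg hfix y ((st.cover y hy).resolve_left hyL), ?_⟩
          rw [clq_iff, hg]
          simpa using st.clique x hx y hy hxy
    · intro g' hg' hfix' y hy
      rw [List.mem_filter] at hy ⊢
      refine ⟨st.inv g' hg' (fun z hz => hfix' z (List.mem_cons_of_mem _ hz)) y hy.1, ?_⟩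
      have h := hy.2
      rw [clq_iff] at h ⊢
      have e := hfix' (g x) List.mem_cons_self
      rw [← e, hg']
      exact h
    · intro u hu
      rw [List.mem_filter] at hu
      obtain ⟨y, rfl, hy, hyL⟩ := st.perp u hu.1
      refine ⟨y, rfl, hy, fun z hz => ?_⟩
      rcases List.mem_cons.1 hz with h | h
      · rw [code_inj h]
        exact (orth_iff _ _).1 hu.2
      · exact hyL z h

theorem search_sound : ∀ (n : Nat) (L cand perp act : List V), search n L cand perp act = true →
    ∀ S, State S L cand perp act → ∃ p ∈ certs, SameOrbit S (Tset p.1)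
  | 0, _, _, _, _, h, _, _ => by simp [search] at h
  | n + 1, L, cand, perp, act, h, S, st => by
    have hle := le_length st.sub st.nodup
    rw [st.card] at hle
    rw [search.eq_def] at h
    dsimp only at h
    by_cases h10 : L.length = 10
    · have : Nat.beq L.length 10 = true := by rw [Nat.beq_eq, h10]
      rw [this, cond_true] at h
      refine leaf_sound h st.card (fun x hx => ?_)
      by_contra hxL
      obtain ⟨g, -, -, -, -, H⟩ := st.add hx hxL
      have st' := H [] (by simp)
      have := le_length st'.sub st'.nodup
      rw [st'.card, List.length_cons] at this
      omega
    · have hb : Nat.beq L.length 10 = false := by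
        rw [Bool.eq_false_iff]; intro h'; rw [Nat.beq_eq] at h'; exact h10 h'
      rw [hb, cond_false] at h
      have hb2 : Nat.blt (L.length + cand.length) 10 = false := by
        rw [Bool.eq_false_iff]; intro h'
        rw [Nat.blt_eq] at h'
        have := length_le (S := S) (L := L ++ cand) (fun x hx => List.mem_append.2 (st.cover x hx))
        rw [st.card, List.length_append] at this
        omega
      rw [hb2, cond_false] at h
      match act, h, st with
      | [], h, st =>
        obtain ⟨x, hx, hxL⟩ : ∃ x ∈ S, code x ∉ L := by
          by_contra! hcon
          have := length_le hcon
          rw [st.card] at this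
          omega
        obtain ⟨g, hg, hfix, hgc, hdom, H⟩ := st.add hx hxL
        simp only [List.all_eq_true (l := List.filter _ _)] at h
        have h1 := h (code (g x)) (List.mem_filter.2 ⟨hgc, hdom⟩)
        obtain ⟨p, hp, ho⟩ := search_sound n _ _ _ _ h1 _ (H _ (by simp))
        exact ⟨p, hp, ho.of_image hg⟩
      | l :: act', h, st =>
        simp only [Bool.and_eq_true] at h
        obtain ⟨ha, hn⟩ := h
        have hl : l ∈ L := st.act l (by simp)
        obtain ⟨y, hy, rfl⟩ := st.sub l hl
        by_cases hex : ∃ x ∈ S, code x ∉ L ∧ Bx y x = 2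
        · obtain ⟨x, hx, hxL, hyx⟩ := hex
          obtain ⟨g, hg, hfix, hgc, hdom, H⟩ := st.add hx hxL
          rw [List.all_eq_true] at ha
          have h1 := ha (code (g x)) (by
            rw [List.mem_filter, List.mem_filter]
            refine ⟨⟨hgc, ?_⟩, hdom⟩
            rw [adj_iff, ← hfix y hl, hg, hyx])
          obtain ⟨p, hp, ho⟩ := search_sound n _ _ _ _ h1 _ (H _ (by
            intro u hu
            rcases List.mem_append.1 hu with hu | hu
            · exact List.mem_cons_of_mem _ (st.act u hu)
            · rw [List.mem_singleton.1 hu]; exact List.mem_cons_self))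
          exact ⟨p, hp, ho.of_image hg⟩
        · refine search_sound n _ _ _ _ hn S ⟨st.card, st.clique, st.sub, st.nodup, ?_, ?_, st.perp,
            fun u hu => st.act u (List.mem_cons_of_mem _ hu)⟩
          · intro x hx
            by_cases hxL : code x ∈ L
            · exact Or.inl hxL
            · right
              rw [List.mem_filter]
              refine ⟨(st.cover x hx).resolve_left hxL, ?_⟩
              rw [orth_iff]
              have := st.clique y hy x hx (fun h => hxL (h ▸ hl))
              simp only [Set.mem_insert_iff, Set.mem_singleton_iff] at this
              exact this.resolve_right (fun h2 => hex ⟨x, hx, hxL, h2⟩)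
          · intro g hg hfix x hx
            rw [List.mem_filter] at hx ⊢
            refine ⟨st.inv g hg hfix x hx.1, ?_⟩
            have h := hx.2
            rw [orth_iff] at h ⊢
            rw [← hfix y hl, hg, h]

/-- The action of `W` on the 10-element cliques in `C` with weights in `{1,2}` has
exactly 8 orbits. -/
theorem stmt2 :
    ∃ R : Finset (Finset Exc), R.card = 8 ∧
      (∀ S ∈ R, S.card = 10 ∧ IsClique {1, 2} S) ∧
      (∀ S : Finset Exc, S.card = 10 → IsClique {1, 2} S → ∃ T ∈ R, SameOrbit S T) ∧
      (∀ T₁ ∈ R, ∀ T₂ ∈ R, SameOrbit T₁ T₂ → T₁ = T₂) := by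
  classical
  have hnd : (certs.map fun p => Tset p.1).Nodup := by
    apply List.Nodup.of_map invE
    rw [List.map_map]
    have e : certs.map (invE ∘ fun p => Tset p.1) = certs.map fun p => invV (p.1.map getV) :=
      List.map_congr_left (fun p hp => invE_Tset hp)
    rw [e]
    exact inv_nodup
  refine ⟨(certs.map fun p => Tset p.1).toFinset, ?_, ?_, ?_, ?_⟩
  · rw [List.toFinset_card_of_nodup hnd, List.length_map]
    rfl
  · intro S hS
    rw [List.mem_toFinset, List.mem_map] at hS
    obtain ⟨p, hp, rfl⟩ := hS
    exact ⟨Tset_card hp, Tset_clique hp⟩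
  · intro S hS hc
    have st : State S [] allV (allV.filter V.isPos) [] := by
      refine ⟨hS, hc, by simp, by simp, fun x _ => Or.inr (code_mem x),
        fun g _ _ x _ => code_mem _, ?_, by simp⟩
      intro u hu
      rw [List.mem_filter] at hu
      obtain ⟨y, rfl⟩ := exists_code hu.1
      exact ⟨y, rfl, isPos_sound hu.2, by simp⟩
    obtain ⟨p, hp, ho⟩ := search_sound 30 _ _ _ _ search_true S st
    exact ⟨Tset p.1, List.mem_toFinset.2 (List.mem_map.2 ⟨p, hp, rfl⟩), ho⟩
  · intro T₁ h1 T₂ h2 ho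
    rw [List.mem_toFinset, List.mem_map] at h1 h2
    obtain ⟨p, hp, rfl⟩ := h1
    obtain ⟨q, hq, rfl⟩ := h2
    have e := invE_eq ho
    rw [invE_Tset hp, invE_Tset hq] at e
    have := List.inj_on_of_nodup_map inv_nodup hp hq e
    rw [this]
end

section
/- The number of 10-element subsets of C that are cliques with weights in {1,2} is exactly 107,700,096. -/
namespace DP1

def codes : List ℕ :=
  [573514672228042302292913602863283207982094053439751140185412877225377262740881191170176120482098569023488,
   2348542722792063752313870805168374788848465501714467551566541987199587671658327203452851669866973270179315713,
   2349115957462014884079010350552057775055897260358916044681880453160115592140357375894810088200407472108736513,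
   2349116097411885477617038949073879963284951809128116349489769940090281736652193809042378925704883339490496513,
   2349116097446052926492414444337190955030124918148811955032935928734551796746068769109065343877820799428595713,
   2349116097446061268154737534057714224315218954552381460796007990743498151741208875300487873588992590810714113,
   2349116097446061270191276187155790523941509260713612801007375928258637054659908860677971292641755398580211713,
   2349116097446061270191773388975394546475597710495390445377544719259006961618629246397250752709898909480128513,
   2349116097446061270192270955015773086489134011647841446995284401300222074776185294740521010381361524913475585,
   2349116097446061272228809608113849386115424317809072787206652338815360977694885280118004429434124332682973185,
   2349116097446061272229306809933453408649512767590850431576821129815730884653605665837283889502267843582889985,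
   2349116097446069613891132697834372655400518354212642292969724400824307332690025386309426959145296124065091585,
   2349116097446069613891629899653976677934606803994419937339893191824677239648745772028706419213439634965008385,
   2349116097446069615928168552752052977560897110155651277551261129339816142567445757406189838266202442734505985,
   2349116097480237062766508193097683647145691463233337898512890389468577392783900346376113377318233584003190785,
   2349116097480237062767005394917287669679779913015115542883059180468947299742620732095392837386377094903107585,
   2349116097480237064803544048015363969306070219176346883094427117984086202661320717472876256439139902672605185,
   2349116097480245406465867137735887238591164255579916388857499179993032557656460823664298786150311694054723585,
   2349116237430107656304536791619505835374746012002538203320779876398743537295736779523682214822709451384950785,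
   2349116237430107656305033993439109857908834461784315847690948667399113444254457165242961674890852962284867585,
   2349116237430107658341572646537186157535124767945547187902316604914252347173157150620445093943615770054365185,
   2349116237430116000003895736257709426820218804349116693665388666923198702168297256811867623654787561436483585,
   2349116237464283448879271231521020418565391913369812299208554655567468762262172216878554041827725021374582785,
   2349689472100058788069676337003188821582177770646986696436118342359271457777766951965640633156143653314371585,
   2349689472100058788070173538822792844116266220428764340806287133359641364736487337684920093224287164214288385,
   2349689472100058790106712191920869143742556526589995681017655070874780267655187323062403512277049971983785985,
   2349689472100067131769035281641392413027650562993565186780727132883726622650327429253826041988221763365904385,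
   2349689472134234580644410776904703404772823672014260792323893121527996682744202389320512460161159223304003585,
   2349689612084105174182439375426525593001878220783461097131782608458162827256038822468081297665635090685763585,
   4697658680219894498081254228568700327222661178308014496862474916681633752173353274227322126902634824924663810,
   4697658680219894498081751430388304349756749628089792141232643707682003659132073659946601586970778335824580610,
   4697658680219894500118290083486380649383039934251023481444011645197142562050773645324085006023541143594078210,
   4697658680219902841780613173206903918668133970654592987207083707206088917045913751515507535734712934976196610,
   4697658680254070290655988668470214910413307079675288592750249695850358977139788711582193953907650394914295810,
   4697658820203940884194017266992037098642361628444488897558139182780525121651625144729762791412126262296055810,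
   4698232054873892015959156812375720084849793387088937390673477648741053042133655317171721209745560464225476610,
   2349116097480245408503400558693946100765079312675376375056775590549756480691437243104331922942680628157485057,
   2349116237430116002041429157215768288994133861444576679864665077479922625203273676251900760447156495539245057,
   2349116237464283450916804652479079280739306970465272285407831066124192685297148636318587178620093955477344257,
   2349116237464291792579127742199602550024401006868841791170903128133139040292288742510009708331265746859462657,
   2349116237464291794615666395297678849650691313030073131382271065648277943210988727887493127384028554628960257,
   2349116237464291794616163597117282872184779762811850775752439856648647850169709113606772587452172065528877057,
   2349689472100067133806568702599451275201565620089025172980003543440450545685303848693859178780590697468665857,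
   2349689472134234582681944197862762266946738729109720778523169532084720605779178808760545596953528157406765057,
   2349689472134242924344267287583285536231832765513290284286241594093666960774318914951968126664699948788883457,
   2349689472134242926380805940681361835858123071674521624497609531608805863693018900329451545717462756558381057,
   2349689472134242926381303142500965858392211521456299268867778322609175770651739286048731005785606267458297857,
   2349689612084105176219972796384584455175793277878921083331059019014886750291015241908114434458004024788525057,
   2349689612084113517882295886105107724460887314282490589094131081023833105286155348099536964169175816170643457,
   2349689612084113519918834539203184024087177620443721929305499018538972008204855333477020383221938623940141057,
   2349689612084113519919331741022788046621266070225499573675667809539341915163575719196299843290082134840057857,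
   2349689612118280966757671381368418716206060423303186194637297069668103165380030308166223382342113276108742657,
   2349689612118280968794210034466495015832350729464417534848665007183242068298730293543706801394876083878240257,
   2349689612118280968794707236286099038366439179246195179218833798183611975257450679262986261463019594778157057,
   2349689612118289310456533124187018285117444765867987040611737069192188423293870399735129331106047875260358657,
   2349689612118289310457030326006622307651533215649764684981905860192558330252590785454408791174191386160275457,
   2349689612118289312493568979104698607277823521810996025193273797707697233171290770831892210226954193929773057,
   4697658680219902843818146594164962780842049027750052973406360117762812840080890170955540672527081869078958082,
   4697658680254070292693522089428273772587222136770748578949526106407082900174765131022227090700019329017057282,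
   4697658680254078634355845179148797041872316173174318084712598168416029255169905237213649620411191120399175682,
   4697658680254078636392383832246873341498606479335549424923966105931168158088605222591133039463953928168673282,
   4697658680254078636392881034066477364032694929117327069294134896931538065047325608310412499532097439068590082,
   4697658820203940886231550687950095960816276685539948883757415593337249044686601564169795928204495196398817282,
   4697658820203949227893873777670619230101370721943518389520487655346195399681741670361218457915666987780935682,
   4697658820203949229930412430768695529727661028104749729731855592861334302600441655738701876968429795550433282,
   4697658820203949229930909632588299552261749477886527374102024383861704209559162041457981337036573306450350082,
   4697658820238116676769249272933930221846543830964213995063653643990465459775616630427904876088604447719034882,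
   4697658820238116678805787926032006521472834137125445335275021581505604362694316615805388295141367255488532482,
   4697658820238116678806285127851610544006922586907222979645190372505974269653037001524667755209510766388449282,
   4697658820238125020468111015752529790757928173529014841038093643514550717689456721996810824852539046870650882,
   4697658820238125020468608217572133813292016623310792485408262434514920624648177107716090284920682557770567682,
   4697658820238125022505146870670210112918306929472023825619630372030059527566877093093573703973445365540065282,
   4698232054873892017996690233333778947023708444184397376872754059297776965168631736611754346537929398328238082,
   4698232054873900359659013323054302216308802480587966882635826121306723320163771842803176876249101189710356482,
   4698232054873900361695551976152378515935092786749198222847194058821862223082471828180660295301863997479854082,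
   4698232054873900361696049177971982538469181236530975867217362849822232130041192213899939755370007508379770882,
   4698232054908067808534388818317613208053975589608662488178992109950993380257646802869863294422038649648455682,
   4698232054908067810570927471415689507680265895769893828390360047466132283176346788247346713474801457417953282,
   4698232054908067810571424673235293530214354345551671472760528838466502190135067173966626173542944968317870082,
   4698232054908076152233250561136212776965359932173463334153432109475078638171486894438769243185973248800071682,
   4698232054908076152233747762955816799499448381955240978523600900475448545130207280158048703254116759699988482,
   4698232054908076154270286416053893099125738688116472318734968837990587448048907265535532122306879567469486082,
   4698232194857938402072417416839435396283030138377862792986881596881159524769483236017432131926514517030215682,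
   4698232194857938404108956069937511695909320444539094133198249534396298427688183221394915550979277324799713282,
   4698232194857938404109453271757115718443408894320871777568418325396668334646903607114195011047420835699630082,
   4698232194857946745771279159658034965194414480942663638961321596405244782683323327586338080690449116181831682,
   4698232194857946745771776361477638987728502930724441283331490387405614689642043713305617540758592627081748482,
   4698232194857946747808315014575715287354793236885672623542858324920753592560743698683100959811355434851246082,
   4698232194892114194646654654921345956939587589963359244504487585049514842777198287653024498863386576119930882,
   4698232194892114194647151856740949979473676039745136888874656376049884749735918673372303958931530087019847682,
   4698232194892114196683690509839026279099966345906368229086024313565023652654618658749787377984292894789345282,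
   4698232194892122538346013599559549548385060382309937734849096375573970007649758764941209907695464686171463682,
   2349689612118289312494066545145077147291359822963447026811013479748912346328846819175162467898416809363120129,
   2349689612118289312494563746964681169825448272745224671181182270749282253287567204894441927966560320263036929,
   2349689612118289314531102400062757469451738578906456011392550208264421156206267190271925347019323128032534529,
   2349689612118297656193425489783280738736832615310025517155622270273367511201407296463347876730494919414652929,
   2349689612152465105068800985046591730482005724330721122698788258917637571295282256530034294903432379352752129,
   2349689752102335698606829583568413918711060273099921427506677745847803715807118689677603132407908246734512129,
   2350262986772286830371969128952096904918492031744369920622016211808331636289148862119561550741342448663932929,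
   4697658820238125022505644436710588652931843230624474827237370054071274640724433141436843961644907980973412354,
   4697658820238125022506141638530192675465931680406252471607538845071644547683153527156123421713051491873329154,
   4697658820238125024542680291628268975092221986567483811818906782586783450601853512533606840765814299642826754,
   4697658820238133366205003381348792244377316022971053317581978844595729805596993618725029370476986091024945154,
   4697658820272300815080378876612103236122489131991748923125144833239999865690868578791715788649923550963044354,
   4697658960222171408618407475133925424351543680760949227933034320170166010202705011939284626154399418344804354,
   4698232054908076154270783982094271639139274989268923320352708520031802561206463313878802379978342182902833154,
   4698232054908076154271281183913875661673363439050700964722877311032172468165183699598081840046485693802749954,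
   4698232054908076156307819837011951961299653745211932304934245248547311371083883684975565259099248501572247554,
   4698232054908084497970142926732475230584747781615501810697317310556257726079023791166987788810420292954365954,
   4698232054942251946845518421995786222329920890636197416240483299200527786172898751233674206983357752892465154,
   4698232194857946747808812580616093827368329538038123625160598006961968705718299747026371217482818050284593154,
   4698232194857946747809309782435697849902417987819901269530766797962338612677020132745650677550961561184509954,
   4698232194857946749845848435533774149528708293981132609742134735477477515595720118123134096603724368954007554,
   4698232194857955091508171525254297418813802330384702115505206797486423870590860224314556626314896160336125954,
   4698232194892114196684188075879404819113502647058819230703763995606238765812174707093057635655755510222692354,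
   4698232194892114196684685277699008841647591096840596875073932786606608672770895092812337095723899021122609154,
   4698232194892114198721223930797085141273881403001828215285300724121747575689595078189820514776661828892106754,
   4698232194892122538346511165599928088398596683462388736466836057615185120807314813284480165366927301604810754,
   4698232194892122538347008367419532110932685133244166380837004848615555027766035199003759625435070812504727554,
   4698232194892122540383049818698004388024886989623620076678203995130324023726014798661963584419690109374308354,
   4698232194892122540384044222337212433093063889187175365418541577131063837643455570100522504555977131174141954,
   4698232194892122542420085673615684710185265745566629061259740723645832833603435169758726463540596428043722754,
   4698232194892122542420582875435288732719354195348406705629909514646202740562155555478005923608739938943639554,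
   4698232194892130882045870110238131679844069475808967226811444848139640285679875290572665574199005411656343554,
   4698232194892130884082408763336207979470359781970198567022812785654779188598575275950148993251768219425841154,
   4698232194892130884082905965155812002004448231751976211392981576655149095557295661669428453319911730325757954,
   4698232194926289989258922515780919402304148548426093326591538774774963990778610144447929462660771080212324354,
   4698232194926298330921245605501442671589242584829662832354610836783910345773750250639351992371942871594442754,
   4698232194926298332957784258599518971215532890990894172565978774299049248692450236016835411424705679363940354,
   4698232194926298332958281460419122993749621340772671816936147565299419155651170621736114871492849190263857154,
   4698232334841993133921575619039430598788029988174598025856262273060860075196571617528811881992309487655985154,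
   4698232334876160582796951114302741590533203097195293631399428261705130135290446577595498300165246947594084354,
   4698232334876168924459274204023264859818297133598863137162500323714076490285586683786920829876418738976202754,
   4698232334876168926495812857121341159444587439760094477373868261229215393204286669164404248929181546745700354,
   4698232334876168926496310058940945181978675889541872121744037052229585300163007054883683708997325057645617154,
   4698805429562073672148686565901291396766407198049846214163711252091221851166765356823201462821267822203645954,
   4698805569511944265686715164423113584995461746819046518971600739021387995678601789970770300325743689585405954,
   4698805569546111714562090659686424576740634855839742124514766727665658055772476750037456718498681149523505154,
   4698805569546120056224413749406947846025728892243311630277838789674604410767616856228879248209852940905623554,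
   4698805569546120058260952402505024145652019198404542970489206727189743313686316841606362667262615748675121154,
   4698805569546120058261449604324628168186107648186320614859375518190113220645037227325642127330759259575037954,
   7046201403011958250395124912083119916199458847066425521474729360453056225080321506642924538234324791884517379,
   7046774637681909382160264457466802902406890605710874014590067826413584145562351679084882956567758993813938179,
   7046774777631779975698293055988625090635945154480074319397957313343750290074188112232451794072234861195698179,
   7046774777665947424573668551251936082381118263500769924941123301988020350168063072299138212245172321133797379,
   7046774777665955766235991640972459351666212299904339430704195363996966705163203178490560741956344112515915779,
   7046774777665955768272530294070535651292502606065570770915563301512105608081903163868044161009106920285413379,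
   7046774777665955768273027495890139673826591055847348415285732092512475515040623549587323621077250431185330179,
   4698232194892122542421080441475667272732890496500857707247649196687417853719711603821276181280202554376986626,
   4698232194892130884083403531196190542017984532904427213010721258696364208714851710012698710991374345759105026,
   4698232194892130886119942184294266841644274839065658553222089196211503111633551695390182130044137153528602626,
   4698232194892130886120439386113870864178363288847436197592257987211873018592272081109461590112280664428519426,
   4698232194926298332958779026459501533763157641925122818553887247340634268808726670079385129164311805697204226,
   4698232194926298334995317679557577833389447948086354158765255184855773171727426655456868548217074613466701826,
   4698232194926298334995814881377181855923536397868131803135423975856143078686147041176148008285218124366618626,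
   4698232194926306676657640769278101102674541984489923664528327246864719526722566761648291077928246404848820226,
   4698232194926306676658137971097705125208630434271701308898496037865089433681287147367570537996389915748737026,
   4698232194926306678694676624195781424834920740432932649109863975380228336599987132745053957049152723518234626,
   4698232334876168926496807624981323721992212190694323123361776734270800413320563103226953966668787673078964226,
   4698232334876168928533346278079400021618502496855554463573144671785939316239263088604437385721550480848461826,
   4698232334876168928533843479899004044152590946637332107943313462786309223197983474323716845789693991748378626,
   4698232334876177270195669367799923290903596533259123969336216733794885671234403194795859915432722272230580226,
   4698232334876177270196166569619527313437684983040901613706385524795255578193123580515139375500865783130497026,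
   4698232334876177272232705222717603613063975289202132953917753462310394481111823565892622794553628590899994626,
   4698232334910344719071044863063234282648769642279819574879382722439155731328278154862546333605659732168679426,
   4698232334910344719071542064882838305182858092061597219249551513439525638286998540581825793673803243068596226,
   4698232334910344721108080717980914604809148398222828559460919450954664541205698525959309212726566050838093826,
   4698232334910353062770403807701437874094242434626398065223991512963610896200838632150731742437737842220212226,
   4698805569546120058261947170365006708199643949338771616477115200231328333802593275668912385002221875008385026,
   4698805569546120060298485823463083007825934255500002956688483137746467236721293261046395804054984682777882626,
   4698805569546120060298983025282687030360022705281780601058651928746837143680013646765675264123128193677799426,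
   4698805569546128401960808913183606277111028291903572462451555199755413591716433367237818333766156474160001026,
   4698805569546128401961306115003210299645116741685350106821723990755783498675153752957097793834299985059917826,
   4698805569546128403997844768101286599271407047846581447033091928270922401593853738334581212887062792829415426,
   4698805569580295850836184408446917268856201400924268067994721188399683651810308327304504751939093934098100226,
   4698805569580295850836681610266521291390289850706045712364889979400053558769028713023784212007237444998017026,
   4698805569580295852873220263364597591016580156867277052576257916915192461687728698401267631060000252767514626,
   4698805569580304194535543353085120860301674193270846558339329978924138816682868804592690160771172044149633026,
   4698805709530166444374213006968739457085255949693468372802610675329849796322144760452073589443569801479860226,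
   4698805709530166444374710208788343479619344399475246017172779466330219703280865146171353049511713312379777026,
   4698805709530166446411248861886419779245634705636477357384147403845358606199565131548836468564476120149274626,
   4698805709530174788073571951606943048530728742040046863147219465854304961194705237740258998275647911531393026,
   4698805709564342236948947446870254040275901851060742468690385454498575021288580197806945416448585371469492226,
   7046774777665955768273525061930518213840127356999799416903471774553690628198179597930593878748713046618677251,
   7046774777665955770310063715028594513466417663161030757114839712068829531116879583308077297801475854388174851,
   7046774777665955770310560916848198536000506112942808401485008503069199438075599969027356757869619365288091651,
   7046774777665964111972386804749117782751511699564600262877911774077775886112019689499499827512647645770293251,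
   7046774777665964111972884006568721805285600149346377907248080565078145793070740075218779287580791156670210051,
   7046774777665964114009422659666798104911890455507609247459448502593284695989440060596262706633553964439707651,
   7046774777700131560847762300012428774496684808585295868421077762722045946205894649566186245685585105708392451,
   7046774777700131560848259501832032797030773258367073512791246553722415853164615035285465705753728616608309251,
   7046774777700131562884798154930109096657063564528304853002614491237554756083315020662949124806491424377806851,
   7046774777700139904547121244650632365942157600931874358765686553246501111078455126854371654517663215759925251,
   7046774917650002154385790898534250962725739357354496173228967249652212090717731082713755083190060973090152451,
   7046774917650002154386288100353854985259827807136273817599136040652581997676451468433034543258204483990069251,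
   7046774917650002156422826753451931284886118113297505157810503978167720900595151453810517962310967291759566851,
   7046774917650010498085149843172454554171212149701074663573576040176667255590291560001940492022139083141685251,
   7046774917684177946960525338435765545916385258721770269116742028820937315684166520068626910195076543079784451,
   7047348152319953286150930443917933948933171115998944666344305715612740011199761255155713501523495175019573251,
   7047348152319953286151427645737537971467259565780722310714474506613109918158481640874992961591638685919490051,
   7047348152319953288187966298835614271093549871941953650925842444128248821077181626252476380644401493688987651,
   7047348152319961629850289388556137540378643908345523156688914506137195176072321732443898910355573285071106051,
   7047348152354129078725664883819448532123817017366218762232080494781465236166196692510585328528510745009205251,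
   7047348292303999672263693482341270720352871566135419067039969981711631380678033125658154166032986612390965251,
   4698232334910353064807937228659496736268157491721858051423267923520334819235815051590764879230106776322973698,
   4698805569580304196573076774043179722475589250366306544538606389480862739717845224032723297563540978252394498,
   4698805709530174790111105372565001910704643799135506849346495876411028884229681657180292135068016845634154498,
   4698805709564342238986480867828312902449816908156202454889661865055298944323556617246978553240954305572253698,
   4698805709564350580648803957548836171734910944559771960652733927064245299318696723438401082952126096954372098,
   4698805709564350582685342610646912471361201250721003300864101864579384202237396708815884502004888904723869698,
   4698805709564350582685839812466516493895289700502780945234270655579754109196117094535163962073032415623786498,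
   7046774777700139906584654665608691228116072658027334344964962963803225034113431546294404791310032149862686723,
   7046774917650010500122683264130513416345127206796534649772852450733391178625267979441973628814508017244446723,
   7046774917684177948998058759393824408090300315817230255316018439377661238719142939508660046987445477182545923,
   7046774917684186290660381849114347677375394352220799761079090501386607593714283045700082576698617268564664323,
   7046774917684186292696920502212423977001684658382031101290458438901746496632983031077565995751380076334161923,
   7046774917684186292697417704032027999535773108163808745660627229902116403591703416796845455819523587234078723,
   7047348152319961631887822809514196402552558965440983142888190916693919099107298151883932047147942219173867523,
   7047348152354129080763198304777507394297732074461678748431356905338189159201173111950618465320879679111966723,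
   7047348152354137422425521394498030663582826110865248254194428967347135514196313218142040995032051470494085123,
   7047348152354137424462060047596106963209116417026479594405796904862274417115013203519524414084814278263582723,
   7047348152354137424462557249415710985743204866808257238775965695862644324073733589238803874152957789163499523,
   7047348292303999674301226903299329582526786623230879053239246392268355303713009545098187302825355546493726723,
   7047348292304008015963549993019852851811880659634448559002318454277301658708149651289609832536527337875845123,
   7047348292304008018000088646117929151438170965795679899213686391792440561626849636667093251589290145645342723,
   7047348292304008018000585847937533173972259415577457543583855182792810468585570022386372711657433656545259523,
   7047348292338175464838925488283163843557053768655144164545484442921571718802024611356296250709464797813944323,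
   7047348292338175466875464141381240143183344074816375504756852380436710621720724596733779669762227605583441923,
   7047348292338175466875961343200844165717432524598153149127021171437080528679444982453059129830371116483358723,
   7047348292338183808537787231101763412468438111219945010519924442445656976715864702925202199473399396965560323,
   7047348292338183808538284432921367435002526561001722654890093233446026883674585088644481659541542907865477123,
   7047348292338183810574823086019443734628816867162953995101461170961165786593285074021965078594305715634974723,
   7047348292338183810575320652059822274642353168315404996719200853002380899750841122365235336265768331068321795,
   7047348292338183810575817853879426297176441618097182641089369644002750806709561508084514796333911841968238595,
   7047348292338183812612356506977502596802731924258413981300737581517889709628261493461998215386674649737736195,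
   7047348292338192154274679596698025866087825960661983487063809643526836064623401599653420745097846441119854595,
   7047348292372359603150055091961336857832999069682679092606975632171106124717276559720107163270783901057953795,
   7047348432322230196688083690483159046062053618451879397414865119101272269229112992867676000775259768439713795,
   7047921666992181328453223235866842032269485377096327890530203585061800189711143165309634419108693970369134595,
   9395890875112017038464801127432353537909968784757355690956560159384162484106729487571315912855185141979426820]


/-- Vertices are coded by natural numbers, digits in base `2 ^ 12`; `ip` reads `78 - B` off. -/
def ip (m n : ℕ) : ℕ := Nat.land (Nat.shiftRight (Nat.mul m n) 361) 2047

def adjN (m n : ℕ) : Bool :=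
  Nat.beq (Nat.land (Nat.shiftRight (Nat.mul m n) 362) 1023) 38

abbrev RepD : Type := ℕ × ℕ × ℕ × List (ℕ × ℕ)
abbrev Entry : Type := List ℕ × ℕ × List RepD

noncomputable def filtK {α : Type} (p : ℕ → Bool) (f : List ℕ → α) (P : List ℕ) :
    List ℕ → α :=
  List.rec (motive := fun _ => List ℕ → α) (fun acc => f acc)
    (fun v _ ih acc => cond (p v) (ih (v :: acc)) (ih acc)) P

noncomputable def lenK (P : List ℕ) : ℕ :=
  List.rec (motive := fun _ => ℕ) 0 (fun _ _ ih => Nat.add ih 1) P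

noncomputable def btStep (f : List ℕ → ℕ) (P : List ℕ) : ℕ :=
  List.rec (motive := fun _ => ℕ) 0 (fun v P ih => Nat.add (filtK (adjN v) f P []) ih) P

/-- `bt k P` counts the `(k+1)`-cliques in `P`. -/
noncomputable def bt (k : ℕ) : List ℕ → ℕ :=
  Nat.rec (motive := fun _ => List ℕ → ℕ) lenK (fun _ ih => btStep ih) k

noncomputable def getK {α : Type} (dflt : ℕ) (f : ℕ → α) (l : List ℕ) : ℕ → α :=
  List.rec (motive := fun _ => ℕ → α) (fun _ => f dflt)
    (fun v _ ih i => Nat.rec (motive := fun _ => α) (f v) (fun j _ => ih j) i) l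

noncomputable def nthK {α : Type} (i : ℕ) (f : ℕ → α) : α := getK 573514672228042302292913602863283207982094053439751140185412877225377262740881191170176120482098569023488 f codes i

noncomputable def nbrK {α : Type} (f : List ℕ → α) (L : List ℕ) : List ℕ → α :=
  List.rec (motive := fun _ => List ℕ → α) f
    (fun i _ ih P => nthK i fun l => filtK (adjN l) ih P []) L

noncomputable def allK {β : Type} (p : β → Bool) (P : List β) : Bool :=
  List.rec (motive := fun _ => Bool) true (fun v _ ih => cond (p v) ih false) P

noncomputable def anyK {β : Type} (p : β → Bool) (P : List β) : Bool :=
  List.rec (motive := fun _ => Bool) false (fun v _ ih => cond (p v) true ih) P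

noncomputable def leafChk (k : ℕ) (K : List (List ℕ × ℕ)) : Bool :=
  allK (fun e => Nat.beq (nbrK (bt k) e.1 codes) e.2) K

noncomputable def forceK {α : Type} (n : ℕ) (f : ℕ → α) : α :=
  Nat.rec (motive := fun _ => α) (f 0) (fun m _ => f (Nat.succ m)) n

/-- The code of the image of `l` under the reflection in the root `p - q`. -/
def reflN (p q l : ℕ) : ℕ :=
  Nat.sub (Nat.add l (Nat.add (Nat.mul (ip l q) p) (Nat.mul (ip l p) q)))
    (Nat.add (Nat.mul (ip l q) q) (Nat.mul (ip l p) p))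

noncomputable def mapK {α : Type} (g : ℕ → ℕ) (f : List ℕ → α) (L : List ℕ) : List ℕ → α :=
  List.rec (motive := fun _ => List ℕ → α) (fun acc => f acc)
    (fun v _ ih acc => forceK (g v) fun z => ih (z :: acc)) L

noncomputable def wordK (f : List ℕ → Bool) (w : List (ℕ × ℕ)) : List ℕ → Bool :=
  List.rec (motive := fun _ => List ℕ → Bool) f
    (fun pq _ ih L => nthK pq.1 fun p => nthK pq.2 fun q =>
      cond (Nat.beq (ip p q) 78) (mapK (reflN p q) ih L []) false) w

noncomputable def subK (L T : List ℕ) : Bool := allK (fun x => anyK (Nat.beq x) T) L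

noncomputable def codK {α : Type} (f : List ℕ → α) (L : List ℕ) : List ℕ → α :=
  List.rec (motive := fun _ => List ℕ → α) (fun acc => f acc)
    (fun i _ ih acc => nthK i fun z => ih (z :: acc)) L

noncomputable def kget {α : Type} (f : List ℕ × ℕ → α) (d : α) (K : List (List ℕ × ℕ)) : ℕ → α :=
  List.rec (motive := fun _ => ℕ → α) (fun _ => d)
    (fun v _ ih i => Nat.rec (motive := fun _ => α) (f v) (fun j _ => ih j) i) K

noncomputable def repChk (K : List (List ℕ × ℕ)) (L : List ℕ) (r : RepD) : Bool :=
  kget (fun e => cond (Nat.beq e.2 r.2.1)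
    (codK (fun T => codK (fun L' => wordK (fun L'' => cond (subK L'' T) (subK T L'') false)
      r.2.2.2 L') (r.1 :: L) []) e.1 []) false) false K r.2.2.1

noncomputable def prof (L : List ℕ) (u w : ℕ) : Bool :=
  allK (fun l => Nat.beq (ip l u) (ip l w)) L

noncomputable def conn (L P : List ℕ) (u w : ℕ) : Bool :=
  cond (Nat.beq u w) true (cond (prof L u w)
    (cond (Nat.beq (ip u w) 78) true
      (anyK (fun z => cond (Nat.beq (ip u z) 78)
        (cond (Nat.beq (ip z w) 78) (prof L u z) false) false) P)) false)

noncomputable def lookK (L P : List ℕ) (w : ℕ) (f : ℕ → Bool) (R : List RepD) : Bool :=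
  List.rec (motive := fun _ => Bool) false
    (fun r _ ih => cond (nthK r.1 fun u => conn L P u w) (f r.2.1) ih) R

noncomputable def sumK (L P0 : List ℕ) (R : List RepD) (tot : ℕ) (P : List ℕ) : ℕ → Bool :=
  List.rec (motive := fun _ => ℕ → Bool) (fun acc => Nat.beq acc tot)
    (fun w _ ih acc => lookK L P0 w (fun v => forceK (Nat.add acc v) ih) R) P

noncomputable def entryChk (k : ℕ) (K : List (List ℕ × ℕ)) (e : Entry) : Bool :=
  cond (allK (repChk K e.1) e.2.2)
    (nbrK (fun P => codK (fun L => sumK L P e.2.2 (Nat.mul (Nat.succ k) e.2.1) P 0) e.1 [])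
      e.1 codes) false

noncomputable def stepChk (k : ℕ) (K : List (List ℕ × ℕ)) (S : List Entry) : Bool :=
  allK (entryChk k K) S


/-- The code of a class, as an affine function with values in `ℤ`. -/
def encZ (v : Fin 9 → ℤ) : ℤ :=
  (v 1 + 1) * 4096 ^ 0 + (v 2 + 1) * 4096 ^ 1 + (v 3 + 1) * 4096 ^ 2 + (v 4 + 1) * 4096 ^ 3 + (v 5 + 1) * 4096 ^ 4 + (v 6 + 1) * 4096 ^ 5 + (v 7 + 1) * 4096 ^ 6 + (v 8 + 1) * 4096 ^ 7 + (v 0 + 3) * 4096 ^ 8 + (54 - 9 * v 0) * 4096 ^ 9 +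
  4096 ^ 21 * (1 * 4096 ^ 0 + (6 - v 0) * 4096 ^ 1 + (v 1 + 1) * 4096 ^ 9 + (v 2 + 1) * 4096 ^ 8 + (v 3 + 1) * 4096 ^ 7 + (v 4 + 1) * 4096 ^ 6 + (v 5 + 1) * 4096 ^ 5 + (v 6 + 1) * 4096 ^ 4 + (v 7 + 1) * 4096 ^ 3 + (v 8 + 1) * 4096 ^ 2)

def enc (x : Exc) : ℕ := (encZ x.1).toNat

theorem B_eq (v w : Fin 9 → ℤ) : B v w = v 0 * w 0 - (v 1 * w 1 + v 2 * w 2 + v 3 * w 3 + v 4 * w 4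
    + v 5 * w 5 + v 6 * w 6 + v 7 * w 7 + v 8 * w 8) := by
  simp only [B, Fin.sum_univ_eight]
  rfl

theorem Kcl_eq (v : Fin 9 → ℤ) : B v Kcl = -3 * v 0 + (v 1 + v 2 + v 3 + v 4 + v 5 + v 6 + v 7 + v 8) := by
  rw [B_eq]
  simp [Kcl]
  ring

theorem exc_eqs (x : Exc) : 
    x.1 1 + x.1 2 + x.1 3 + x.1 4 + x.1 5 + x.1 6 + x.1 7 + x.1 8 = 3 * x.1 0 - 1 ∧
    x.1 1 ^ 2 + x.1 2 ^ 2 + x.1 3 ^ 2 + x.1 4 ^ 2 + x.1 5 ^ 2 + x.1 6 ^ 2 + x.1 7 ^ 2 + x.1 8 ^ 2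
      = x.1 0 ^ 2 + 1 := by
  obtain ⟨v, h1, h2⟩ := x
  rw [Kcl_eq] at h2
  rw [B_eq] at h1
  constructor
  · simp only; linarith
  · simp only; linarith

theorem cs7 (a b c d e f g : ℤ) : (a + b + c + d + e + f + g) ^ 2 ≤
    7 * (a ^ 2 + b ^ 2 + c ^ 2 + d ^ 2 + e ^ 2 + f ^ 2 + g ^ 2) := by
  have h := sq_sum_le_card_mul_sum_sq (s := Finset.univ) (f := ![a, b, c, d, e, f, g])
  simpa [Fin.sum_univ_seven] using h

theorem bnd_aux (a b : ℤ) (h : (3 * a - 1 - b) ^ 2 ≤ 7 * (a ^ 2 + 1 - b ^ 2)) :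
    (0 ≤ a ∧ a ≤ 6) ∧ (-1 ≤ b ∧ b ≤ 3) := by
  have h1 : -1 ≤ a := by nlinarith [sq_nonneg (8 * b - (3 * a - 1))]
  have h2 : a ≤ 7 := by nlinarith [sq_nonneg (8 * b - (3 * a - 1))]
  have h3 : -8 ≤ b := by nlinarith [sq_nonneg (3 * a - 1 - b)]
  have h4 : b ≤ 8 := by nlinarith [sq_nonneg (3 * a - 1 - b)]
  interval_cases a <;> interval_cases b <;> simp_all

theorem bnds (x : Exc) : (0 ≤ x.1 0 ∧ x.1 0 ≤ 6) ∧ ∀ i : Fin 8, -1 ≤ x.1 i.succ ∧ x.1 i.succ ≤ 3 := by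
  obtain ⟨h1, h2⟩ := exc_eqs x
  have key : ∀ i : Fin 8, (3 * x.1 0 - 1 - x.1 i.succ) ^ 2 ≤ 7 * (x.1 0 ^ 2 + 1 - x.1 i.succ ^ 2) := by
    intro i
    fin_cases i
    · have h := cs7 (x.1 2) (x.1 3) (x.1 4) (x.1 5) (x.1 6) (x.1 7) (x.1 8)
      have e : 3 * x.1 0 - 1 - x.1 1 = (x.1 2) + (x.1 3) + (x.1 4) + (x.1 5) + (x.1 6) + (x.1 7) + (x.1 8) := by linarith
      change (3 * x.1 0 - 1 - x.1 1) ^ 2 ≤ 7 * (x.1 0 ^ 2 + 1 - x.1 1 ^ 2)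
      rw [e]
      linarith
    · have h := cs7 (x.1 1) (x.1 3) (x.1 4) (x.1 5) (x.1 6) (x.1 7) (x.1 8)
      have e : 3 * x.1 0 - 1 - x.1 2 = (x.1 1) + (x.1 3) + (x.1 4) + (x.1 5) + (x.1 6) + (x.1 7) + (x.1 8) := by linarith
      change (3 * x.1 0 - 1 - x.1 2) ^ 2 ≤ 7 * (x.1 0 ^ 2 + 1 - x.1 2 ^ 2)
      rw [e]
      linarith
    · have h := cs7 (x.1 1) (x.1 2) (x.1 4) (x.1 5) (x.1 6) (x.1 7) (x.1 8)
      have e : 3 * x.1 0 - 1 - x.1 3 = (x.1 1) + (x.1 2) + (x.1 4) + (x.1 5) + (x.1 6) + (x.1 7) + (x.1 8) := by linarith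
      change (3 * x.1 0 - 1 - x.1 3) ^ 2 ≤ 7 * (x.1 0 ^ 2 + 1 - x.1 3 ^ 2)
      rw [e]
      linarith
    · have h := cs7 (x.1 1) (x.1 2) (x.1 3) (x.1 5) (x.1 6) (x.1 7) (x.1 8)
      have e : 3 * x.1 0 - 1 - x.1 4 = (x.1 1) + (x.1 2) + (x.1 3) + (x.1 5) + (x.1 6) + (x.1 7) + (x.1 8) := by linarith
      change (3 * x.1 0 - 1 - x.1 4) ^ 2 ≤ 7 * (x.1 0 ^ 2 + 1 - x.1 4 ^ 2)
      rw [e]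
      linarith
    · have h := cs7 (x.1 1) (x.1 2) (x.1 3) (x.1 4) (x.1 6) (x.1 7) (x.1 8)
      have e : 3 * x.1 0 - 1 - x.1 5 = (x.1 1) + (x.1 2) + (x.1 3) + (x.1 4) + (x.1 6) + (x.1 7) + (x.1 8) := by linarith
      change (3 * x.1 0 - 1 - x.1 5) ^ 2 ≤ 7 * (x.1 0 ^ 2 + 1 - x.1 5 ^ 2)
      rw [e]
      linarith
    · have h := cs7 (x.1 1) (x.1 2) (x.1 3) (x.1 4) (x.1 5) (x.1 7) (x.1 8)
      have e : 3 * x.1 0 - 1 - x.1 6 = (x.1 1) + (x.1 2) + (x.1 3) + (x.1 4) + (x.1 5) + (x.1 7) + (x.1 8) := by linarith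
      change (3 * x.1 0 - 1 - x.1 6) ^ 2 ≤ 7 * (x.1 0 ^ 2 + 1 - x.1 6 ^ 2)
      rw [e]
      linarith
    · have h := cs7 (x.1 1) (x.1 2) (x.1 3) (x.1 4) (x.1 5) (x.1 6) (x.1 8)
      have e : 3 * x.1 0 - 1 - x.1 7 = (x.1 1) + (x.1 2) + (x.1 3) + (x.1 4) + (x.1 5) + (x.1 6) + (x.1 8) := by linarith
      change (3 * x.1 0 - 1 - x.1 7) ^ 2 ≤ 7 * (x.1 0 ^ 2 + 1 - x.1 7 ^ 2)
      rw [e]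
      linarith
    · have h := cs7 (x.1 1) (x.1 2) (x.1 3) (x.1 4) (x.1 5) (x.1 6) (x.1 7)
      have e : 3 * x.1 0 - 1 - x.1 8 = (x.1 1) + (x.1 2) + (x.1 3) + (x.1 4) + (x.1 5) + (x.1 6) + (x.1 7) := by linarith
      change (3 * x.1 0 - 1 - x.1 8) ^ 2 ≤ 7 * (x.1 0 ^ 2 + 1 - x.1 8 ^ 2)
      rw [e]
      linarith
  exact ⟨(bnd_aux _ _ (key 0)).1, fun i => (bnd_aux _ _ (key i)).2⟩

theorem encZ_nonneg (x : Exc) : 0 ≤ encZ x.1 := by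
  obtain ⟨⟨h0, h0'⟩, h⟩ := bnds x
  have h1 : -1 ≤ x.1 1 := (h 0).1
  have h2 : -1 ≤ x.1 2 := (h 1).1
  have h3 : -1 ≤ x.1 3 := (h 2).1
  have h4 : -1 ≤ x.1 4 := (h 3).1
  have h5 : -1 ≤ x.1 5 := (h 4).1
  have h6 : -1 ≤ x.1 6 := (h 5).1
  have h7 : -1 ≤ x.1 7 := (h 6).1
  have h8 : -1 ≤ x.1 8 := (h 7).1
  unfold encZ
  linarith

theorem enc_cast (x : Exc) : ((enc x : ℕ) : ℤ) = encZ x.1 := Int.toNat_of_nonneg (encZ_nonneg x)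

theorem ip_of (m n PP F H N : ℕ)
    (h : m * n = PP + 4096 ^ 21 * F + 4096 ^ 30 * (N + N) + 4096 ^ 31 * H)
    (hP : PP < 4096 ^ 10 * 4096 ^ 10) (hF : F < 4096 ^ 9) (hN : N + N < 4096) : ip m n = N := by
  have e : ip m n = (m * n) / 2 ^ 361 % 2 ^ 11 := by
    have e1 : ip m n = ((m * n) >>> 361) &&& (2 ^ 11 - 1) := rfl
    rw [e1, Nat.and_two_pow_sub_one_eq_mod, Nat.shiftRight_eq_div_pow]
  rw [e, h]
  omega

theorem low_aux (f0 f1 f2 f3 f4 f5 f6 f7 f8 : ℕ) (h0 : f0 < 4096) (h1 : f1 < 4096) (h2 : f2 < 4096) (h3 : f3 < 4096) (h4 : f4 < 4096) (h5 : f5 < 4096) (h6 : f6 < 4096) (h7 : f7 < 4096) (h8 : f8 < 4096) :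
    f0 * 4096 ^ 0 + f1 * 4096 ^ 1 + f2 * 4096 ^ 2 + f3 * 4096 ^ 3 + f4 * 4096 ^ 4 + f5 * 4096 ^ 5 + f6 * 4096 ^ 6 + f7 * 4096 ^ 7 + f8 * 4096 ^ 8 < 4096 ^ 9 := by
  omega

set_option maxHeartbeats 4000000 in
theorem kron (c0 c1 c2 c3 c4 c5 c6 c7 a t d e0 e1 e2 e3 e4 e5 e6 e7 a' t' d' : ℕ)
    (hc0 : c0 ≤ 4) (hc1 : c1 ≤ 4) (hc2 : c2 ≤ 4) (hc3 : c3 ≤ 4) (hc4 : c4 ≤ 4) (hc5 : c5 ≤ 4) (hc6 : c6 ≤ 4) (hc7 : c7 ≤ 4) (ha : a ≤ 9) (ht : t ≤ 54) (hd : d ≤ 6) (he0 : e0 ≤ 4) (he1 : e1 ≤ 4) (he2 : e2 ≤ 4) (he3 : e3 ≤ 4) (he4 : e4 ≤ 4) (he5 : e5 ≤ 4) (he6 : e6 ≤ 4) (he7 : e7 ≤ 4) (ha' : a' ≤ 9) (ht' : t' ≤ 54) (hd' : d' ≤ 6) (N : ℕ)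
    (hN : N + N = (c0 * e0 + c0 * e0) + (c1 * e1 + c1 * e1) + (c2 * e2 + c2 * e2) + (c3 * e3 + c3 * e3) + (c4 * e4 + c4 * e4) + (c5 * e5 + c5 * e5) + (c6 * e6 + c6 * e6) + (c7 * e7 + c7 * e7) + (a * d' + d * a') + (t * 1 + 1 * t')) :
    ip (c0 * 4096 ^ 0 + c1 * 4096 ^ 1 + c2 * 4096 ^ 2 + c3 * 4096 ^ 3 + c4 * 4096 ^ 4 + c5 * 4096 ^ 5 + c6 * 4096 ^ 6 + c7 * 4096 ^ 7 + a * 4096 ^ 8 + t * 4096 ^ 9 + 4096 ^ 21 * (1 * 4096 ^ 0 + d * 4096 ^ 1 + c7 * 4096 ^ 2 + c6 * 4096 ^ 3 + c5 * 4096 ^ 4 + c4 * 4096 ^ 5 + c3 * 4096 ^ 6 + c2 * 4096 ^ 7 + c1 * 4096 ^ 8 + c0 * 4096 ^ 9)) (e0 * 4096 ^ 0 + e1 * 4096 ^ 1 + e2 * 4096 ^ 2 + e3 * 4096 ^ 3 + e4 * 4096 ^ 4 + e5 * 4096 ^ 5 + e6 * 4096 ^ 6 + e7 * 4096 ^ 7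 + a' * 4096 ^ 8 + t' * 4096 ^ 9 + 4096 ^ 21 * (1 * 4096 ^ 0 + d' * 4096 ^ 1 + e7 * 4096 ^ 2 + e6 * 4096 ^ 3 + e5 * 4096 ^ 4 + e4 * 4096 ^ 5 + e3 * 4096 ^ 6 + e2 * 4096 ^ 7 + e1 * 4096 ^ 8 + e0 * 4096 ^ 9)) = N := by
  have b0 : c0 * 1 + 1 * e0 ≤ 8 := by
    exact le_trans (Nat.add_le_add (Nat.mul_le_mul hc0 le_rfl) (Nat.mul_le_mul le_rfl he0)) (by norm_num)
  have b1 : c0 * d' + c1 * 1 + d * e0 + 1 * e1 ≤ 56 := by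
    exact le_trans (Nat.add_le_add (Nat.add_le_add (Nat.add_le_add (Nat.mul_le_mul hc0 hd') (Nat.mul_le_mul hc1 le_rfl)) (Nat.mul_le_mul hd he0)) (Nat.mul_le_mul le_rfl he1)) (by norm_num)
  have b2 : c0 * e7 + c1 * d' + c2 * 1 + c7 * e0 + d * e1 + 1 * e2 ≤ 88 := by
    exact le_trans (Nat.add_le_add (Nat.add_le_add (Nat.add_le_add (Nat.add_le_add (Nat.add_le_add (Nat.mul_le_mul hc0 he7) (Nat.mul_le_mul hc1 hd')) (Nat.mul_le_mul hc2 le_rfl)) (Nat.mul_le_mul hc7 he0)) (Nat.mul_le_mul hd he1)) (Nat.mul_le_mul le_rfl he2)) (by norm_num)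
  have b3 : c0 * e6 + c1 * e7 + c2 * d' + c3 * 1 + c6 * e0 + c7 * e1 + d * e2 + 1 * e3 ≤ 120 := by
    exact le_trans (Nat.add_le_add (Nat.add_le_add (Nat.add_le_add (Nat.add_le_add (Nat.add_le_add (Nat.add_le_add (Nat.add_le_add (Nat.mul_le_mul hc0 he6) (Nat.mul_le_mul hc1 he7)) (Nat.mul_le_mul hc2 hd')) (Nat.mul_le_mul hc3 le_rfl)) (Nat.mul_le_mul hc6 he0)) (Nat.mul_le_mul hc7 he1)) (Nat.mul_le_mul hd he2)) (Nat.mul_le_mul le_rfl he3)) (by norm_num)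
  have b4 : c0 * e5 + c1 * e6 + c2 * e7 + c3 * d' + c4 * 1 + c5 * e0 + c6 * e1 + c7 * e2 + d * e3 + 1 * e4 ≤ 152 := by
    exact le_trans (Nat.add_le_add (Nat.add_le_add (Nat.add_le_add (Nat.add_le_add (Nat.add_le_add (Nat.add_le_add (Nat.add_le_add (Nat.add_le_add (Nat.add_le_add (Nat.mul_le_mul hc0 he5) (Nat.mul_le_mul hc1 he6)) (Nat.mul_le_mul hc2 he7)) (Nat.mul_le_mul hc3 hd')) (Nat.mul_le_mul hc4 le_rfl)) (Nat.mul_le_mul hc5 he0)) (Nat.mul_le_mul hc6 he1)) (Nat.mul_le_mul hc7 he2)) (Nat.mul_le_mul hd he3)) (Nat.mul_le_mul le_rfl he4)) (by norm_num)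
  have b5 : c0 * e4 + c1 * e5 + c2 * e6 + c3 * e7 + c4 * d' + c5 * 1 + c4 * e0 + c5 * e1 + c6 * e2 + c7 * e3 + d * e4 + 1 * e5 ≤ 184 := by
    exact le_trans (Nat.add_le_add (Nat.add_le_add (Nat.add_le_add (Nat.add_le_add (Nat.add_le_add (Nat.add_le_add (Nat.add_le_add (Nat.add_le_add (Nat.add_le_add (Nat.add_le_add (Nat.add_le_add (Nat.mul_le_mul hc0 he4) (Nat.mul_le_mul hc1 he5)) (Nat.mul_le_mul hc2 he6)) (Nat.mul_le_mul hc3 he7)) (Nat.mul_le_mul hc4 hd')) (Nat.mul_le_mul hc5 le_rfl)) (Nat.mul_le_mul hc4 he0)) (Nat.mul_le_mul hc5 he1)) (Nat.mul_le_mul hc6 he2)) (Nat.mul_le_mul hc7 he3)) (Nat.mul_le_mul hd he4)) (Nat.mul_le_mul le_rfl he5)) (by norm_num)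
  have b6 : c0 * e3 + c1 * e4 + c2 * e5 + c3 * e6 + c4 * e7 + c5 * d' + c6 * 1 + c3 * e0 + c4 * e1 + c5 * e2 + c6 * e3 + c7 * e4 + d * e5 + 1 * e6 ≤ 216 := by
    exact le_trans (Nat.add_le_add (Nat.add_le_add (Nat.add_le_add (Nat.add_le_add (Nat.add_le_add (Nat.add_le_add (Nat.add_le_add (Nat.add_le_add (Nat.add_le_add (Nat.add_le_add (Nat.add_le_add (Nat.add_le_add (Nat.add_le_add (Nat.mul_le_mul hc0 he3) (Nat.mul_le_mul hc1 he4)) (Nat.mul_le_mul hc2 he5)) (Nat.mul_le_mul hc3 he6)) (Nat.mul_le_mul hc4 he7)) (Nat.mul_le_mul hc5 hd')) (Nat.mul_le_mul hc6 le_rfl)) (Nat.mul_le_mul hc3 he0)) (Nat.mul_le_mul hc4 he1)) (Nat.mul_le_mul hc5 he2)) (Nat.mul_le_mul hc6 he3)) (Nat.mul_le_mul hc7 he4)) (Nat.mul_le_mul hd he5)) (Nat.mul_le_mul le_rfl he6)) (by norm_num)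
  have b7 : c0 * e2 + c1 * e3 + c2 * e4 + c3 * e5 + c4 * e6 + c5 * e7 + c6 * d' + c7 * 1 + c2 * e0 + c3 * e1 + c4 * e2 + c5 * e3 + c6 * e4 + c7 * e5 + d * e6 + 1 * e7 ≤ 248 := by
    exact le_trans (Nat.add_le_add (Nat.add_le_add (Nat.add_le_add (Nat.add_le_add (Nat.add_le_add (Nat.add_le_add (Nat.add_le_add (Nat.add_le_add (Nat.add_le_add (Nat.add_le_add (Nat.add_le_add (Nat.add_le_add (Nat.add_le_add (Nat.add_le_add (Nat.add_le_add (Nat.mul_le_mul hc0 he2) (Nat.mul_le_mul hc1 he3)) (Nat.mul_le_mul hc2 he4)) (Nat.mul_le_mul hc3 he5)) (Nat.mul_le_mul hc4 he6)) (Nat.mul_le_mul hc5 he7)) (Nat.mul_le_mul hc6 hd')) (Nat.mul_le_mul hc7 le_rfl)) (Nat.mul_le_mul hc2 he0)) (Nat.mul_le_mul hc3 he1)) (Nat.mul_le_mul hc4 he2)) (Nat.mul_le_mul hc5 he3)) (Nat.mul_le_mul hc6 he4)) (Nat.mul_le_mul hc7 he5)) (Nat.mul_le_mul hd he6)) (Nat.mul_le_mul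 le_rfl he7)) (by norm_num)
  have b8 : c0 * e1 + c1 * e2 + c2 * e3 + c3 * e4 + c4 * e5 + c5 * e6 + c6 * e7 + c7 * d' + a * 1 + c1 * e0 + c2 * e1 + c3 * e2 + c4 * e3 + c5 * e4 + c6 * e5 + c7 * e6 + d * e7 + 1 * a' ≤ 290 := by
    exact le_trans (Nat.add_le_add (Nat.add_le_add (Nat.add_le_add (Nat.add_le_add (Nat.add_le_add (Nat.add_le_add (Nat.add_le_add (Nat.add_le_add (Nat.add_le_add (Nat.add_le_add (Nat.add_le_add (Nat.add_le_add (Nat.add_le_add (Nat.add_le_add (Nat.add_le_add (Nat.add_le_add (Nat.add_le_add (Nat.mul_le_mul hc0 he1) (Nat.mul_le_mul hc1 he2)) (Nat.mul_le_mul hc2 he3)) (Nat.mul_le_mul hc3 he4)) (Nat.mul_le_mul hc4 he5)) (Nat.mul_le_mul hc5 he6)) (Nat.mul_le_mul hc6 he7)) (Nat.mul_le_mul hc7 hd')) (Nat.mul_le_mul ha le_rfl)) (Nat.mul_le_mul hc1 he0)) (Nat.mul_le_mul hc2 he1)) (Nat.mul_le_mul hc3 he2)) (Nat.mul_le_mul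 hc4 he3)) (Nat.mul_le_mul hc5 he4)) (Nat.mul_le_mul hc6 he5)) (Nat.mul_le_mul hc7 he6)) (Nat.mul_le_mul hd he7)) (Nat.mul_le_mul le_rfl ha')) (by norm_num)
  have b9 : c0 * e0 + c1 * e1 + c2 * e2 + c3 * e3 + c4 * e4 + c5 * e5 + c6 * e6 + c7 * e7 + a * d' + t * 1 + c0 * e0 + c1 * e1 + c2 * e2 + c3 * e3 + c4 * e4 + c5 * e5 + c6 * e6 + c7 * e7 + d * a' + 1 * t' ≤ 472 := by
    exact le_trans (Nat.add_le_add (Nat.add_le_add (Nat.add_le_add (Nat.add_le_add (Nat.add_le_add (Nat.add_le_add (Nat.add_le_add (Nat.add_le_add (Nat.add_le_add (Nat.add_le_add (Nat.add_le_add (Nat.add_le_add (Nat.add_le_add (Nat.add_le_add (Nat.add_le_add (Nat.add_le_add (Nat.add_le_add (Nat.add_le_add (Nat.add_le_add (Nat.mul_le_mul hc0 he0) (Nat.mul_le_mul hc1 he1)) (Nat.mul_le_mul hc2 he2)) (Nat.mul_le_mul hc3 he3)) (Nat.mul_le_mul hc4 he4)) (Nat.mul_le_mul hc5 he5)) (Nat.mul_le_mul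 hc6 he6)) (Nat.mul_le_mul hc7 he7)) (Nat.mul_le_mul ha hd')) (Nat.mul_le_mul ht le_rfl)) (Nat.mul_le_mul hc0 he0)) (Nat.mul_le_mul hc1 he1)) (Nat.mul_le_mul hc2 he2)) (Nat.mul_le_mul hc3 he3)) (Nat.mul_le_mul hc4 he4)) (Nat.mul_le_mul hc5 he5)) (Nat.mul_le_mul hc6 he6)) (Nat.mul_le_mul hc7 he7)) (Nat.mul_le_mul hd ha')) (Nat.mul_le_mul le_rfl ht')) (by norm_num)
  have hP : c0 * 4096 ^ 0 + c1 * 4096 ^ 1 + c2 * 4096 ^ 2 + c3 * 4096 ^ 3 + c4 * 4096 ^ 4 + c5 * 4096 ^ 5 + c6 * 4096 ^ 6 + c7 * 4096 ^ 7 + a * 4096 ^ 8 + t * 4096 ^ 9 < 4096 ^ 10 := by clear hN; omega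
  have hP2 : e0 * 4096 ^ 0 + e1 * 4096 ^ 1 + e2 * 4096 ^ 2 + e3 * 4096 ^ 3 + e4 * 4096 ^ 4 + e5 * 4096 ^ 5 + e6 * 4096 ^ 6 + e7 * 4096 ^ 7 + a' * 4096 ^ 8 + t' * 4096 ^ 9 < 4096 ^ 10 := by clear hN; omega
  have hPP := Nat.mul_lt_mul'' hP hP2
  have E1 : (c0 * 4096 ^ 0 + c1 * 4096 ^ 1 + c2 * 4096 ^ 2 + c3 * 4096 ^ 3 + c4 * 4096 ^ 4 + c5 * 4096 ^ 5 + c6 * 4096 ^ 6 + c7 * 4096 ^ 7 + a * 4096 ^ 8 + t * 4096 ^ 9 + 4096 ^ 21 * (1 * 4096 ^ 0 + d * 4096 ^ 1 + c7 * 4096 ^ 2 + c6 * 4096 ^ 3 + c5 * 4096 ^ 4 + c4 * 4096 ^ 5 + c3 * 4096 ^ 6 + c2 * 4096 ^ 7 + c1 * 4096 ^ 8 + c0 * 4096 ^ 9)) * (e0 * 4096 ^ 0 + e1 * 4096 ^ 1 + e2 * 4096 ^ 2 + e3 * 4096 ^ 3 + e4 * 4096 ^ 4 + e5 * 4096 ^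 5 + e6 * 4096 ^ 6 + e7 * 4096 ^ 7 + a' * 4096 ^ 8 + t' * 4096 ^ 9 + 4096 ^ 21 * (1 * 4096 ^ 0 + d' * 4096 ^ 1 + e7 * 4096 ^ 2 + e6 * 4096 ^ 3 + e5 * 4096 ^ 4 + e4 * 4096 ^ 5 + e3 * 4096 ^ 6 + e2 * 4096 ^ 7 + e1 * 4096 ^ 8 + e0 * 4096 ^ 9)) =
     (c0 * 4096 ^ 0 + c1 * 4096 ^ 1 + c2 * 4096 ^ 2 + c3 * 4096 ^ 3 + c4 * 4096 ^ 4 + c5 * 4096 ^ 5 + c6 * 4096 ^ 6 + c7 * 4096 ^ 7 + a * 4096 ^ 8 + t * 4096 ^ 9) * (e0 * 4096 ^ 0 + e1 * 4096 ^ 1 + e2 * 4096 ^ 2 + e3 * 4096 ^ 3 + e4 * 4096 ^ 4 + e5 * 4096 ^ 5 + e6 * 4096 ^ 6 + e7 * 4096 ^ 7 + a' * 4096 ^ 8 + t' * 4096 ^ 9) + 4096 ^ 21 * ((c0 * 1 + 1 * e0) * 4096 ^ 0 + (c0 * d' + c1 * 1 + d * e0 + 1 * e1) * 4096 ^ 1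 + (c0 * e7 + c1 * d' + c2 * 1 + c7 * e0 + d * e1 + 1 * e2) * 4096 ^ 2 + (c0 * e6 + c1 * e7 + c2 * d' + c3 * 1 + c6 * e0 + c7 * e1 + d * e2 + 1 * e3) * 4096 ^ 3 + (c0 * e5 + c1 * e6 + c2 * e7 + c3 * d' + c4 * 1 + c5 * e0 + c6 * e1 + c7 * e2 + d * e3 + 1 * e4) * 4096 ^ 4 + (c0 * e4 + c1 * e5 + c2 * e6 + c3 * e7 + c4 * d' + c5 * 1 + c4 * e0 + c5 * e1 + c6 * e2 + c7 * e3 + d * e4 + 1 * e5) * 4096 ^ 5 + (c0 * e3 + c1 * e4 + c2 * e5 + c3 * e6 + c4 * e7 + c5 * d' + c6 * 1 + c3 * e0 + c4 * e1 + c5 * e2 + c6 * e3 + c7 * e4 + d * e5 + 1 * e6) * 4096 ^ 6 + (c0 * e2 + c1 * e3 + c2 * e4 + c3 * e5 + c4 * e6 + c5 * e7 + c6 * d' + c7 * 1 + c2 * e0 + c3 * e1 + c4 * e2 + c5 * e3 + c6 * e4 + c7 * e5 + d * e6 + 1 * e7) * 4096 ^ 7 + (c0 * e1 + c1 * e2 +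 c2 * e3 + c3 * e4 + c4 * e5 + c5 * e6 + c6 * e7 + c7 * d' + a * 1 + c1 * e0 + c2 * e1 + c3 * e2 + c4 * e3 + c5 * e4 + c6 * e5 + c7 * e6 + d * e7 + 1 * a') * 4096 ^ 8) +
     4096 ^ 30 * (c0 * e0 + c1 * e1 + c2 * e2 + c3 * e3 + c4 * e4 + c5 * e5 + c6 * e6 + c7 * e7 + a * d' + t * 1 + c0 * e0 + c1 * e1 + c2 * e2 + c3 * e3 + c4 * e4 + c5 * e5 + c6 * e6 + c7 * e7 + d * a' + 1 * t') + 4096 ^ 31 * (((c1 * e0 + c2 * e1 + c3 * e2 + c4 * e3 + c5 * e4 + c6 * e5 + c7 * e6 + a * e7 + t * d' + c0 * e1 + c1 * e2 + c2 * e3 + c3 * e4 + c4 * e5 + c5 * e6 + c6 * e7 + c7 * a' + d * t') * 4096 ^ 0 + (c2 * e0 + c3 * e1 + c4 * e2 + c5 * e3 + c6 * e4 + c7 * e5 + a * e6 + t * e7 + c0 * e2 + c1 * e3 + c2 * e4 + c3 * e5 + c4 * e6 + c5 * e7 + c6 * a' + c7 * t') * 4096 ^ 1 + (c3 * e0 +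 c4 * e1 + c5 * e2 + c6 * e3 + c7 * e4 + a * e5 + t * e6 + c0 * e3 + c1 * e4 + c2 * e5 + c3 * e6 + c4 * e7 + c5 * a' + c6 * t') * 4096 ^ 2 + (c4 * e0 + c5 * e1 + c6 * e2 + c7 * e3 + a * e4 + t * e5 + c0 * e4 + c1 * e5 + c2 * e6 + c3 * e7 + c4 * a' + c5 * t') * 4096 ^ 3 + (c5 * e0 + c6 * e1 + c7 * e2 + a * e3 + t * e4 + c0 * e5 + c1 * e6 + c2 * e7 + c3 * a' + c4 * t') * 4096 ^ 4 + (c6 * e0 + c7 * e1 + a * e2 + t * e3 + c0 * e6 + c1 * e7 + c2 * a' + c3 * t') * 4096 ^ 5 + (c7 * e0 + a * e1 + t * e2 + c0 * e7 + c1 * a' + c2 * t') * 4096 ^ 6 + (a * e0 + t * e1 + c0 * a' + c1 * t') * 4096 ^ 7 + (t * e0 + c0 * t') * 4096 ^ 8) + 4096 ^ 11 * ((1 * 4096 ^ 0 + d * 4096 ^ 1 + c7 * 4096 ^ 2 + c6 * 4096 ^ 3 + c5 * 4096 ^ 4 + c4 * 4096 ^ 5 + c3 * 4096 ^ 6 +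 c2 * 4096 ^ 7 + c1 * 4096 ^ 8 + c0 * 4096 ^ 9) * (1 * 4096 ^ 0 + d' * 4096 ^ 1 + e7 * 4096 ^ 2 + e6 * 4096 ^ 3 + e5 * 4096 ^ 4 + e4 * 4096 ^ 5 + e3 * 4096 ^ 6 + e2 * 4096 ^ 7 + e1 * 4096 ^ 8 + e0 * 4096 ^ 9))) := by
    ring
  have E2 : c0 * e0 + c1 * e1 + c2 * e2 + c3 * e3 + c4 * e4 + c5 * e5 + c6 * e6 + c7 * e7 + a * d' + t * 1 + c0 * e0 + c1 * e1 + c2 * e2 + c3 * e3 + c4 * e4 + c5 * e5 + c6 * e6 + c7 * e7 + d * a' + 1 * t' = N + N := by rw [hN]; ring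
  rw [E2] at E1 b9
  refine ip_of _ _ _ _ _ N E1 hPP ?_ (lt_of_le_of_lt b9 (by norm_num))
  exact low_aux _ _ _ _ _ _ _ _ _ (lt_of_le_of_lt b0 (by norm_num)) (lt_of_le_of_lt b1 (by norm_num)) (lt_of_le_of_lt b2 (by norm_num)) (lt_of_le_of_lt b3 (by norm_num)) (lt_of_le_of_lt b4 (by norm_num)) (lt_of_le_of_lt b5 (by norm_num)) (lt_of_le_of_lt b6 (by norm_num)) (lt_of_le_of_lt b7 (by norm_num)) (lt_of_le_of_lt b8 (by norm_num))

theorem enc_nat (x : Exc) : ∃ c0 c1 c2 c3 c4 c5 c6 c7 a t d : ℕ, ((c0 : ℤ) = x.1 1 + 1 ∧ (c1 : ℤ) = x.1 2 + 1 ∧ (c2 : ℤ) = x.1 3 + 1 ∧ (c3 : ℤ) = x.1 4 + 1 ∧ (c4 : ℤ) = x.1 5 + 1 ∧ (c5 : ℤ) = x.1 6 + 1 ∧ (c6 : ℤ) = x.1 7 + 1 ∧ (c7 : ℤ) = x.1 8 + 1 ∧ (a : ℤ) = x.1 0 + 3 ∧ (t : ℤ) = 54 - 9 * x.1 0 ∧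 (d : ℤ) = 6 - x.1 0) ∧
    (c0 ≤ 4 ∧ c1 ≤ 4 ∧ c2 ≤ 4 ∧ c3 ≤ 4 ∧ c4 ≤ 4 ∧ c5 ≤ 4 ∧ c6 ≤ 4 ∧ c7 ≤ 4 ∧ a ≤ 9 ∧ t ≤ 54 ∧ d ≤ 6) ∧
    enc x = c0 * 4096 ^ 0 + c1 * 4096 ^ 1 + c2 * 4096 ^ 2 + c3 * 4096 ^ 3 + c4 * 4096 ^ 4 + c5 * 4096 ^ 5 + c6 * 4096 ^ 6 + c7 * 4096 ^ 7 + a * 4096 ^ 8 + t * 4096 ^ 9 + 4096 ^ 21 * (1 * 4096 ^ 0 + d * 4096 ^ 1 + c7 * 4096 ^ 2 + c6 * 4096 ^ 3 + c5 * 4096 ^ 4 + c4 * 4096 ^ 5 + c3 * 4096 ^ 6 + c2 * 4096 ^ 7 + c1 * 4096 ^ 8 + c0 * 4096 ^ 9) := by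
  obtain ⟨⟨h0, h0'⟩, h⟩ := bnds x
  have g0 : -1 ≤ x.1 1 ∧ x.1 1 ≤ 3 := h 0
  obtain ⟨c0, hc0⟩ := Int.eq_ofNat_of_zero_le (show 0 ≤ x.1 1 + 1 by linarith [g0.1])
  have g1 : -1 ≤ x.1 2 ∧ x.1 2 ≤ 3 := h 1
  obtain ⟨c1, hc1⟩ := Int.eq_ofNat_of_zero_le (show 0 ≤ x.1 2 + 1 by linarith [g1.1])
  have g2 : -1 ≤ x.1 3 ∧ x.1 3 ≤ 3 := h 2
  obtain ⟨c2, hc2⟩ := Int.eq_ofNat_of_zero_le (show 0 ≤ x.1 3 + 1 by linarith [g2.1])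
  have g3 : -1 ≤ x.1 4 ∧ x.1 4 ≤ 3 := h 3
  obtain ⟨c3, hc3⟩ := Int.eq_ofNat_of_zero_le (show 0 ≤ x.1 4 + 1 by linarith [g3.1])
  have g4 : -1 ≤ x.1 5 ∧ x.1 5 ≤ 3 := h 4
  obtain ⟨c4, hc4⟩ := Int.eq_ofNat_of_zero_le (show 0 ≤ x.1 5 + 1 by linarith [g4.1])
  have g5 : -1 ≤ x.1 6 ∧ x.1 6 ≤ 3 := h 5
  obtain ⟨c5, hc5⟩ := Int.eq_ofNat_of_zero_le (show 0 ≤ x.1 6 + 1 by linarith [g5.1])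
  have g6 : -1 ≤ x.1 7 ∧ x.1 7 ≤ 3 := h 6
  obtain ⟨c6, hc6⟩ := Int.eq_ofNat_of_zero_le (show 0 ≤ x.1 7 + 1 by linarith [g6.1])
  have g7 : -1 ≤ x.1 8 ∧ x.1 8 ≤ 3 := h 7
  obtain ⟨c7, hc7⟩ := Int.eq_ofNat_of_zero_le (show 0 ≤ x.1 8 + 1 by linarith [g7.1])
  obtain ⟨a, ha⟩ := Int.eq_ofNat_of_zero_le (show 0 ≤ x.1 0 + 3 by linarith)
  obtain ⟨t, ht⟩ := Int.eq_ofNat_of_zero_le (show 0 ≤ 54 - 9 * x.1 0 by linarith)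
  obtain ⟨d, hd⟩ := Int.eq_ofNat_of_zero_le (show 0 ≤ 6 - x.1 0 by linarith)
  refine ⟨c0, c1, c2, c3, c4, c5, c6, c7, a, t, d, ?_, ?_, ?_⟩
  · exact ⟨hc0.symm, hc1.symm, hc2.symm, hc3.symm, hc4.symm, hc5.symm, hc6.symm, hc7.symm,
      ha.symm, ht.symm, hd.symm⟩
  · refine ⟨?_, ?_, ?_, ?_, ?_, ?_, ?_, ?_, ?_, ?_, ?_⟩ <;> omega
  · apply (Nat.cast_injective : Function.Injective (Nat.cast : ℕ → ℤ))
    rw [enc_cast]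
    unfold encZ
    rw [hc0, hc1, hc2, hc3, hc4, hc5, hc6, hc7, ha, ht, hd]
    push_cast
    ring

set_option maxHeartbeats 1000000 in
theorem ip_enc (x y : Exc) : ((ip (enc x) (enc y) : ℕ) : ℤ) = 78 - Bx x y := by
  obtain ⟨sx, -⟩ := exc_eqs x
  obtain ⟨sy, -⟩ := exc_eqs y
  obtain ⟨c0, c1, c2, c3, c4, c5, c6, c7, a, t, d, ⟨qc0, qc1, qc2, qc3, qc4, qc5, qc6, qc7, qa, qt, qd⟩, ⟨hc0, hc1, hc2, hc3, hc4, hc5, hc6, hc7, ha, ht, hd⟩, ex⟩ := enc_nat x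
  obtain ⟨e0, e1, e2, e3, e4, e5, e6, e7, a', t', d', ⟨qe0, qe1, qe2, qe3, qe4, qe5, qe6, qe7, qa', qt', qd'⟩, ⟨he0, he1, he2, he3, he4, he5, he6, he7, ha', ht', hd'⟩, ey⟩ := enc_nat y
  have key : ((c0 : ℤ) * e0 + c0 * e0) + ((c1 : ℤ) * e1 + c1 * e1) + ((c2 : ℤ) * e2 + c2 * e2) + ((c3 : ℤ) * e3 + c3 * e3) + ((c4 : ℤ) * e4 + c4 * e4) + ((c5 : ℤ) * e5 + c5 * e5) + ((c6 : ℤ) * e6 + c6 * e6) + ((c7 : ℤ) * e7 + c7 * e7) + ((a : ℤ) * d' + d * a') + ((t : ℤ) * 1 + 1 * t') = 2 * (78 - Bx x y) := by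
    unfold Bx
    rw [B_eq, qc0, qc1, qc2, qc3, qc4, qc5, qc6, qc7, qa, qt, qd, qe0, qe1, qe2, qe3, qe4, qe5, qe6, qe7, qa', qt', qd']
    linear_combination 2 * sx + 2 * sy
  have hpos : 0 ≤ 78 - Bx x y := by
    have : (0 : ℤ) ≤ ((c0 : ℤ) * e0 + c0 * e0) + ((c1 : ℤ) * e1 + c1 * e1) + ((c2 : ℤ) * e2 + c2 * e2) + ((c3 : ℤ) * e3 + c3 * e3) + ((c4 : ℤ) * e4 + c4 * e4) + ((c5 : ℤ) * e5 + c5 * e5) + ((c6 : ℤ) * e6 + c6 * e6) + ((c7 : ℤ) * e7 + c7 * e7) + ((a : ℤ) * d' + d * a') + ((t : ℤ) * 1 + 1 * t') := by positivity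
    linarith
  obtain ⟨N, hN⟩ := Int.eq_ofNat_of_zero_le hpos
  rw [hN]
  congr 1
  rw [ex, ey]
  refine kron c0 c1 c2 c3 c4 c5 c6 c7 a t d e0 e1 e2 e3 e4 e5 e6 e7 a' t' d' hc0 hc1 hc2 hc3 hc4 hc5 hc6 hc7 ha ht hd he0 he1 he2 he3 he4 he5 he6 he7 ha' ht' hd' N ?_
  zify
  rw [key, hN]
  ring

theorem adj_ip (m n : ℕ) : adjN m n = true ↔ ip m n = 76 ∨ ip m n = 77 := by
  have e1 : adjN m n = Nat.beq (((m * n) >>> 362) &&& (2 ^ 10 - 1)) 38 := rfl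
  have e2 : ip m n = ((m * n) >>> 361) &&& (2 ^ 11 - 1) := rfl
  rw [e1, e2, Nat.and_two_pow_sub_one_eq_mod, Nat.and_two_pow_sub_one_eq_mod, Nat.beq_eq]
  rw [show 362 = 361 + 1 from rfl, Nat.shiftRight_add]
  generalize (m * n) >>> 361 = z
  rw [Nat.shiftRight_eq_div_pow]
  omega

def adjE (x y : Exc) : Prop := Bx x y ∈ ({1, 2} : Set ℤ)

theorem adj_enc (x y : Exc) : adjN (enc x) (enc y) = true ↔ adjE x y := by
  rw [adj_ip]
  have := ip_enc x y
  simp only [adjE, Set.mem_insert_iff, Set.mem_singleton_iff]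
  omega

theorem Bx_comm (x y : Exc) : Bx x y = Bx y x := by
  unfold Bx; rw [B_eq, B_eq]; ring

theorem adjE_comm (x y : Exc) : adjE x y ↔ adjE y x := by unfold adjE; rw [Bx_comm]

theorem Bx_self (x : Exc) : Bx x x = -1 := x.2.1

theorem eq_of_Bx (x y : Exc) (h : Bx x y = -1) : x = y := by
  obtain ⟨sx, qx⟩ := exc_eqs x
  obtain ⟨sy, qy⟩ := exc_eqs y
  unfold Bx at h
  rw [B_eq] at h
  have cs := sq_sum_le_card_mul_sum_sq (s := Finset.univ) (f := fun i : Fin 8 => x.1 i.succ - y.1 i.succ)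
  have hs : ∑ i : Fin 8, (x.1 i.succ - y.1 i.succ) = 3 * (x.1 0 - y.1 0) := by
    rw [Fin.sum_univ_eight]
    change (x.1 1 - y.1 1) + (x.1 2 - y.1 2) + (x.1 3 - y.1 3) + (x.1 4 - y.1 4) + (x.1 5 - y.1 5) + (x.1 6 - y.1 6) + (x.1 7 - y.1 7) + (x.1 8 - y.1 8) = _
    linarith
  have hq : ∑ i : Fin 8, (x.1 i.succ - y.1 i.succ) ^ 2 = (x.1 0 - y.1 0) ^ 2 := by
    rw [Fin.sum_univ_eight]
    change (x.1 1 - y.1 1) ^ 2 + (x.1 2 - y.1 2) ^ 2 + (x.1 3 - y.1 3) ^ 2 + (x.1 4 - y.1 4) ^ 2 + (x.1 5 - y.1 5) ^ 2 + (x.1 6 - y.1 6) ^ 2 + (x.1 7 - y.1 7) ^ 2 + (x.1 8 - y.1 8) ^ 2 = _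
    linarith
  rw [hs, hq] at cs
  simp only [Finset.card_univ, Fintype.card_fin] at cs
  push_cast at cs
  have h0 : (x.1 0 - y.1 0) ^ 2 = 0 := le_antisymm (by nlinarith) (sq_nonneg _)
  rw [h0, Finset.sum_eq_zero_iff_of_nonneg (fun _ _ => sq_nonneg _)] at hq
  apply Subtype.ext
  funext i
  refine Fin.cases ?_ (fun j => ?_) i
  · have := pow_eq_zero_iff (two_ne_zero) |>.1 h0
    linarith
  · have := pow_eq_zero_iff (two_ne_zero) |>.1 (hq j (Finset.mem_univ _))
    linarith

theorem enc_inj : Function.Injective enc := by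
  intro x y h
  apply eq_of_Bx
  have h1 := ip_enc x y
  have h2 := ip_enc x x
  rw [Bx_self] at h2
  rw [← h] at h1
  linarith

/-- The reflection in the root `p - q`. -/
def rv (p q v : Fin 9 → ℤ) : Fin 9 → ℤ := fun i => v i + (B v p - B v q) * (p i - q i)

theorem rv_B (p q : Exc) (h : Bx p q = 0) (v w : Fin 9 → ℤ) : B (rv p.1 q.1 v) (rv p.1 q.1 w) = B v w := by
  have hp := Bx_self p
  have hq := Bx_self q
  unfold Bx at h hp hq
  have e : ∀ (s t : ℤ), B (fun i => v i + s * (p.1 i - q.1 i)) (fun i => w i + t * (p.1 i - q.1 i)) =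
      B v w + t * (B v p.1 - B v q.1) + s * (B w p.1 - B w q.1) + s * t * (B p.1 p.1 - 2 * B p.1 q.1 + B q.1 q.1) := by
    intro s t
    simp only [B_eq]
    ring
  unfold rv
  rw [e, h, hp, hq]
  ring

theorem rv_K (p q : Exc) (v : Fin 9 → ℤ) : B (rv p.1 q.1 v) Kcl = B v Kcl := by
  have hp := p.2.2
  have hq := q.2.2
  have e : ∀ s : ℤ, B (fun i => v i + s * (p.1 i - q.1 i)) Kcl = B v Kcl + s * (B p.1 Kcl - B q.1 Kcl) := by
    intro s
    simp only [Kcl_eq]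
    ring
  unfold rv
  rw [e, hp, hq]
  ring

theorem rv_rv (p q : Exc) (h : Bx p q = 0) (v : Fin 9 → ℤ) : rv p.1 q.1 (rv p.1 q.1 v) = v := by
  have hp := Bx_self p
  have hq := Bx_self q
  have hqp : Bx q p = 0 := by rw [Bx_comm]; exact h
  unfold Bx at h hp hq hqp
  have e : ∀ (s : ℤ) (w : Fin 9 → ℤ), B (fun i => v i + s * (p.1 i - q.1 i)) w =
      B v w + s * (B p.1 w - B q.1 w) := by
    intro s w
    simp only [B_eq]
    ring
  funext i
  change (rv p.1 q.1 v) i + (B (rv p.1 q.1 v) p.1 - B (rv p.1 q.1 v) q.1) * (p.1 i - q.1 i) = v i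
  unfold rv
  rw [e, e, h, hp, hq, hqp]
  ring

def rE (p q : Exc) (h : Bx p q = 0) : Exc ≃ Exc where
  toFun x := ⟨rv p.1 q.1 x.1, by rw [IsExc, rv_B p q h, rv_K]; exact x.2⟩
  invFun x := ⟨rv p.1 q.1 x.1, by rw [IsExc, rv_B p q h, rv_K]; exact x.2⟩
  left_inv x := Subtype.ext (rv_rv p q h x.1)
  right_inv x := Subtype.ext (rv_rv p q h x.1)

theorem rE_B (p q : Exc) (h : Bx p q = 0) (x y : Exc) : Bx (rE p q h x) (rE p q h y) = Bx x y :=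
  rv_B p q h x.1 y.1

theorem rE_swap (p q : Exc) (h : Bx p q = 0) : rE p q h p = q := by
  apply Subtype.ext
  funext i
  have hp := Bx_self p
  unfold Bx at h hp
  change p.1 i + (B p.1 p.1 - B p.1 q.1) * (p.1 i - q.1 i) = q.1 i
  rw [h, hp]
  ring

theorem rE_fix (p q : Exc) (h : Bx p q = 0) (x : Exc) (hx : Bx x p = Bx x q) : rE p q h x = x := by
  apply Subtype.ext
  funext i
  unfold Bx at hx
  change x.1 i + (B x.1 p.1 - B x.1 q.1) * (p.1 i - q.1 i) = x.1 i
  rw [hx]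
  ring

theorem encZ_rv (p q v : Fin 9 → ℤ) :
    encZ (rv p q v) = encZ v + (B v p - B v q) * (encZ p - encZ q) := by
  unfold rv
  generalize B v p - B v q = s
  unfold encZ
  ring

theorem enc_rE (p q : Exc) (h : Bx p q = 0) (x : Exc) :
    enc (rE p q h x) = reflN (enc p) (enc q) (enc x) := by
  have e : ((enc (rE p q h x) : ℕ) : ℤ) = enc x +
      ((ip (enc x) (enc q) : ℕ) - (ip (enc x) (enc p) : ℕ) : ℤ) * (enc p - enc q) := by
    rw [ip_enc, ip_enc, enc_cast, enc_cast, enc_cast, enc_cast]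
    change encZ (rv p.1 q.1 x.1) = _
    rw [encZ_rv]
    unfold Bx
    ring
  have e2 : reflN (enc p) (enc q) (enc x) =
      (enc x + (ip (enc x) (enc q) * enc p + ip (enc x) (enc p) * enc q)) -
      (ip (enc x) (enc q) * enc q + ip (enc x) (enc p) * enc p) := rfl
  rw [e2]
  symm
  apply Nat.sub_eq_of_eq_add
  zify
  rw [e]
  ring

/-- All lists of length `n` with entries at most `4`, sum `s` and sum of squares `q`. -/
def gen : ℕ → ℕ → ℕ → List (List ℕ)
  | 0, s, q => bif Nat.beq s 0 && Nat.beq q 0 then [[]] else []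
  | n + 1, s, q => [0, 1, 2, 3, 4].flatMap fun c =>
      bif Nat.ble c s && Nat.ble (c * c) q && Nat.ble ((s - c) * (s - c)) (n * (q - c * c)) then
        (gen n (s - c) (q - c * c)).map (fun l => c :: l) else []

theorem list_cs (l : List ℕ) : l.sum * l.sum ≤ l.length * (l.map (fun c => c * c)).sum := by
  induction l with
  | nil => simp
  | cons c l ih =>
    simp only [List.sum_cons, List.length_cons, List.map_cons]
    have h2 : ∀ m : List ℕ, 2 * c * m.sum ≤ m.length * (c * c) + (m.map (fun c => c * c)).sum := by
      intro m
      induction m with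
      | nil => simp
      | cons d m ih2 =>
        simp only [List.sum_cons, List.length_cons, List.map_cons]
        zify at ih2 ⊢
        nlinarith [sq_nonneg ((c : ℤ) - d)]
    have := h2 l
    nlinarith

theorem mem_gen (l : List ℕ) (h : ∀ c ∈ l, c ≤ 4) :
    l ∈ gen l.length l.sum (l.map (fun c => c * c)).sum := by
  induction l with
  | nil => simp [gen]
  | cons c l ih =>
    have ih := ih (fun d hd => h d (List.mem_cons_of_mem _ hd))
    have hc := h c List.mem_cons_self
    simp only [List.length_cons, gen, List.mem_flatMap]
    refine ⟨c, ?_, ?_⟩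
    · interval_cases c <;> simp
    · have e1 : (c :: l).sum - c = l.sum := by simp
      have e2 : ((c :: l).map (fun c => c * c)).sum - c * c = (l.map (fun c => c * c)).sum := by simp
      have h1 : Nat.ble c (c :: l).sum = true := by simp
      have h2 : Nat.ble (c * c) ((c :: l).map (fun c => c * c)).sum = true := by simp
      have h3 : Nat.ble (l.sum * l.sum) (l.length * (l.map (fun c => c * c)).sum) = true := by
        rw [Nat.ble_eq]; exact list_cs l
      rw [e1, e2, h1, h2, h3]
      simpa using ih

theorem gen_mem (n : ℕ) : ∀ (s q : ℕ) (l : List ℕ), l ∈ gen n s q →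
    l.length = n ∧ l.sum = s ∧ (l.map (fun c => c * c)).sum = q := by
  induction n with
  | zero =>
    intro s q l h
    simp only [gen, Bool.cond_eq_ite] at h
    split_ifs at h with h1
    · simp only [Bool.and_eq_true, Nat.beq_eq] at h1
      simp at h
      subst h
      simp [h1.1, h1.2]
    · simp at h
  | succ n ih =>
    intro s q l h
    simp only [gen, List.mem_flatMap, Bool.cond_eq_ite] at h
    obtain ⟨c, -, h⟩ := h
    split_ifs at h with h1
    · simp only [Bool.and_eq_true, Nat.ble_eq] at h1
      rw [List.mem_map] at h
      obtain ⟨m, hm, rfl⟩ := h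
      obtain ⟨i1, i2, i3⟩ := ih _ _ _ hm
      simp only [List.length_cons, List.sum_cons, List.map_cons]
      omega
    · simp at h

def encN (a : ℕ) (l : List ℕ) : ℕ :=
  match l with
  | [c0, c1, c2, c3, c4, c5, c6, c7] =>
    c0 * 4096 ^ 0 + c1 * 4096 ^ 1 + c2 * 4096 ^ 2 + c3 * 4096 ^ 3 + c4 * 4096 ^ 4 + c5 * 4096 ^ 5 + c6 * 4096 ^ 6 + c7 * 4096 ^ 7 + (a + 3) * 4096 ^ 8 + (54 - 9 * a) * 4096 ^ 9 + 4096 ^ 21 * (1 * 4096 ^ 0 + (6 - a) * 4096 ^ 1 + c7 * 4096 ^ 2 + c6 * 4096 ^ 3 + c5 * 4096 ^ 4 + c4 * 4096 ^ 5 + c3 * 4096 ^ 6 + c2 * 4096 ^ 7 + c1 * 4096 ^ 8 + c0 * 4096 ^ 9)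
  | _ => 0

def genAll : List ℕ := [0, 1, 2, 3, 4, 5, 6].flatMap fun a =>
  (gen 8 (3 * a + 7) (a * a + 6 * a + 7)).map (encN a)

theorem enc_genAll (x : Exc) : enc x ∈ genAll := by
  obtain ⟨c0, c1, c2, c3, c4, c5, c6, c7, a, t, d, ⟨q0, q1, q2, q3, q4, q5, q6, q7, qa, qt, qd⟩,
    ⟨h0, h1, h2, h3, h4, h5, h6, h7, ha, ht, hd⟩, e⟩ := enc_nat x
  obtain ⟨sx, qx⟩ := exc_eqs x
  obtain ⟨⟨b0, b1⟩, -⟩ := bnds x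
  obtain ⟨A, hA⟩ := Int.eq_ofNat_of_zero_le b0
  have hA6 : A ≤ 6 := by omega
  simp only [genAll, List.mem_flatMap, List.mem_map]
  refine ⟨A, ?_, [c0, c1, c2, c3, c4, c5, c6, c7], ?_, ?_⟩
  · interval_cases A <;> simp
  · have := mem_gen [c0, c1, c2, c3, c4, c5, c6, c7] (by
      intro c hc
      simp only [List.mem_cons, List.not_mem_nil, or_false] at hc
      rcases hc with rfl | rfl | rfl | rfl | rfl | rfl | rfl | rfl <;> assumption)
    have e1 : [c0, c1, c2, c3, c4, c5, c6, c7].sum = 3 * A + 7 := by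
      simp only [List.sum_cons, List.sum_nil]
      omega
    have e2 : ([c0, c1, c2, c3, c4, c5, c6, c7].map (fun c => c * c)).sum = A * A + 6 * A + 7 := by
      simp only [List.map_cons, List.map_nil, List.sum_cons, List.sum_nil]
      zify
      rw [hA] at qx sx
      rw [q0, q1, q2, q3, q4, q5, q6, q7]
      linear_combination qx + 2 * sx
    rw [e1, e2] at this
    exact this
  · rw [e]
    have ea : a = A + 3 := by omega
    have et : t = 54 - 9 * A := by omega
    have ed : d = 6 - A := by omega
    simp only [encN, ea, et, ed]

theorem genAll_enc (c : ℕ) (h : c ∈ genAll) : ∃ x : Exc, enc x = c := by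
  simp only [genAll, List.mem_flatMap, List.mem_map] at h
  obtain ⟨A, hA, l, hl, rfl⟩ := h
  have hA6 : A ≤ 6 := by
    simp only [List.mem_cons, List.not_mem_nil, or_false] at hA
    omega
  obtain ⟨i1, i2, i3⟩ := gen_mem _ _ _ _ hl
  match l, i1, i2, i3 with
  | [c0, c1, c2, c3, c4, c5, c6, c7], _, i2, i3 =>
    simp only [List.map_cons, List.map_nil, List.sum_cons, List.sum_nil] at i2 i3
    zify at i2 i3
    let v : Fin 9 → ℤ := ![(A : ℤ), (c0 : ℤ) - 1, (c1 : ℤ) - 1, (c2 : ℤ) - 1, (c3 : ℤ) - 1,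
      (c4 : ℤ) - 1, (c5 : ℤ) - 1, (c6 : ℤ) - 1, (c7 : ℤ) - 1]
    have v0 : v 0 = A := rfl
    have v1 : v 1 = c0 - 1 := rfl
    have v2 : v 2 = c1 - 1 := rfl
    have v3 : v 3 = c2 - 1 := rfl
    have v4 : v 4 = c3 - 1 := rfl
    have v5 : v 5 = c4 - 1 := rfl
    have v6 : v 6 = c5 - 1 := rfl
    have v7 : v 7 = c6 - 1 := rfl
    have v8 : v 8 = c7 - 1 := rfl
    refine ⟨⟨v, ?_, ?_⟩, ?_⟩
    · rw [B_eq, v0, v1, v2, v3, v4, v5, v6, v7, v8]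
      linear_combination 2 * i2 - i3
    · rw [Kcl_eq, v0, v1, v2, v3, v4, v5, v6, v7, v8]
      linear_combination i2
    · apply (Nat.cast_injective : Function.Injective (Nat.cast : ℕ → ℤ))
      rw [enc_cast]
      unfold encZ
      simp only [v0, v1, v2, v3, v4, v5, v6, v7, v8, encN]
      have h54 : ((54 - 9 * A : ℕ) : ℤ) = 54 - 9 * A := by omega
      have h6 : ((6 - A : ℕ) : ℤ) = 6 - A := by omega
      push_cast
      rw [h54, h6]
      ring

theorem codes_gen : genAll = codes := by decide +kernel

theorem codes_nodup : codes.Nodup := by decide +kernel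

theorem enc_mem (x : Exc) : enc x ∈ codes := codes_gen ▸ enc_genAll x

theorem codes_enc (c : ℕ) (h : c ∈ codes) : ∃ x : Exc, enc x = c :=
  genAll_enc c (codes_gen ▸ h)

noncomputable def exl : List Exc := codes.attach.map fun c => (codes_enc c.1 c.2).choose

theorem exl_map : exl.map enc = codes := by
  rw [exl, List.map_map]
  conv_rhs => rw [← List.attach_map_subtype_val codes]
  apply List.map_congr_left
  intro c _
  exact (codes_enc c.1 c.2).choose_spec

theorem exl_nodup : exl.Nodup := List.Nodup.of_map enc (exl_map ▸ codes_nodup)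

theorem mem_exl (x : Exc) : x ∈ exl := by
  have h := enc_mem x
  rw [← exl_map, List.mem_map] at h
  obtain ⟨y, hy, e⟩ := h
  exact enc_inj e ▸ hy

noncomputable instance : Fintype Exc := by
  classical
  exact ⟨exl.toFinset, fun x => List.mem_toFinset.2 (mem_exl x)⟩

noncomputable instance : DecidableRel adjE := Classical.decRel _

noncomputable instance (M : Set ℤ) : DecidablePred (IsClique M) := Classical.decPred _

noncomputable def cl (P : Finset Exc) (k : ℕ) : ℕ :=
  ((P.powersetCard k).filter (IsClique {1, 2})).card

noncomputable def Nb (L : List Exc) : Finset Exc := Finset.univ.filter fun x => ∀ l ∈ L, adjE l x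

noncomputable def FE (L : List Exc) (k : ℕ) : ℕ := cl (Nb L) k

theorem adjE_irrefl (x : Exc) : ¬ adjE x x := by
  unfold adjE
  rw [Bx_self]
  simp

theorem cl_mem (P : Finset Exc) (k : ℕ) (v : Exc) (hv : v ∈ P) :
    (((P.powersetCard (k + 1)).filter (IsClique {1, 2})).filter (fun T => v ∈ T)).card =
      cl (P.filter (adjE v)) k := by
  unfold cl
  refine Finset.card_bij' (fun T _ => T.erase v) (fun T _ => insert v T) ?_ ?_ ?_ ?_
  · intro T hT
    simp only [Finset.mem_filter, Finset.mem_powersetCard] at hT ⊢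
    obtain ⟨⟨⟨h1, h2⟩, h3⟩, h4⟩ := hT
    refine ⟨⟨?_, ?_⟩, ?_⟩
    · intro x hx
      rw [Finset.mem_erase] at hx
      exact Finset.mem_filter.2 ⟨h1 hx.2, h3 v h4 x hx.2 (Ne.symm hx.1)⟩
    · rw [Finset.card_erase_of_mem h4, h2]; rfl
    · intro x hx y hy hxy
      exact h3 x (Finset.mem_of_mem_erase hx) y (Finset.mem_of_mem_erase hy) hxy
  · intro T hT
    simp only [Finset.mem_filter, Finset.mem_powersetCard] at hT ⊢
    obtain ⟨⟨h1, h2⟩, h3⟩ := hT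
    have hvT : v ∉ T := fun h => adjE_irrefl v (Finset.mem_filter.1 (h1 h)).2
    refine ⟨⟨⟨?_, ?_⟩, ?_⟩, Finset.mem_insert_self _ _⟩
    · intro x hx
      rcases Finset.mem_insert.1 hx with rfl | hx
      · exact hv
      · exact (Finset.mem_filter.1 (h1 hx)).1
    · rw [Finset.card_insert_of_notMem hvT, h2]
    · intro x hx y hy hxy
      rcases Finset.mem_insert.1 hx with e | hx2 <;> rcases Finset.mem_insert.1 hy with e2 | hy2
      · exact absurd (e.trans e2.symm) hxy
      · rw [e]
        exact (Finset.mem_filter.1 (h1 hy2)).2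
      · rw [e2]
        exact (adjE_comm _ _).1 (Finset.mem_filter.1 (h1 hx2)).2
      · exact h3 x hx2 y hy2 hxy
  · intro T hT
    exact Finset.insert_erase (Finset.mem_filter.1 hT).2
  · intro T hT
    simp only [Finset.mem_filter, Finset.mem_powersetCard] at hT
    exact Finset.erase_insert fun h => adjE_irrefl v (Finset.mem_filter.1 (hT.1.1 h)).2

theorem cl_step (P : Finset Exc) (k : ℕ) :
    (k + 1) * cl P (k + 1) = ∑ u ∈ P, cl (P.filter (adjE u)) k := by
  have h1 : ∀ u ∈ P, cl (P.filter (adjE u)) k =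
      ∑ T ∈ (P.powersetCard (k + 1)).filter (IsClique {1, 2}), if u ∈ T then 1 else 0 := by
    intro u hu
    rw [← cl_mem P k u hu, Finset.card_filter]
  rw [Finset.sum_congr rfl h1, Finset.sum_comm]
  have h2 : ∀ T ∈ (P.powersetCard (k + 1)).filter (IsClique {1, 2}),
      (∑ u ∈ P, if u ∈ T then 1 else 0) = k + 1 := by
    intro T hT
    simp only [Finset.mem_filter, Finset.mem_powersetCard] at hT
    rw [← Finset.card_filter, Finset.filter_mem_eq_inter, Finset.inter_eq_right.2 hT.1.1]
    exact hT.1.2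
  rw [Finset.sum_congr rfl h2, Finset.sum_const, smul_eq_mul, mul_comm]
  rfl

theorem cl_insert (P : Finset Exc) (k : ℕ) (v : Exc) (hv : v ∉ P) :
    cl (insert v P) (k + 1) = cl (P.filter (adjE v)) k + cl P (k + 1) := by
  have h1 := cl_mem (insert v P) k v (Finset.mem_insert_self _ _)
  rw [Finset.filter_insert, if_neg (adjE_irrefl v)] at h1
  rw [← h1]
  conv_lhs => unfold cl
  rw [← Finset.card_filter_add_card_filter_not (fun T => v ∈ T)]
  congr 1
  unfold cl
  congr 1
  ext T
  simp only [Finset.mem_filter, Finset.mem_powersetCard]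
  constructor
  · rintro ⟨⟨⟨h1, h2⟩, h3⟩, h4⟩
    exact ⟨⟨(Finset.subset_insert_iff_of_notMem h4).1 h1, h2⟩, h3⟩
  · rintro ⟨⟨h1, h2⟩, h3⟩
    exact ⟨⟨⟨h1.trans (Finset.subset_insert _ _), h2⟩, h3⟩, fun h => hv (h1 h)⟩

theorem cl_zero (P : Finset Exc) : cl P 0 = 1 := by
  unfold cl
  rw [Finset.powersetCard_zero, Finset.filter_singleton, if_pos]
  · rfl
  · intro x hx
    simp at hx

theorem cl_empty (k : ℕ) : cl ∅ (k + 1) = 0 := by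
  unfold cl
  rw [Finset.powersetCard_eq_empty.2 (by simp)]
  rfl

theorem Nb_cons (u : Exc) (L : List Exc) : Nb (u :: L) = (Nb L).filter (adjE u) := by
  ext x
  simp [Nb, and_comm]

theorem FE_step (L : List Exc) (k : ℕ) :
    (k + 1) * FE L (k + 1) = ∑ u ∈ Nb L, FE (u :: L) k := by
  unfold FE
  rw [cl_step]
  exact Finset.sum_congr rfl fun u _ => by rw [Nb_cons]

theorem FE_congr (L M : List Exc) (h : ∀ x, x ∈ L ↔ x ∈ M) (k : ℕ) : FE L k = FE M k := by
  have : Nb L = Nb M := by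
    ext x
    simp [Nb, h]
  unfold FE
  rw [this]

theorem cl_map (g : Exc ≃ Exc) (hg : ∀ x y, Bx (g x) (g y) = Bx x y) (P : Finset Exc) (k : ℕ) :
    cl (P.map g.toEmbedding) k = cl P k := by
  unfold cl
  symm
  refine Finset.card_bij (fun T _ => T.map g.toEmbedding) ?_ ?_ ?_
  · intro T hT
    simp only [Finset.mem_filter, Finset.mem_powersetCard] at hT ⊢
    refine ⟨⟨Finset.map_subset_map.2 hT.1.1, by rw [Finset.card_map]; exact hT.1.2⟩, ?_⟩
    intro x hx y hy hxy
    obtain ⟨x', hx', rfl⟩ := Finset.mem_map.1 hx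
    obtain ⟨y', hy', rfl⟩ := Finset.mem_map.1 hy
    have := hT.2 x' hx' y' hy' (fun h => hxy (by rw [h]))
    rw [← hg] at this
    exact this
  · intro T _ T' _ h
    exact Finset.map_injective _ h
  · intro T hT
    simp only [Finset.mem_filter, Finset.mem_powersetCard] at hT
    refine ⟨T.map g.symm.toEmbedding, ?_, ?_⟩
    · simp only [Finset.mem_filter, Finset.mem_powersetCard]
      refine ⟨⟨?_, by rw [Finset.card_map]; exact hT.1.2⟩, ?_⟩
      · intro x hx
        obtain ⟨y, hy, rfl⟩ := Finset.mem_map.1 hx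
        obtain ⟨z, hz, hzy⟩ := Finset.mem_map.1 (hT.1.1 hy)
        rw [← hzy]
        simpa using hz
      · intro x hx y hy hxy
        obtain ⟨x', hx', rfl⟩ := Finset.mem_map.1 hx
        obtain ⟨y', hy', rfl⟩ := Finset.mem_map.1 hy
        have := hT.2 x' hx' y' hy' (fun h => hxy (by rw [h]))
        rw [← hg]
        simpa using this
    · ext x
      simp

theorem FE_map (g : Exc ≃ Exc) (hg : ∀ x y, Bx (g x) (g y) = Bx x y) (L : List Exc) (k : ℕ) :
    FE (L.map g) k = FE L k := by
  have key : Nb (L.map g) = (Nb L).map g.toEmbedding := by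
    ext x
    simp only [Nb, Finset.mem_filter, Finset.mem_univ, true_and, List.mem_map, forall_exists_index,
      and_imp, forall_apply_eq_imp_iff₂, Finset.mem_map]
    constructor
    · intro h
      refine ⟨g.symm x, fun l hl => ?_, by simp⟩
      have := h l hl
      unfold adjE at this ⊢
      rw [← hg]
      simpa using this
    · rintro ⟨y, hy, rfl⟩ l hl
      have := hy l hl
      unfold adjE at this ⊢
      rw [← hg] at this
      exact this
  unfold FE
  rw [key, cl_map g hg]

theorem FE_swap (L : List Exc) (u w : Exc) (h : Bx u w = 0) (hL : ∀ l ∈ L, Bx l u = Bx l w)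
    (k : ℕ) : FE (u :: L) k = FE (w :: L) k := by
  rw [← FE_map (rE u w h) (rE_B u w h) (u :: L) k, List.map_cons, rE_swap]
  congr 2
  conv_rhs => rw [← List.map_id L]
  apply List.map_congr_left
  intro l hl
  exact rE_fix u w h l (hL l hl)

theorem FE_nil (k : ℕ) :
    {S : Finset Exc | S.card = k ∧ IsClique {1, 2} S}.ncard = FE [] k := by
  unfold FE cl
  rw [← Set.ncard_coe_finset ((((Nb []).powersetCard k).filter (IsClique {1, 2})))]
  congr 1
  ext S
  simp [Nb, Finset.mem_powersetCard]

theorem getK_mem (d : ℕ) (l : List ℕ) : ∀ i : ℕ, ∃ c, (c = d ∨ c ∈ l) ∧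
    ∀ (α : Type) (f : ℕ → α), getK d f l i = f c := by
  induction l with
  | nil => exact fun i => ⟨d, Or.inl rfl, fun _ _ => rfl⟩
  | cons v l ih =>
    intro i
    cases i with
    | zero => exact ⟨v, Or.inr List.mem_cons_self, fun _ _ => rfl⟩
    | succ j =>
      obtain ⟨c, hc, h⟩ := ih j
      exact ⟨c, hc.imp id (List.mem_cons_of_mem _), fun α f => h α f⟩

theorem nthK_ex (i : ℕ) : ∃ x : Exc, ∀ (α : Type) (f : ℕ → α), nthK i f = f (enc x) := by
  obtain ⟨c, hc, h⟩ := getK_mem _ codes i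
  have hm : c ∈ codes := by
    rcases hc with e | hc
    · rw [e]
      exact List.mem_cons_self
    · exact hc
  obtain ⟨x, rfl⟩ := codes_enc c hm
  exact ⟨x, h⟩

noncomputable def dE (i : ℕ) : Exc := (nthK_ex i).choose

theorem nthK_eq {α : Type} (i : ℕ) (f : ℕ → α) : nthK i f = f (enc (dE i)) :=
  (nthK_ex i).choose_spec α f

theorem cond_and (a b : Bool) : cond a b false = true ↔ a = true ∧ b = true := by
  cases a <;> simp

theorem allK_iff {β : Type} (p : β → Bool) (P : List β) :
    allK p P = true ↔ ∀ x ∈ P, p x = true := by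
  induction P with
  | nil => simp [allK]
  | cons v P ih =>
    have : allK p (v :: P) = cond (p v) (allK p P) false := rfl
    rw [this, cond_and, ih]
    simp

theorem anyK_iff {β : Type} (p : β → Bool) (P : List β) :
    anyK p P = true ↔ ∃ x ∈ P, p x = true := by
  induction P with
  | nil => simp [anyK]
  | cons v P ih =>
    have : anyK p (v :: P) = cond (p v) true (anyK p P) := rfl
    rw [this]
    cases h : p v
    · simp [ih, h]
    · simp [h]

theorem forceK_eq {α : Type} (n : ℕ) (f : ℕ → α) : forceK n f = f n := by
  cases n <;> rfl

theorem filtK_eq {α : Type} (v : Exc) (f : List ℕ → α) (P : List Exc) : ∀ acc : List Exc,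
    filtK (adjN (enc v)) f (P.map enc) (acc.map enc) =
      f (((P.filter (fun x => adjE v x)).reverse ++ acc).map enc) := by
  induction P with
  | nil => intro acc; rfl
  | cons x P ih =>
    intro acc
    have e : filtK (adjN (enc v)) f ((x :: P).map enc) (acc.map enc) =
      cond (adjN (enc v) (enc x)) (filtK (adjN (enc v)) f (P.map enc) ((x :: acc).map enc))
        (filtK (adjN (enc v)) f (P.map enc) (acc.map enc)) := rfl
    rw [e, ih, ih]
    by_cases h : adjE v x
    · rw [(adj_enc v x).2 h]
      simp [h]
    · have h2 : adjN (enc v) (enc x) = false := by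
        rw [← Bool.not_eq_true, adj_enc]
        exact h
      rw [h2]
      simp [h]

theorem lenK_eq (P : List ℕ) : lenK P = P.length := by
  induction P with
  | nil => rfl
  | cons v P ih =>
    have : lenK (v :: P) = lenK P + 1 := rfl
    rw [this, ih]
    rfl

theorem bt_eq (k : ℕ) : ∀ P : List Exc, P.Nodup → bt k (P.map enc) = cl P.toFinset (k + 1) := by
  induction k with
  | zero =>
    intro P hP
    have e : bt 0 (P.map enc) = lenK (P.map enc) := rfl
    rw [e, lenK_eq, List.length_map]
    clear e
    induction P with
    | nil => exact (cl_empty 0).symm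
    | cons v P ih =>
      rw [List.nodup_cons] at hP
      rw [List.toFinset_cons, cl_insert _ _ _ (by simpa using hP.1), cl_zero, ← ih hP.2,
        List.length_cons, add_comm]
  | succ k ihk =>
    intro P hP
    have e : bt (k + 1) (P.map enc) = btStep (bt k) (P.map enc) := rfl
    rw [e]
    clear e
    induction P with
    | nil => exact (cl_empty _).symm
    | cons v P ih =>
      rw [List.nodup_cons] at hP
      have e : btStep (bt k) ((v :: P).map enc) =
        filtK (adjN (enc v)) (bt k) (P.map enc) (([] : List Exc).map enc)
          + btStep (bt k) (P.map enc) := rfl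
      rw [e, ih hP.2, filtK_eq, List.append_nil, ihk _ (List.nodup_reverse.2 (hP.2.filter _)),
        List.toFinset_cons, cl_insert _ _ _ (by simpa using hP.1)]
      congr 2
      ext x
      simp

theorem nbrK_eq (L : List ℕ) : ∀ P : List Exc, P.Nodup → ∃ Q : List Exc, Q.Nodup ∧
    (∀ x, x ∈ Q ↔ x ∈ P ∧ ∀ l ∈ L.map dE, adjE l x) ∧
    ∀ (α : Type) (f : List ℕ → α), nbrK f L (P.map enc) = f (Q.map enc) := by
  induction L with
  | nil => exact fun P hP => ⟨P, hP, by simp, fun _ _ => rfl⟩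
  | cons i L ih =>
    intro P hP
    obtain ⟨Q, h1, h2, h3⟩ := ih ((P.filter (fun x => adjE (dE i) x)).reverse ++ [])
      (by rw [List.append_nil]; exact List.nodup_reverse.2 (hP.filter _))
    refine ⟨Q, h1, ?_, ?_⟩
    · intro x
      rw [h2]
      simp
      tauto
    · intro α f
      have e : nbrK f (i :: L) (P.map enc) =
        nthK i fun l => filtK (adjN l) (nbrK f L) (P.map enc) (([] : List Exc).map enc) := rfl
      rw [e, nthK_eq, filtK_eq, h3]

theorem nbrK_codes (L : List ℕ) : ∃ Q : List Exc, Q.Nodup ∧ Q.toFinset = Nb (L.map dE) ∧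
    ∀ (α : Type) (f : List ℕ → α), nbrK f L codes = f (Q.map enc) := by
  obtain ⟨Q, h1, h2, h3⟩ := nbrK_eq L exl exl_nodup
  refine ⟨Q, h1, ?_, ?_⟩
  · ext x
    rw [List.mem_toFinset, h2]
    simp [Nb, mem_exl]
  · rw [exl_map] at h3
    exact h3

theorem codK_eq {α : Type} (f : List ℕ → α) (L : List ℕ) : ∀ acc : List Exc,
    codK f L (acc.map enc) = f (((L.map dE).reverse ++ acc).map enc) := by
  induction L with
  | nil => intro acc; rfl
  | cons i L ih =>
    intro acc
    have e : codK f (i :: L) (acc.map enc) = nthK i fun z => codK f L (z :: acc.map enc) := rfl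
    rw [e, nthK_eq]
    have := ih (dE i :: acc)
    rw [List.map_cons] at this
    rw [this]
    simp

theorem mapK_eq {α : Type} (p q : Exc) (h : Bx p q = 0) (f : List ℕ → α) (L : List Exc) :
    ∀ acc : List Exc, mapK (reflN (enc p) (enc q)) f (L.map enc) (acc.map enc) =
      f (((L.map (rE p q h)).reverse ++ acc).map enc) := by
  induction L with
  | nil => intro acc; rfl
  | cons x L ih =>
    intro acc
    have e : mapK (reflN (enc p) (enc q)) f ((x :: L).map enc) (acc.map enc) =
      forceK (reflN (enc p) (enc q) (enc x))
        fun z => mapK (reflN (enc p) (enc q)) f (L.map enc) (z :: acc.map enc) := rfl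
    rw [e, forceK_eq, ← enc_rE p q h]
    have := ih (rE p q h x :: acc)
    rw [List.map_cons] at this
    rw [this]
    simp

theorem ip_78 (x y : Exc) : Nat.beq (ip (enc x) (enc y)) 78 = true ↔ Bx x y = 0 := by
  rw [Nat.beq_eq]
  have := ip_enc x y
  omega

theorem wordK_eq (f : List ℕ → Bool) (w : List (ℕ × ℕ)) : ∀ L : List Exc,
    wordK f w (L.map enc) = true →
      ∃ M : List Exc, f (M.map enc) = true ∧ ∀ k, FE M k = FE L k := by
  induction w with
  | nil => exact fun L h => ⟨L, h, fun _ => rfl⟩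
  | cons pq w ih =>
    intro L h
    have e : wordK f (pq :: w) (L.map enc) = nthK pq.1 fun p => nthK pq.2 fun q =>
      cond (Nat.beq (ip p q) 78) (mapK (reflN p q) (wordK f w) (L.map enc)
        (([] : List Exc).map enc)) false := rfl
    rw [e, nthK_eq, nthK_eq, cond_and, ip_78] at h
    obtain ⟨h1, h2⟩ := h
    rw [mapK_eq _ _ h1] at h2
    obtain ⟨M, hM, hF⟩ := ih _ h2
    refine ⟨M, hM, fun k => ?_⟩
    rw [hF, ← FE_map (rE _ _ h1) (rE_B _ _ h1) L]
    exact FE_congr _ _ (by simp) k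

theorem subK_iff (L T : List Exc) : subK (L.map enc) (T.map enc) = true ↔ ∀ x ∈ L, x ∈ T := by
  unfold subK
  rw [allK_iff]
  simp only [anyK_iff, List.mem_map, forall_exists_index, and_imp, forall_apply_eq_imp_iff₂,
    exists_exists_and_eq_and, Nat.beq_eq]
  constructor
  · intro h x hx
    obtain ⟨y, hy, e⟩ := h x hx
    exact enc_inj e ▸ hy
  · exact fun h x hx => ⟨x, h x hx, rfl⟩

def known (k : ℕ) (K : List (List ℕ × ℕ)) : Prop := ∀ e ∈ K, FE (e.1.map dE) k = e.2

theorem kget_mem (f : List ℕ × ℕ → Bool) (K : List (List ℕ × ℕ)) : ∀ i,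
    kget f false K i = true → ∃ e ∈ K, f e = true := by
  induction K with
  | nil =>
    intro i h
    exact absurd h (by simp [kget])
  | cons v K ih =>
    intro i h
    cases i with
    | zero => exact ⟨v, List.mem_cons_self, h⟩
    | succ j =>
      obtain ⟨e, he, h⟩ := ih j h
      exact ⟨e, List.mem_cons_of_mem _ he, h⟩

theorem repChk_ok (k : ℕ) (K : List (List ℕ × ℕ)) (hK : known k K) (L : List ℕ) (r : RepD)
    (h : repChk K L r = true) : FE (dE r.1 :: L.map dE) k = r.2.1 := by
  obtain ⟨e, he, h⟩ := kget_mem _ _ _ h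
  rw [cond_and, Nat.beq_eq] at h
  obtain ⟨h1, h2⟩ := h
  have c1 := codK_eq (fun T => codK (fun L' => wordK (fun L'' => cond (subK L'' T) (subK T L'') false)
      r.2.2.2 L') (r.1 :: L) []) e.1 []
  rw [List.map_nil] at c1
  rw [c1] at h2
  have c2 := codK_eq (fun L' => wordK (fun L'' => cond
    (subK L'' (((e.1.map dE).reverse ++ []).map enc))
    (subK (((e.1.map dE).reverse ++ []).map enc) L'') false) r.2.2.2 L') (r.1 :: L) []
  rw [List.map_nil] at c2
  rw [c2] at h2
  obtain ⟨M, hM, hF⟩ := wordK_eq _ _ _ h2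
  rw [cond_and, subK_iff, subK_iff] at hM
  rw [← h1, ← hK e he]
  rw [FE_congr (e.1.map dE) M (fun x => ⟨fun hx => hM.2 x (by simpa using hx),
    fun hx => by simpa using hM.1 x hx⟩), hF]
  exact FE_congr _ _ (by simp [or_comm]) k

theorem prof_iff (L : List Exc) (u w : Exc) : prof (L.map enc) (enc u) (enc w) = true ↔
    ∀ l ∈ L, Bx l u = Bx l w := by
  unfold prof
  rw [allK_iff]
  simp only [List.mem_map, forall_exists_index, and_imp, forall_apply_eq_imp_iff₂, Nat.beq_eq]
  refine forall₂_congr fun l _ => ?_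
  have h1 := ip_enc l u
  have h2 := ip_enc l w
  omega

theorem conn_ok (L P : List Exc) (u w : Exc) (k : ℕ)
    (h : conn (L.map enc) (P.map enc) (enc u) (enc w) = true) : FE (u :: L) k = FE (w :: L) k := by
  unfold conn at h
  cases h1 : Nat.beq (enc u) (enc w)
  · rw [h1, cond_false, cond_and, prof_iff] at h
    obtain ⟨hp, h⟩ := h
    cases h2 : Nat.beq (ip (enc u) (enc w)) 78
    · rw [h2, cond_false, anyK_iff] at h
      obtain ⟨c, hc, h⟩ := h
      obtain ⟨z, hz, rfl⟩ := List.mem_map.1 hc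
      rw [cond_and, cond_and, ip_78, ip_78, prof_iff] at h
      obtain ⟨a1, a2, a3⟩ := h
      rw [FE_swap L u z a1 a3 k]
      exact FE_swap L z w a2 (fun l hl => (a3 l hl).symm.trans (hp l hl)) k
    · rw [ip_78] at h2
      exact FE_swap L u w h2 hp k
  · rw [Nat.beq_eq] at h1
    rw [enc_inj h1]

theorem lookK_ok (L P : List Exc) (w : Exc) (f : ℕ → Bool) (k : ℕ) (R : List RepD)
    (h : lookK (L.map enc) (P.map enc) (enc w) f R = true) :
    ∃ r ∈ R, f r.2.1 = true ∧ FE (w :: L) k = FE (dE r.1 :: L) k := by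
  induction R with
  | nil => exact absurd h (by simp [lookK])
  | cons r R ih =>
    have e : lookK (L.map enc) (P.map enc) (enc w) f (r :: R) =
      cond (nthK r.1 fun u => conn (L.map enc) (P.map enc) u (enc w)) (f r.2.1)
        (lookK (L.map enc) (P.map enc) (enc w) f R) := rfl
    rw [e, nthK_eq] at h
    cases h1 : conn (L.map enc) (P.map enc) (enc (dE r.1)) (enc w)
    · rw [h1] at h
      obtain ⟨s, hs, h⟩ := ih h
      exact ⟨s, List.mem_cons_of_mem _ hs, h⟩
    · rw [h1] at h
      exact ⟨r, List.mem_cons_self, h, (conn_ok _ _ _ _ k h1).symm⟩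

theorem sumK_ok (L P0 : List Exc) (R : List RepD) (k tot : ℕ)
    (hR : ∀ r ∈ R, FE (dE r.1 :: L) k = r.2.1) (P : List Exc) : ∀ acc : ℕ,
    sumK (L.map enc) (P0.map enc) R tot (P.map enc) acc = true →
      acc + (P.map fun w => FE (w :: L) k).sum = tot := by
  induction P with
  | nil =>
    intro acc h
    have e : sumK (L.map enc) (P0.map enc) R tot (([] : List Exc).map enc) acc =
      Nat.beq acc tot := rfl
    rw [e, Nat.beq_eq] at h
    simpa using h
  | cons w P ih =>
    intro acc h
    have e : sumK (L.map enc) (P0.map enc) R tot ((w :: P).map enc) acc =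
      lookK (L.map enc) (P0.map enc) (enc w) (fun v => forceK (Nat.add acc v)
        (sumK (L.map enc) (P0.map enc) R tot (P.map enc))) R := rfl
    rw [e] at h
    obtain ⟨r, hr, h1, h2⟩ := lookK_ok L P0 w _ k R h
    rw [forceK_eq] at h1
    have h3 := ih _ h1
    have h4 : Nat.add acc r.2.1 = acc + r.2.1 := rfl
    rw [h4] at h3
    rw [List.map_cons, List.sum_cons, h2, hR r hr, ← h3]
    ring

theorem entryChk_ok (k : ℕ) (K : List (List ℕ × ℕ)) (hK : known k K) (e : Entry)
    (h : entryChk k K e = true) : FE (e.1.map dE) (k + 1) = e.2.1 := by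
  unfold entryChk at h
  rw [cond_and, allK_iff] at h
  obtain ⟨h1, h2⟩ := h
  obtain ⟨Q, q1, q2, q3⟩ := nbrK_codes e.1
  rw [q3] at h2
  have c1 := codK_eq (fun L => sumK L (Q.map enc) e.2.2 (Nat.mul (Nat.succ k) e.2.1)
    (Q.map enc) 0) e.1 []
  rw [List.map_nil, List.append_nil] at c1
  rw [c1] at h2
  have hc : ∀ w, FE (w :: (e.1.map dE).reverse) k = FE (w :: e.1.map dE) k :=
    fun w => FE_congr _ _ (by simp) k
  have h3 := sumK_ok _ _ _ k _ (fun r hr => (hc _).trans (repChk_ok k K hK e.1 r (h1 r hr))) _ _ h2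
  rw [zero_add] at h3
  simp only [hc] at h3
  rw [← List.sum_toFinset _ q1, q2, ← FE_step] at h3
  exact Nat.eq_of_mul_eq_mul_left (Nat.succ_pos k) h3

theorem stepChk_ok (k : ℕ) (K M : List (List ℕ × ℕ)) (S : List Entry) (hK : known k K)
    (h : stepChk k K S = true) (hS : S.map (fun e => (e.1, e.2.1)) = M) : known (k + 1) M := by
  unfold stepChk at h
  rw [allK_iff] at h
  intro e he
  rw [← hS, List.mem_map] at he
  obtain ⟨s, hs, rfl⟩ := he
  exact entryChk_ok k K hK s (h s hs)

theorem leafChk_ok (k : ℕ) (K : List (List ℕ × ℕ)) (h : leafChk k K = true) : known (k + 1) K := by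
  unfold leafChk at h
  rw [allK_iff] at h
  intro e he
  have h1 := h e he
  rw [Nat.beq_eq] at h1
  obtain ⟨Q, q1, q2, q3⟩ := nbrK_codes e.1
  rw [q3, bt_eq k Q q1, q2] at h1
  exact h1

def K0 : List (List ℕ × ℕ) :=
  [([], 107700096)]

def K1 : List (List ℕ × ℕ) :=
  [([0], 4487504)]

def K2 : List (List ℕ × ℕ) :=
  [([0, 29], 257208),
   ([0, 141], 142488)]

def K3 : List (List ℕ × ℕ) :=
  [([0, 29, 61], 20352),
   ([0, 29, 120], 12324),
   ([0, 29, 216], 3984),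
   ([0, 141, 238], 37440)]

def K4 : List (List ℕ × ℕ) :=
  [([0, 29, 61, 84], 2128),
   ([0, 29, 61, 130], 1572),
   ([0, 29, 61, 179], 494),
   ([0, 29, 61, 237], 184),
   ([0, 29, 61, 104], 1856),
   ([0, 29, 120, 188], 928),
   ([0, 29, 120, 215], 174),
   ([0, 29, 120, 209], 3640),
   ([0, 29, 216, 238], 720)]

def K5 : List (List ℕ × ℕ) :=
  [([0, 29, 61, 84, 123], 262),
   ([0, 29, 61, 84, 161], 88),
   ([0, 29, 61, 84, 208], 30),
   ([0, 29, 61, 84, 91], 254),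
   ([0, 29, 61, 130, 228], 62),
   ([0, 29, 61, 130, 140], 220),
   ([0, 29, 61, 130, 175], 36),
   ([0, 29, 61, 130, 135], 104),
   ([0, 29, 61, 130, 174], 528),
   ([0, 29, 61, 130, 236], 14),
   ([0, 29, 61, 179, 224], 8),
   ([0, 29, 61, 179, 209], 108),
   ([0, 29, 61, 237, 135], 48),
   ([0, 29, 120, 188, 209], 300),
   ([0, 29, 120, 215, 238], 24)]

def S0 : List Entry :=
  [([], 107700096,
     [(0, 4487504, 0, []),
      (239, 4487504, 0, [(239, 141), (141, 1), (1, 0)])])]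

def S1 : List Entry :=
  [([0], 4487504,
     [(29, 257208, 0, []),
      (141, 142488, 1, []),
      (210, 257208, 0, [(210, 120), (120, 30), (30, 29)]),
      (238, 142488, 1, [(238, 198), (198, 142), (142, 141)])])]

def S2 : List Entry :=
  [([0, 29], 257208,
     [(61, 20352, 0, []),
      (120, 12324, 1, []),
      (147, 12324, 1, [(29, 1), (1, 0), (140, 120)]),
      (216, 3984, 2, []),
      (178, 20352, 0, [(178, 130), (130, 65), (65, 61)]),
      (209, 12324, 1, [(209, 157), (157, 122), (122, 120)]),
      (232, 12324, 1, [(29, 1), (1, 0), (204, 151), (151, 120)])]),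
   ([0, 141], 142488,
     [(35, 12324, 1, [(35, 2), (2, 0), (35, 29), (134, 120)]),
      (135, 3984, 2, [(135, 35), (35, 29), (221, 216)]),
      (198, 3984, 2, [(141, 1), (1, 0), (238, 221), (221, 216)]),
      (204, 12324, 1, [(204, 36), (36, 0), (204, 99), (99, 29), (134, 120)]),
      (238, 37440, 3, [])])]

def S3 : List Entry :=
  [([0, 29, 61], 20352,
     [(84, 2128, 0, []),
      (130, 1572, 1, []),
      (134, 1572, 1, [(61, 30), (30, 29), (133, 130)]),
      (194, 1572, 1, [(29, 1), (1, 0), (135, 35), (35, 29), (135, 75), (75, 61), (158, 130)]),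
      (179, 494, 2, []),
      (203, 494, 2, [(29, 1), (1, 0), (135, 75), (75, 61), (182, 179)]),
      (225, 494, 2, [(61, 1), (1, 0), (61, 30), (30, 29), (135, 75), (75, 61), (209, 180), (180, 179)]),
      (237, 184, 3, []),
      (104, 1856, 4, []),
      (135, 1856, 4, [(135, 2), (2, 0), (135, 35), (35, 29), (178, 130), (130, 65), (65, 61)]),
      (155, 2128, 0, [(155, 123), (123, 86), (86, 84)]),
      (174, 1572, 1, [(174, 137), (137, 131), (131, 130)]),
      (205, 1572, 1, [(61, 30), (30, 29), (168, 136), (136, 130)]),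
      (220, 1572, 1, [(29, 1), (1, 0), (135, 35), (35, 29), (135, 75), (75, 61), (139, 133), (133, 130)])]),
   ([0, 29, 120], 12324,
     [(71, 1572, 1, [(71, 31), (31, 29), (71, 61), (132, 130)]),
      (188, 928, 5, []),
      (121, 494, 2, [(121, 71), (71, 61), (180, 179)]),
      (157, 494, 2, [(120, 30), (30, 29), (209, 180), (180, 179)]),
      (215, 174, 6, []),
      (231, 174, 6, [(120, 30), (30, 29), (209, 157), (157, 122), (122, 120), (229, 215)]),
      (168, 1572, 1, [(168, 72), (72, 29), (168, 106), (106, 61), (132, 130)]),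
      (209, 3640, 7, []),
      (226, 928, 5, [(226, 197), (197, 191), (191, 188)])]),
   ([0, 29, 216], 3984,
     [(75, 494, 2, [(75, 2), (2, 0), (75, 30), (30, 29), (130, 65), (65, 61), (209, 180), (180, 179)]),
      (140, 174, 6, [(140, 35), (35, 29), (204, 151), (151, 120)]),
      (199, 174, 6, [(29, 1), (1, 0), (120, 30), (30, 29), (209, 157), (157, 122), (122, 120), (220, 215)]),
      (135, 184, 3, [(135, 75), (75, 61), (238, 237)]),
      (164, 494, 2, [(164, 14), (14, 0), (164, 66), (66, 29), (130, 65), (65, 61), (209, 180), (180, 179)]),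
      (238, 720, 8, [])]),
   ([0, 141, 238], 37440,
     [(35, 3640, 7, [(35, 2), (2, 0), (35, 29), (134, 120)]),
      (204, 3640, 7, [(204, 36), (36, 0), (204, 99), (99, 29), (134, 120)])])]

def S4 : List Entry :=
  [([0, 29, 61, 84], 2128,
     [(123, 262, 0, []),
      (132, 262, 0, [(84, 65), (65, 61), (127, 123)]),
      (162, 262, 0, [(61, 30), (30, 29), (121, 71), (71, 61), (121, 87), (87, 84), (149, 123)]),
      (196, 262, 0, [(29, 1), (1, 0), (135, 35), (35, 29), (148, 100), (100, 61), (118, 86), (86, 84), (153, 128), (128, 124), (124, 123)]),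
      (161, 88, 1, []),
      (167, 88, 1, [(61, 30), (30, 29), (121, 87), (87, 84), (164, 161)]),
      (181, 88, 1, [(84, 30), (30, 29), (84, 65), (65, 61), (121, 87), (87, 84), (174, 164), (164, 161)]),
      (214, 88, 1, [(29, 1), (1, 0), (135, 35), (35, 29), (135, 75), (75, 61), (148, 111), (111, 84), (164, 161)]),
      (223, 88, 1, [(29, 1), (1, 0), (84, 30), (30, 29), (84, 65), (65, 61), (113, 86), (86, 84), (174, 164), (164, 161)]),
      (230, 88, 1, [(61, 1), (1, 0), (84, 30), (30, 29), (121, 71), (71, 61), (91, 86), (86, 84), (174, 164), (164, 161)]),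
      (208, 30, 2, []),
      (229, 30, 2, [(29, 1), (1, 0), (135, 75), (75, 61), (126, 89), (89, 84), (209, 208)]),
      (235, 30, 2, [(61, 1), (1, 0), (61, 30), (30, 29), (135, 75), (75, 61), (121, 87), (87, 84)]),
      (237, 30, 2, [(84, 3), (3, 0), (84, 30), (30, 29), (126, 68), (68, 61), (121, 87), (87, 84)]),
      (91, 254, 3, []),
      (104, 254, 3, [(84, 30), (30, 29), (84, 65), (65, 61), (121, 87), (87, 84)]),
      (113, 254, 3, [(61, 30), (30, 29), (113, 86), (86, 84)]),
      (118, 254, 3, [(29, 1), (1, 0), (135, 75), (75, 61), (118, 86), (86, 84)]),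
      (121, 254, 3, [(29, 1), (1, 0), (135, 75), (75, 61), (126, 89), (89, 84)]),
      (126, 254, 3, [(61, 30), (30, 29), (121, 87), (87, 84)]),
      (135, 254, 3, [(84, 30), (30, 29), (84, 65), (65, 61), (113, 86), (86, 84)]),
      (148, 254, 3, [(148, 8), (8, 0), (121, 31), (31, 29), (148, 100), (100, 61), (155, 123), (123, 86), (86, 84)]),
      (153, 262, 0, [(153, 128), (128, 124), (124, 123)]),
      (169, 262, 0, [(84, 65), (65, 61), (150, 124), (124, 123)]),
      (176, 262, 0, [(61, 30), (30, 29), (121, 71), (71, 61), (121, 87), (87, 84), (128, 124), (124, 123)]),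
      (218, 262, 0, [(29, 1), (1, 0), (135, 35), (35, 29), (148, 100), (100, 61), (118, 86), (86, 84)])]),
   ([0, 29, 61, 130], 1572,
     [(89, 262, 0, [(89, 68), (68, 61), (89, 84)]),
      (126, 88, 1, [(126, 89), (89, 84), (164, 161)]),
      (137, 88, 1, [(130, 65), (65, 61), (174, 164), (164, 161)]),
      (228, 62, 4, []),
      (140, 220, 5, []),
      (165, 220, 5, [(130, 65), (65, 61), (174, 137), (137, 131), (131, 130), (172, 140)]),
      (175, 36, 6, []),
      (182, 36, 6, [(130, 65), (65, 61), (174, 137), (137, 131), (131, 130), (177, 175)]),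
      (197, 220, 5, [(29, 1), (1, 0), (130, 65), (65, 61), (136, 130)]),
      (199, 220, 5, [(29, 1), (1, 0), (135, 75), (75, 61), (164, 131), (131, 130), (172, 140)]),
      (202, 36, 6, [(29, 1), (1, 0), (135, 75), (75, 61), (164, 131), (131, 130), (177, 175)]),
      (226, 36, 6, [(29, 1), (1, 0), (130, 65), (65, 61), (136, 130)]),
      (135, 104, 7, []),
      (150, 262, 0, [(150, 101), (101, 61), (150, 112), (112, 84)]),
      (164, 104, 7, [(130, 65), (65, 61), (174, 137), (137, 131), (131, 130)]),
      (174, 528, 8, []),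
      (236, 14, 9, []),
      (238, 14, 9, [(130, 65), (65, 61), (174, 137), (137, 131), (131, 130)])]),
   ([0, 29, 61, 179], 494,
     [(87, 88, 1, [(87, 31), (31, 29), (87, 65), (65, 61), (123, 86), (86, 84), (174, 164), (164, 161)]),
      (195, 62, 4, [(29, 1), (1, 0), (135, 35), (35, 29), (135, 75), (75, 61), (159, 130), (233, 228)]),
      (133, 36, 6, [(133, 71), (71, 61), (168, 136), (136, 130)]),
      (163, 36, 6, [(61, 30), (30, 29), (130, 65), (65, 61), (174, 137), (137, 131), (131, 130), (176, 175)]),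
      (121, 30, 2, [(121, 87), (87, 84), (209, 208)]),
      (224, 8, 10, []),
      (231, 8, 10, [(61, 30), (30, 29), (209, 180), (180, 179), (229, 224)]),
      (215, 14, 9, [(29, 1), (1, 0), (135, 35), (35, 29), (135, 75), (75, 61), (133, 130)]),
      (104, 104, 7, [(104, 34), (34, 29), (104, 65), (65, 61), (168, 136), (136, 130)]),
      (135, 104, 7, [(135, 35), (35, 29), (135, 75), (75, 61), (158, 130)]),
      (152, 88, 1, [(152, 58), (58, 29), (152, 100), (100, 61), (123, 86), (86, 84), (174, 164), (164, 161)]),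
      (209, 108, 11, []),
      (219, 62, 4, [(29, 1), (1, 0), (135, 35), (35, 29), (135, 75), (75, 61), (138, 132), (132, 130), (233, 228)])]),
   ([0, 29, 61, 237], 184,
     [(84, 30, 2, [(84, 3), (3, 0), (84, 30), (30, 29), (126, 68), (68, 61), (121, 87), (87, 84)]),
      (136, 14, 9, [(136, 75), (75, 61), (164, 131), (131, 130)]),
      (140, 14, 9, [(61, 30), (30, 29), (139, 81), (81, 61), (158, 130)]),
      (199, 14, 9, [(29, 1), (1, 0), (135, 35), (35, 29), (100, 61), (168, 136), (136, 130)]),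
      (135, 48, 12, []),
      (155, 30, 2, [(155, 11), (11, 0), (155, 59), (59, 29), (126, 68), (68, 61), (121, 87), (87, 84)])]),
   ([0, 29, 61, 104], 1856,
     [(84, 254, 3, [(84, 30), (30, 29), (84, 65), (65, 61), (121, 87), (87, 84)]),
      (136, 104, 7, [(136, 130)]),
      (140, 104, 7, [(61, 30), (30, 29), (139, 133), (133, 130)]),
      (179, 104, 7, [(104, 34), (34, 29), (104, 65), (65, 61), (168, 136), (136, 130)]),
      (199, 104, 7, [(29, 1), (1, 0), (135, 35), (35, 29), (135, 75), (75, 61), (168, 136), (136, 130)]),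
      (203, 104, 7, [(29, 1), (1, 0), (178, 82), (82, 29), (178, 130), (130, 65), (65, 61), (133, 130)]),
      (225, 104, 7, [(61, 1), (1, 0), (210, 120), (120, 30), (30, 29)]),
      (155, 254, 3, [(155, 59), (59, 29), (155, 102), (102, 61), (121, 87), (87, 84)]),
      (238, 48, 12, [(238, 237)])]),
   ([0, 29, 120, 188], 928,
     [(126, 62, 4, [(126, 33), (33, 29), (126, 68), (68, 61), (168, 136), (136, 130), (234, 228)]),
      (128, 62, 4, [(29, 1), (1, 0), (128, 33), (33, 29), (128, 71), (71, 61), (139, 133), (133, 130), (231, 228)]),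
      (166, 62, 4, [(120, 7), (7, 0), (166, 67), (67, 29), (68, 61), (159, 130), (233, 228)]),
      (197, 62, 4, [(188, 13), (13, 0), (71, 31), (31, 29), (71, 61), (132, 130)]),
      (90, 220, 5, [(90, 4), (4, 0), (90, 31), (31, 29), (124, 71), (71, 61), (132, 130), (170, 140)]),
      (103, 220, 5, [(103, 1), (1, 0), (103, 33), (33, 29), (111, 65), (65, 61), (133, 130), (173, 140)]),
      (164, 8, 10, [(164, 103), (103, 61)]),
      (182, 8, 10, [(120, 30), (30, 29), (89, 68), (68, 61), (209, 180), (180, 179), (229, 224)]),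
      (227, 8, 10, [(29, 1), (1, 0), (173, 74), (74, 29), (121, 71), (71, 61), (207, 179), (227, 224)]),
      (236, 8, 10, [(120, 7), (7, 0), (150, 57), (57, 29), (182, 179), (232, 224)]),
      (136, 220, 5, [(136, 3), (3, 0), (136, 35), (35, 29), (100, 61), (174, 137), (137, 131), (131, 130), (170, 140)]),
      (149, 220, 5, [(149, 8), (8, 0), (149, 57), (57, 29), (124, 71), (71, 61), (138, 132), (132, 130), (170, 140)]),
      (209, 300, 13, []),
      (226, 300, 13, [(29, 1), (1, 0), (173, 122), (122, 120), (200, 188)])]),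
   ([0, 29, 120, 215], 174,
     [(81, 36, 6, [(81, 2), (2, 0), (81, 31), (31, 29), (133, 71), (71, 61), (132, 130), (205, 175)]),
      (173, 8, 10, [(173, 74), (74, 29), (75, 61)]),
      (200, 8, 10, [(29, 1), (1, 0), (122, 31), (31, 29), (121, 71), (71, 61), (208, 179), (229, 224)]),
      (135, 14, 9, [(135, 35), (35, 29), (135, 75), (75, 61), (168, 136), (136, 130)]),
      (139, 14, 9, [(29, 1), (1, 0), (71, 31), (31, 29), (71, 61), (169, 136), (136, 130)]),
      (158, 36, 6, [(158, 8), (8, 0), (158, 62), (62, 29), (133, 71), (71, 61), (138, 132), (132, 130), (205, 175)]),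
      (238, 24, 14, [])]),
   ([0, 29, 120, 209], 3640,
     [(71, 528, 8, [(71, 31), (31, 29), (71, 61), (132, 130)]),
      (188, 300, 13, []),
      (168, 528, 8, [(168, 72), (72, 29), (168, 106), (106, 61), (132, 130)]),
      (226, 300, 13, [(226, 197), (197, 191), (191, 188)])]),
   ([0, 29, 216, 238], 720,
     [(75, 108, 11, [(75, 2), (2, 0), (75, 30), (30, 29), (130, 65), (65, 61), (209, 180), (180, 179)]),
      (164, 108, 11, [(164, 14), (14, 0), (164, 66), (66, 29), (130, 65), (65, 61), (209, 180), (180, 179)])])]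

theorem leaf5 : leafChk 4 K5 = true := by decide +kernel
theorem st4 : stepChk 5 K5 S4 = true := by decide +kernel
theorem st3 : stepChk 6 K4 S3 = true := by decide +kernel
theorem st2 : stepChk 7 K3 S2 = true := by decide +kernel
theorem st1 : stepChk 8 K2 S1 = true := by decide +kernel
theorem st0 : stepChk 9 K1 S0 = true := by decide +kernel

theorem kn5 : known 5 K5 := leafChk_ok 4 K5 leaf5
theorem kn4 : known 6 K4 := stepChk_ok 5 K5 K4 S4 kn5 st4 rfl
theorem kn3 : known 7 K3 := stepChk_ok 6 K4 K3 S3 kn4 st3 rfl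
theorem kn2 : known 8 K2 := stepChk_ok 7 K3 K2 S2 kn3 st2 rfl
theorem kn1 : known 9 K1 := stepChk_ok 8 K2 K1 S1 kn2 st1 rfl
theorem kn0 : known 10 K0 := stepChk_ok 9 K1 K0 S0 kn1 st0 rfl

end DP1

/-- There are exactly 107,700,096 ten-element cliques in `C` with weights in `{1,2}`. -/
theorem stmt3 :
    {S : Finset Exc | S.card = 10 ∧ IsClique {1, 2} S}.ncard = 107700096 := by
  rw [DP1.FE_nil]
  exact DP1.kn0 ([], 107700096) List.mem_cons_self
end
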